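/- (Conservation laws) Let m ≥ 1 be an integer and let u be a classical m-equivariant solution of CSS on an open interval I such that for each compact J ⊆ I and all integers j, k ≥ 0 with j + k ≤ 2, sup_{t∈J} 2π·∫₀^∞ (1 + r⁴)·|∂_t^j ∂_r^k u(t,r)|²·r dr < ∞. Then both the mass M[u(t,·)] = ‖u(t,·)‖_{L²}² and the energy E[u(t,·)] are constant functions of t on I. -/

import Mathlib

open MeasureTheory Set Filter

noncomputable section

/-- The Jackiw–Pi vortex `Q(r) = √8 (m+1) r^m / (1 + r^(2m+2))`. -/
def Q (m : ℕ) (r : ℝ) : ℝ :=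
  Real.sqrt 8 * (m + 1) * r ^ m / (1 + r ^ (2 * m + 2))

/-- `A_θ[u](r) = -(1/2) ∫₀^r |u(r')|² r' dr'`. -/
def Atheta (u : ℝ → ℂ) (r : ℝ) : ℝ :=
  -(1 / 2) * ∫ s in (0:ℝ)..r, ‖u s‖ ^ 2 * s

/-- Bilinear version `A_θ[f,g](r) = -(1/2) ∫₀^r Re(conj f g) r' dr'`. -/
def Atheta2 (f g : ℝ → ℂ) (r : ℝ) : ℝ :=
  -(1 / 2) * ∫ s in (0:ℝ)..r, ((starRingEnd ℂ) (f s) * g s).re * s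

/-- `A_t[u](r) = -∫_r^∞ (m + A_θ[u](r')) |u(r')|² / r' dr'`. -/
def At (m : ℕ) (u : ℝ → ℂ) (r : ℝ) : ℝ :=
  -∫ s in Set.Ioi r, ((m : ℝ) + Atheta u s) * ‖u s‖ ^ 2 / s

/-- Squared (2D radial) `L²` norm: `‖u‖² = 2π ∫₀^∞ |u(r)|² r dr`. -/
def L2sq (u : ℝ → ℂ) : ℝ :=
  2 * Real.pi * ∫ r in Set.Ioi (0:ℝ), ‖u r‖ ^ 2 * r

/-- Squared equivariant `Ḣ¹_m` norm. -/
def H1msq (m : ℕ) (u : ℝ → ℂ) : ℝ :=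
  2 * Real.pi * ∫ r in Set.Ioi (0:ℝ), (‖deriv u r‖ ^ 2 + (m : ℝ) ^ 2 * ‖u r‖ ^ 2 / r ^ 2) * r

/-- The energy functional. -/
def Energy (m : ℕ) (u : ℝ → ℂ) : ℝ :=
  2 * Real.pi * ∫ r in Set.Ioi (0:ℝ),
    ((1 / 2) * ‖deriv u r‖ ^ 2
      + (1 / 2) * (((m : ℝ) + Atheta u r) / r) ^ 2 * ‖u r‖ ^ 2
      - (1 / 4) * ‖u r‖ ^ 4) * r

/-- The Chern–Simons–Schrödinger equation at the point `(t, r)`: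
`i ∂_t u - A_t[u] u + ∂_r² u + (1/r) ∂_r u - ((m + A_θ[u])/r)² u + |u|² u = 0`. -/
def CSSeq (m : ℕ) (u : ℝ → ℝ → ℂ) (t r : ℝ) : Prop :=
  Complex.I * deriv (fun s => u s r) t
    - (At m (u t) r : ℂ) * u t r
    + deriv (deriv (u t)) r
    + (1 / (r : ℂ)) * deriv (u t) r
    - ((((m : ℝ) + Atheta (u t) r) / r : ℝ) : ℂ) ^ 2 * u t r
    + ((‖u t r‖ : ℝ) : ℂ) ^ 2 * u t r = 0

/-- A classical `m`-equivariant solution of CSS on the open interval `I`. -/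
structure IsCSS (m : ℕ) (I : Set ℝ) (u : ℝ → ℝ → ℂ) : Prop where
  smooth : ContDiffOn ℝ (⊤ : ℕ∞) (fun p : ℝ × ℝ => u p.1 p.2) (I ×ˢ Set.Ioi (0:ℝ))
  integrable : ∀ t ∈ I, IntegrableOn (fun r => ‖u t r‖ ^ 2 * r) (Set.Ioi (0:ℝ))
  equivariant : ∃ U : ℝ → ℝ × ℝ → ℂ,
    ContDiffOn ℝ (⊤ : ℕ∞) (fun p : ℝ × (ℝ × ℝ) => U p.1 p.2) (I ×ˢ (Set.univ : Set (ℝ × ℝ))) ∧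
    ∀ t ∈ I, ∀ x : ℝ × ℝ, x ≠ 0 →
      U t x = u t (Real.sqrt (x.1 ^ 2 + x.2 ^ 2)) *
        (((x.1 : ℂ) + (x.2 : ℂ) * Complex.I) / ((Real.sqrt (x.1 ^ 2 + x.2 ^ 2) : ℝ) : ℂ)) ^ m
  bounded : ∀ J : Set ℝ, J ⊆ I → IsCompact J → ∃ C : ℝ, ∀ t ∈ J,
    Real.sqrt (L2sq (u t)) + Real.sqrt (H1msq m (u t)) ≤ C
  eq : ∀ t ∈ I, ∀ r : ℝ, 0 < r → CSSeq m u t r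

/-- Tightness: uniformly small mass near spatial infinity. -/
def Tight (I : Set ℝ) (u : ℝ → ℝ → ℂ) : Prop :=
  ∀ η : ℝ, 0 < η → ∃ R : ℝ, ∀ t ∈ I,
    2 * Real.pi * ∫ r in Set.Ioi R, ‖u t r‖ ^ 2 * r < η

/-- The real inner product `(f,g)_r = Re (2π ∫₀^∞ f conj(g) r dr)`. -/
def iprod (f g : ℝ → ℂ) : ℝ :=
  2 * Real.pi * (∫ r in Set.Ioi (0:ℝ), f r * (starRingEnd ℂ) (g r) * (r : ℂ)).re

/-- `ΛQ = r Q' + Q`. -/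
def LamQ (m : ℕ) (r : ℝ) : ℝ := r * deriv (Q m) r + Q m r

/-- The linearized Bogomol'nyi operator `L_Q`. -/
def LQ (m : ℕ) (f : ℝ → ℂ) (r : ℝ) : ℂ :=
  deriv f r - ((((m : ℝ) + Atheta (fun s => (Q m s : ℂ)) r) / r : ℝ) : ℂ) * f r
    - ((2 * Atheta2 (fun s => (Q m s : ℂ)) f r / r : ℝ) : ℂ) * (Q m r : ℂ)

end

section Aux

open scoped ContDiff Topology


def Sm (f : ℝ × ℝ → ℝ) : Prop := ContDiff ℝ ∞ f

noncomputable def dT (f : ℝ × ℝ → ℝ) (p : ℝ × ℝ) : ℝ := fderiv ℝ f p (1, 0)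
noncomputable def dR (f : ℝ × ℝ → ℝ) (p : ℝ × ℝ) : ℝ := fderiv ℝ f p (0, 1)

theorem Sm.cont {f : ℝ × ℝ → ℝ} (hf : Sm f) : Continuous f := ContDiff.continuous hf

theorem Sm.diff {f : ℝ × ℝ → ℝ} (hf : Sm f) : Differentiable ℝ f :=
  ContDiff.differentiable hf (by simp)

theorem Sm.dT {f : ℝ × ℝ → ℝ} (hf : Sm f) : Sm (dT f) := by
  have h : ContDiff ℝ ∞ (fderiv ℝ f) := ContDiff.fderiv_right hf (by simp)
  exact h.clm_apply contDiff_const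

theorem Sm.dR {f : ℝ × ℝ → ℝ} (hf : Sm f) : Sm (dR f) := by
  have h : ContDiff ℝ ∞ (fderiv ℝ f) := ContDiff.fderiv_right hf (by simp)
  exact h.clm_apply contDiff_const

theorem Sm.hasT {f : ℝ × ℝ → ℝ} (hf : Sm f) (t r : ℝ) :
    HasDerivAt (fun s => f (s, r)) (_root_.dT f (t, r)) t := by
  have h1 : HasDerivAt (fun s : ℝ => (s, r)) ((1 : ℝ), (0 : ℝ)) t :=
    (hasDerivAt_id t).prodMk (hasDerivAt_const t r)
  exact (hf.diff (t, r)).hasFDerivAt.comp_hasDerivAt t h1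

theorem Sm.hasR {f : ℝ × ℝ → ℝ} (hf : Sm f) (t r : ℝ) :
    HasDerivAt (fun s => f (t, s)) (_root_.dR f (t, r)) r := by
  have h1 : HasDerivAt (fun s : ℝ => (t, s)) ((0 : ℝ), (1 : ℝ)) r :=
    (hasDerivAt_const r t).prodMk (hasDerivAt_id r)
  exact (hf.diff (t, r)).hasFDerivAt.comp_hasDerivAt r h1

theorem Sm.comm {f : ℝ × ℝ → ℝ} (hf : Sm f) (p : ℝ × ℝ) :
    _root_.dT (_root_.dR f) p = _root_.dR (_root_.dT f) p := by
  have h : ContDiff ℝ ∞ (fderiv ℝ f) := ContDiff.fderiv_right hf (by simp)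
  have hd : DifferentiableAt ℝ (fderiv ℝ f) p := h.differentiable (by simp) p
  have key : ∀ v w : ℝ × ℝ, fderiv ℝ (fun q => fderiv ℝ f q v) p w
      = fderiv ℝ (fderiv ℝ f) p w v := by
    intro v w
    rw [fderiv_clm_apply hd (differentiableAt_const v)]
    simp
  unfold _root_.dT _root_.dR
  rw [key, key]
  exact (ContDiff.contDiffAt hf).isSymmSndFDerivAt (by simp; exact WithTop.coe_le_coe.2 le_top) _ _

noncomputable def II (α β a b : ℝ) (F : ℝ × ℝ → ℝ) : ℝ := ∫ t in α..β, ∫ r in a..b, F (t, r)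

theorem cr {F : ℝ × ℝ → ℝ} (hF : Continuous F) (t : ℝ) : Continuous (fun r => F (t, r)) := by
  fun_prop

theorem ct {F : ℝ × ℝ → ℝ} (hF : Continuous F) (r : ℝ) : Continuous (fun t => F (t, r)) := by
  fun_prop

theorem ci {F : ℝ × ℝ → ℝ} (hF : Continuous F) (a b : ℝ) :
    Continuous (fun t => ∫ r in a..b, F (t, r)) :=
  intervalIntegral.continuous_parametric_intervalIntegral_of_continuous' (by exact hF) a b

theorem II_mono {α β a b : ℝ} (h1 : α ≤ β) (h2 : a ≤ b) {F G : ℝ × ℝ → ℝ} (hF : Continuous F)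
    (hG : Continuous G) (h : ∀ t ∈ Icc α β, ∀ r ∈ Icc a b, F (t, r) ≤ G (t, r)) :
    II α β a b F ≤ II α β a b G := by
  refine intervalIntegral.integral_mono_on h1 ((ci hF a b).intervalIntegrable _ _)
    ((ci hG a b).intervalIntegrable _ _) fun t ht => ?_
  exact intervalIntegral.integral_mono_on h2 ((cr hF t).intervalIntegrable _ _)
    ((cr hG t).intervalIntegrable _ _) (h t ht)

theorem II_add {α β a b : ℝ} {F G : ℝ × ℝ → ℝ} (hF : Continuous F) (hG : Continuous G) :
    II α β a b (fun p => F p + G p) = II α β a b F + II α β a b G := by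
  unfold II
  rw [← intervalIntegral.integral_add ((ci hF a b).intervalIntegrable _ _)
    ((ci hG a b).intervalIntegrable _ _)]
  congr 1; ext t
  exact intervalIntegral.integral_add ((cr hF t).intervalIntegrable _ _)
    ((cr hG t).intervalIntegrable _ _)

theorem II_mul {α β a b c : ℝ} {F : ℝ × ℝ → ℝ} :
    II α β a b (fun p => c * F p) = c * II α β a b F := by
  unfold II; simp

theorem II_const {α β a b c : ℝ} :
    II α β a b (fun _ => c) = c * (β - α) * (b - a) := by
  unfold II; simp; ring

theorem II_nonneg {α β a b : ℝ} (h1 : α ≤ β) (h2 : a ≤ b) {F : ℝ × ℝ → ℝ}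
    (h : ∀ t ∈ Icc α β, ∀ r ∈ Icc a b, 0 ≤ F (t, r)) : 0 ≤ II α β a b F :=
  intervalIntegral.integral_nonneg h1 fun t ht => intervalIntegral.integral_nonneg h2 (h t ht)

theorem int_subset {f : ℝ → ℝ} (hf : Continuous f) {a b c d : ℝ} (h1 : a ≤ c) (h2 : c ≤ d)
    (h3 : d ≤ b) (h0 : ∀ r ∈ Icc a b, 0 ≤ f r) : ∫ r in c..d, f r ≤ ∫ r in a..b, f r := by
  have i := fun x y => hf.intervalIntegrable (μ := volume) x y
  rw [← intervalIntegral.integral_add_adjacent_intervals (i a c) (i c b),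
    ← intervalIntegral.integral_add_adjacent_intervals (i c d) (i d b)]
  have e1 : 0 ≤ ∫ r in a..c, f r := intervalIntegral.integral_nonneg h1
    fun r hr => h0 r ⟨hr.1, by linarith [hr.2]⟩
  have e2 : 0 ≤ ∫ r in d..b, f r := intervalIntegral.integral_nonneg h3
    fun r hr => h0 r ⟨by linarith [hr.1], hr.2⟩
  linarith

theorem II_subset {α β α' β' a b c d : ℝ} (g1 : α ≤ α') (g2 : α' ≤ β') (g3 : β' ≤ β)
    (h1 : a ≤ c) (h2 : c ≤ d)
    (h3 : d ≤ b) {F : ℝ × ℝ → ℝ} (hF : Continuous F)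
    (h : ∀ t ∈ Icc α β, ∀ r ∈ Icc a b, 0 ≤ F (t, r)) : II α' β' c d F ≤ II α β a b F := by
  unfold II
  calc _ ≤ ∫ t in α'..β', ∫ r in a..b, F (t, r) := by
        refine intervalIntegral.integral_mono_on g2 ((ci hF c d).intervalIntegrable _ _)
          ((ci hF a b).intervalIntegrable _ _) fun t ht => ?_
        exact int_subset (cr hF t) h1 h2 h3 (h t ⟨by linarith [ht.1], by linarith [ht.2]⟩)
    _ ≤ _ := int_subset (ci hF a b) g1 g2 g3 fun t ht =>
        intervalIntegral.integral_nonneg (by linarith) (h t ht)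

theorem II_swap {α β a b : ℝ} {F : ℝ × ℝ → ℝ} (hF : Continuous F) :
    II α β a b F = ∫ r in a..b, ∫ t in α..β, F (t, r) := by
  unfold II
  apply MeasureTheory.intervalIntegral_intervalIntegral_swap (F := fun t r => F (t, r))
  have : IntegrableOn F (uIcc α β ×ˢ uIcc a b) :=
    hF.continuousOn.integrableOn_compact (isCompact_uIcc.prod isCompact_uIcc)
  rw [IntegrableOn, Measure.volume_eq_prod, ← Measure.prod_restrict] at this
  rw [Measure.prod_restrict] at *
  exact IntegrableOn.mono_set this (Set.prod_mono uIoc_subset_uIcc uIoc_subset_uIcc)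

noncomputable def gA (x y : ℝ × ℝ → ℝ) (p : ℝ × ℝ) : ℝ := dR (dR x) p - dT y p
noncomputable def gB (x y : ℝ × ℝ → ℝ) (p : ℝ × ℝ) : ℝ := dR (dR y) p + dT x p

theorem Sm.gA {x y : ℝ × ℝ → ℝ} (hx : Sm x) (hy : Sm y) : Sm (gA x y) :=
  ContDiff.sub hx.dR.dR hy.dT
theorem Sm.gB {x y : ℝ × ℝ → ℝ} (hx : Sm x) (hy : Sm y) : Sm (gB x y) :=
  ContDiff.add hy.dR.dR hx.dT

theorem zeroDR {x : ℝ × ℝ → ℝ} (hx : Sm x) {c : ℝ} (h : ∀ t r, r < c → x (t, r) = 0) :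
    ∀ t r, r < c → dR x (t, r) = 0 := by
  intro t r hr
  have h1 := hx.hasR t r
  have h2 : (fun s => x (t, s)) =ᶠ[𝓝 r] fun _ => 0 := by
    filter_upwards [Iio_mem_nhds hr] with s hs using h t s hs
  exact h1.unique ((hasDerivAt_const r (0:ℝ)).congr_of_eventuallyEq h2)

theorem hasDerivAt_int' {f f' : ℝ × ℝ → ℝ} (cf : Continuous f) (cf' : Continuous f')
    (hf : ∀ t r, HasDerivAt (fun s => f (s, r)) (f' (t, r)) t) (a b t : ℝ) :
    HasDerivAt (fun t => ∫ r in a..b, f (t, r)) (∫ r in a..b, f' (t, r)) t := by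
  obtain ⟨C, hC⟩ := ((isCompact_Icc (a := t - 1) (b := t + 1)).prod
    (isCompact_uIcc (a := a) (b := b))).exists_bound_of_continuousOn
    (f := f') cf'.continuousOn
  refine (intervalIntegral.hasDerivAt_integral_of_dominated_loc_of_deriv_le (𝕜 := ℝ)
    (F := fun t r => f (t, r)) (F' := fun t r => f' (t, r))
    (bound := fun _ => C) (s := Metric.ball t 1)
    (Metric.ball_mem_nhds t one_pos) ?_ ?_ ?_ ?_ ?_ ?_).2
  · exact Eventually.of_forall fun s => (cr cf s).aestronglyMeasurable
  · exact (cr cf t).intervalIntegrable _ _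
  · exact (cr cf' t).aestronglyMeasurable
  · refine Eventually.of_forall fun r hr s hs => hC (s, r) ⟨?_, uIoc_subset_uIcc hr⟩
    rw [Metric.mem_ball, Real.dist_eq, abs_lt] at hs
    constructor <;> simp <;> linarith [hs.1, hs.2]
  · exact intervalIntegrable_const
  · exact Eventually.of_forall fun r _ s _ => hf s r

theorem q_hasT {x y : ℝ × ℝ → ℝ} (hx : Sm x) (hy : Sm y) (t r : ℝ) :
    HasDerivAt (fun s => x (s, r) ^ 2 + y (s, r) ^ 2)
      (2 * (x (t, r) * dT x (t, r) + y (t, r) * dT y (t, r))) t := by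
  refine (((hx.hasT t r).fun_pow 2).fun_add ((hy.hasT t r).fun_pow 2)).congr_deriv ?_
  push_cast; ring

theorem q_hasR {x y : ℝ × ℝ → ℝ} (hx : Sm x) (hy : Sm y) (t r : ℝ) :
    HasDerivAt (fun s => x (t, s) ^ 2 + y (t, s) ^ 2)
      (2 * (x (t, r) * dR x (t, r) + y (t, r) * dR y (t, r))) r := by
  refine (((hx.hasR t r).fun_pow 2).fun_add ((hy.hasR t r).fun_pow 2)).congr_deriv ?_
  push_cast; ring

theorem j_hasR {x y : ℝ × ℝ → ℝ} (hx : Sm x) (hy : Sm y) (t r : ℝ) :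
    HasDerivAt (fun s => 2 * (x (t, s) * dR y (t, s) - y (t, s) * dR x (t, s)))
      (2 * (x (t, r) * dR (dR y) (t, r) - y (t, r) * dR (dR x) (t, r))) r := by
  refine ((((hx.hasR t r).fun_mul (hy.dR.hasR t r)).fun_sub
    ((hy.hasR t r).fun_mul (hx.dR.hasR t r))).const_mul 2).congr_deriv ?_
  ring

theorem cs_aux {A B I : ℝ} (h : ∀ l : ℝ, 0 ≤ A * (l * l) + (-2 * I) * l + B) : I ^ 2 ≤ A * B := by
  have := discrim_le_zero h
  unfold discrim at this
  nlinarith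

theorem int_cs {f g : ℝ → ℝ} (hf : Continuous f) (hg : Continuous g) {a b : ℝ} (hab : a ≤ b) :
    (∫ r in a..b, f r * g r) ^ 2 ≤ (∫ r in a..b, f r ^ 2) * ∫ r in a..b, g r ^ 2 := by
  apply cs_aux
  intro l
  have : 0 ≤ ∫ r in a..b, (l * f r - g r) ^ 2 :=
    intervalIntegral.integral_nonneg hab fun _ _ => sq_nonneg _
  have e : ∫ r in a..b, (l * f r - g r) ^ 2 = ∫ r in a..b, ((l * l) * f r ^ 2 + (-2 * l) * (f r * g r) + g r ^ 2) := by
    congr 1; ext r; ring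
  rw [e, intervalIntegral.integral_add, intervalIntegral.integral_add,
    intervalIntegral.integral_const_mul, intervalIntegral.integral_const_mul] at this
  · linarith
  all_goals apply Continuous.intervalIntegrable; fun_prop

theorem bdd {F : ℝ × ℝ → ℝ} (hF : Continuous F) (α β a b : ℝ) :
    ∃ C, 0 ≤ C ∧ ∀ t ∈ Icc α β, ∀ r ∈ Icc a b, |F (t, r)| ≤ C := by
  obtain ⟨C, hC⟩ := ((isCompact_Icc (a := α) (b := β)).prod
    (isCompact_Icc (a := a) (b := b))).exists_bound_of_continuousOn (f := F) hF.continuousOn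
  exact ⟨max C 0, le_max_right _ _, fun t ht r hr => (hC (t, r) ⟨ht, hr⟩).trans (le_max_left _ _)⟩

structure ZD (x y W : ℝ × ℝ → ℝ) (T c M : ℝ) : Prop where
  hx : Sm x
  hy : Sm y
  zx : ∀ t r, r ≤ 1 → x (t, r) = 0
  zy : ∀ t r, r ≤ 1 → y (t, r) = 0
  hT : 0 < T
  hc : 0 ≤ c
  hM1 : 1 ≤ M
  e1 : ∀ t ∈ Icc (-T) T, ∀ r, 2 ≤ r →
    gA x y (t, r) = -((x (t, r) ^ 2 + y (t, r) ^ 2) / r + W (t, r)) * x (t, r)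
  e2 : ∀ t ∈ Icc (-T) T, ∀ r, 2 ≤ r →
    gB x y (t, r) = -((x (t, r) ^ 2 + y (t, r) ^ 2) / r + W (t, r)) * y (t, r)
  hW : ∀ t ∈ Icc (-T) T, ∀ r, 2 ≤ r → |W (t, r)| ≤ c
  hL : ∀ t ∈ Icc (-T) T, ∀ r s, 2 ≤ r → 2 ≤ s → |W (t, r) - W (t, s)| ≤ c * |r - s|
  hM : ∀ t ∈ Icc (-T) T, ∀ b, 0 ≤ b → ∫ r in (0:ℝ)..b, (x (t, r) ^ 2 + y (t, r) ^ 2) ≤ M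

noncomputable def ps (T t : ℝ) : ℝ := T ^ 2 - t ^ 2

theorem ps_cont (T : ℝ) : Continuous (ps T) := by unfold ps; fun_prop
theorem ps_has (T t : ℝ) : HasDerivAt (ps T) (-2 * t) t := by
  unfold ps
  refine ((hasDerivAt_const t (T ^ 2)).fun_sub ((hasDerivAt_id' t).fun_pow 2)).congr_deriv ?_
  push_cast; ring
theorem ps_nonneg {T t : ℝ} (h : t ∈ Icc (-T) T) : 0 ≤ ps T t := by
  unfold ps; nlinarith [h.1, h.2]
theorem ps_le {T t : ℝ} : ps T t ≤ T ^ 2 := by unfold ps; nlinarith [sq_nonneg t]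

theorem bdd6 {F1 F2 F3 F4 F5 F6 : ℝ × ℝ → ℝ} (h1 : Continuous F1) (h2 : Continuous F2)
    (h3 : Continuous F3) (h4 : Continuous F4) (h5 : Continuous F5) (h6 : Continuous F6)
    (α β a b : ℝ) : ∃ K, 0 ≤ K ∧ ∀ t ∈ Icc α β, ∀ r ∈ Icc a b, |F1 (t, r)| ≤ K ∧ |F2 (t, r)| ≤ K ∧
      |F3 (t, r)| ≤ K ∧ |F4 (t, r)| ≤ K ∧ |F5 (t, r)| ≤ K ∧ |F6 (t, r)| ≤ K := by
  obtain ⟨K, h0, hK⟩ := bdd (F := fun p => |F1 p| + |F2 p| + |F3 p| + |F4 p| + |F5 p| + |F6 p|)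
    (by fun_prop) α β a b
  refine ⟨K, h0, fun t ht r hr => ?_⟩
  have := (le_abs_self _).trans (hK t ht r hr)
  have a1 := abs_nonneg (F1 (t, r)); have a2 := abs_nonneg (F2 (t, r))
  have a3 := abs_nonneg (F3 (t, r)); have a4 := abs_nonneg (F4 (t, r))
  have a5 := abs_nonneg (F5 (t, r)); have a6 := abs_nonneg (F6 (t, r))
  refine ⟨?_, ?_, ?_, ?_, ?_, ?_⟩ <;> linarith



noncomputable def rho (r : ℝ) : ℝ := (max (1 + r) (1 / 2))⁻¹
theorem rho_cont : Continuous rho := by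
  unfold rho
  exact ((continuous_const.add continuous_id).max continuous_const).inv₀ fun r => by
    have : (0:ℝ) < max (1 + r) (1 / 2) := lt_of_lt_of_le (by norm_num) (le_max_right _ _)
    exact this.ne'
theorem rho_eq {r : ℝ} (h : -(1/2) ≤ r) : rho r = (1 + r)⁻¹ := by
  unfold rho; rw [max_eq_left (by linarith)]
theorem rho_pos (r : ℝ) : 0 < rho r := by
  unfold rho
  have : (0:ℝ) < max (1 + r) (1 / 2) := lt_of_lt_of_le (by norm_num) (le_max_right _ _)
  positivity
theorem rho_le {r : ℝ} (h : 0 ≤ r) : rho r ≤ 1 := by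
  rw [rho_eq (by linarith)]; exact inv_le_one_of_one_le₀ (by linarith)
theorem rho_mul {r : ℝ} (h : 0 ≤ r) : rho r * (1 + r) = 1 := by
  rw [rho_eq (by linarith)]; exact inv_mul_cancel₀ (by linarith)
theorem rho_has {r : ℝ} (h : 0 ≤ r) : HasDerivAt rho (-(rho r) ^ 2) r := by
  have h1 : HasDerivAt (fun s : ℝ => (1 + s)⁻¹) (-1 / (1 + r) ^ 2) r :=
    ((hasDerivAt_id' r).const_add 1).inv (by linarith)
  have h2 : rho =ᶠ[𝓝 r] fun s => (1 + s)⁻¹ := by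
    filter_upwards [Ioi_mem_nhds (show -(1/2) < r by linarith)] with s hs
    exact rho_eq (le_of_lt hs)
  refine (h1.congr_of_eventuallyEq h2).congr_deriv ?_
  rw [rho_eq (by linarith)]; field_simp

theorem morId {x y : ℝ × ℝ → ℝ} (hx : Sm x) (hy : Sm y)
    (zx : ∀ t r, r < 1 / 2 → x (t, r) = 0) (zy : ∀ t r, r < 1 / 2 → y (t, r) = 0)
    {e e1 : ℝ → ℝ} (he : ∀ t, HasDerivAt e (e1 t) t) 
    (ce1 : Continuous e1) {α β : ℝ} (h1 : e α = 0) (h2 : e β = 0) 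
    {b : ℝ} (hb : 0 ≤ b) {f f1 f2 : ℝ → ℝ} (cf : Continuous f) (cf1 : Continuous f1) (cf2 : Continuous f2)
    (hf : ∀ r, 0 ≤ r → HasDerivAt f (f1 r) r) (hf1 : ∀ r, 0 ≤ r → HasDerivAt f1 (f2 r) r)
    (fb : f b = 0) (f1b : f1 b = 0) :
    II α β 0 b (fun p => e1 p.1 * (f p.2 * (x p * dR y p - y p * dR x p))
      + e p.1 * (2 * f1 p.2 * (dR x p ^ 2 + dR y p ^ 2) + 2 * f p.2 * (dR x p * gA x y p + dR y p * gB x y p)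
        + f1 p.2 * (x p * gA x y p + y p * gB x y p) + f2 p.2 * (x p * dR x p + y p * dR y p))) = 0 := by
  have ce : Continuous e := continuous_iff_continuousAt.2 fun t => (he t).continuousAt
  have c1 := hx.cont; have c2 := hy.cont; have c3 := hx.dR.cont; have c4 := hy.dR.cont
  have c5 := hx.dT.cont; have c6 := hy.dT.cont; have c7 := hx.dR.dR.cont
  have c8 := hy.dR.dR.cont; have c9 := (hx.gA hy).cont; have c10 := (hx.gB hy).cont
  have c11 := hx.dR.dT.cont; have c12 := hy.dR.dT.cont
  have z1 : ∀ t, x (t, 0) = 0 := fun t => zx t 0 (by norm_num)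
  have z2 : ∀ t, y (t, 0) = 0 := fun t => zy t 0 (by norm_num)
  have z3 : ∀ t, dR x (t, 0) = 0 := fun t => zeroDR hx zx t 0 (by norm_num)
  have z4 : ∀ t, dR y (t, 0) = 0 := fun t => zeroDR hy zy t 0 (by norm_num)
  set D : ℝ × ℝ → ℝ := fun p => 2 * f1 p.2 * (dR x p ^ 2 + dR y p ^ 2) + 2 * f p.2 * (dR x p * gA x y p + dR y p * gB x y p)
        + f1 p.2 * (x p * gA x y p + y p * gB x y p) + f2 p.2 * (x p * dR x p + y p * dR y p) with hD
  have cD : Continuous D := by fun_prop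
  set j : ℝ × ℝ → ℝ := fun p => f p.2 * (x p * dR y p - y p * dR x p) with hj
  have cj : Continuous j := by fun_prop
  have hK' : ∀ t, HasDerivAt (fun t => ∫ r in (0:ℝ)..b, j (t, r)) (∫ r in (0:ℝ)..b, D (t, r)) t := by
    intro t
    have h := hasDerivAt_int' (f := j)
      (f' := fun p => f p.2 * ((dT x p * dR y p + x p * dT (dR y) p
        - (dT y p * dR x p + y p * dT (dR x) p))))
      (by fun_prop) (by fun_prop) (fun t r => ((((hx.hasT t r).fun_mul (hy.dR.hasT t r)).fun_sub
    ((hy.hasT t r).fun_mul (hx.dR.hasT t r)))).const_mul (f r)) 0 b t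
    refine h.congr_deriv ?_
    rw [← sub_eq_zero, ← intervalIntegral.integral_sub]
    · rw [intervalIntegral.integral_eq_sub_of_hasDerivAt (f := fun r =>
        f r * ((x (t, r) * dT y (t, r) - y (t, r) * dT x (t, r))
          - (dR x (t, r) ^ 2 + dR y (t, r) ^ 2))
        - f1 r * (x (t, r) * dR x (t, r) + y (t, r) * dR y (t, r)))]
      · simp [z1, z2, z3, z4, fb, f1b]
      · intro r hr
        rw [uIcc_of_le hb] at hr
        refine (((hf r hr.1).fun_mul ((((hx.hasR t r).fun_mul (hy.dT.hasR t r)).fun_sub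
          ((hy.hasR t r).fun_mul (hx.dT.hasR t r))).fun_sub
          (((hx.dR.hasR t r).fun_pow 2).fun_add ((hy.dR.hasR t r).fun_pow 2)))).fun_sub
          ((hf1 r hr.1).fun_mul (((hx.hasR t r).fun_mul (hx.dR.hasR t r)).fun_add
          ((hy.hasR t r).fun_mul (hy.dR.hasR t r))))).congr_deriv ?_
        simp only [hD, gA, gB, ← hx.comm, ← hy.comm]
        push_cast; ring
      · apply Continuous.intervalIntegrable; fun_prop
    all_goals apply Continuous.intervalIntegrable; fun_prop
  have key : ∫ t in α..β, (e1 t * (∫ r in (0:ℝ)..b, j (t, r)) + e t * (∫ r in (0:ℝ)..b, D (t, r))) = 0 := by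
    rw [intervalIntegral.integral_eq_sub_of_hasDerivAt (f := fun t => e t * ∫ r in (0:ℝ)..b, j (t, r))]
    · simp [h1, h2]
    · intro t _
      exact (he t).fun_mul (hK' t)
    · have := ci cj 0 b; have := ci cD 0 b
      apply Continuous.intervalIntegrable; fun_prop
  refine Eq.trans ?_ key
  unfold II
  congr 1; ext t
  rw [← intervalIntegral.integral_const_mul, ← intervalIntegral.integral_const_mul,
    ← intervalIntegral.integral_add]
  all_goals apply Continuous.intervalIntegrable; fun_prop

noncomputable def vb (b r : ℝ) : ℝ := 1 - r / b
noncomputable def F0 (b r : ℝ) : ℝ := -(vb b r ^ 3 * rho r)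
noncomputable def F1 (b r : ℝ) : ℝ := vb b r ^ 3 * rho r ^ 2 + 3 * vb b r ^ 2 * b⁻¹ * rho r
noncomputable def F2 (b r : ℝ) : ℝ := -2 * vb b r ^ 3 * rho r ^ 3 - 6 * vb b r ^ 2 * b⁻¹ * rho r ^ 2
  - 6 * vb b r * b⁻¹ ^ 2 * rho r

theorem vb_cont (b : ℝ) : Continuous (vb b) := by unfold vb; fun_prop
theorem vb_has (b r : ℝ) : HasDerivAt (vb b) (-b⁻¹) r := by
  unfold vb
  refine ((hasDerivAt_const r (1:ℝ)).fun_sub ((hasDerivAt_id' r).div_const b)).congr_deriv ?_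
  rw [one_div]; ring
theorem F0_cont (b : ℝ) : Continuous (F0 b) := by
  have := vb_cont b; have := rho_cont; unfold F0; fun_prop
theorem F1_cont (b : ℝ) : Continuous (F1 b) := by
  have := vb_cont b; have := rho_cont; unfold F1; fun_prop
theorem F2_cont (b : ℝ) : Continuous (F2 b) := by
  have := vb_cont b; have := rho_cont; unfold F2; fun_prop
theorem F0_has {b r : ℝ} (h : 0 ≤ r) : HasDerivAt (F0 b) (F1 b r) r := by
  refine (((vb_has b r).fun_pow 3).fun_mul (rho_has h)).fun_neg.congr_deriv ?_
  unfold F1; push_cast; ring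
theorem F1_has {b r : ℝ} (h : 0 ≤ r) : HasDerivAt (F1 b) (F2 b r) r := by
  refine ((((vb_has b r).fun_pow 3).fun_mul ((rho_has h).fun_pow 2)).fun_add
    (((((vb_has b r).fun_pow 2).const_mul 3).mul_const b⁻¹).fun_mul (rho_has h))).congr_deriv ?_
  unfold F2; push_cast; ring

theorem wt {b r : ℝ} (hb : 1 ≤ b) (h0 : 0 ≤ r) (h1 : r ≤ b) :
    0 ≤ vb b r ∧ vb b r ≤ 1 ∧ |F0 b r| ≤ vb b r * rho r ∧ vb b r ^ 2 * rho r ^ 2 ≤ F1 b r ∧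
    F1 b r ≤ 7 * (vb b r ^ 2 * rho r ^ 2) ∧ |F2 b r| ≤ 38 * (vb b r * rho r) ∧ F0 b r ≤ 0 := by
  have bp : 0 < b := by linarith
  have v0 : 0 ≤ vb b r := by unfold vb; rw [sub_nonneg, div_le_one bp]; exact h1
  have v1 : vb b r ≤ 1 := by unfold vb; have : 0 ≤ r / b := by positivity
                             linarith
  have r0 := (rho_pos r).le
  have r1 := rho_le h0
  have rm := rho_mul h0
  have bi : b⁻¹ ≤ 2 * rho r := by
    rw [inv_le_iff_one_le_mul₀ bp]; nlinarith
  have bi0 : 0 ≤ b⁻¹ := by positivity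
  have ve : vb b r = 1 - r * b⁻¹ := by unfold vb; rw [div_eq_mul_inv]
  set v := vb b r
  set s := rho r
  set k := b⁻¹
  have v3 : v ^ 3 ≤ v := by nlinarith [mul_nonneg v0 (sub_nonneg.2 v1), mul_nonneg (mul_nonneg v0 v0) (sub_nonneg.2 v1)]
  have v2 : v ^ 2 ≤ v := by nlinarith
  have v32 : v ^ 3 ≤ v ^ 2 := by nlinarith [mul_nonneg (mul_nonneg v0 v0) (sub_nonneg.2 v1)]
  have s2 : s ^ 2 ≤ s := by nlinarith
  have s3 : s ^ 3 ≤ s := by nlinarith [mul_nonneg (mul_nonneg r0 r0) (sub_nonneg.2 r1)]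
  refine ⟨v0, v1, ?_, ?_, ?_, ?_, ?_⟩
  · unfold F0; rw [abs_neg, abs_of_nonneg (by positivity)]; gcongr
  · unfold F1
    have : v ^ 2 * s ^ 2 = v ^ 2 * s ^ 2 * (v + r * k) := by rw [ve]; ring
    have h2 : v ^ 2 * s ^ 2 * (r * k) ≤ v ^ 2 * s * k := by
      have : s * r ≤ 1 := by nlinarith
      calc _ = v ^ 2 * s * k * (s * r) := by ring
        _ ≤ v ^ 2 * s * k * 1 := by gcongr
        _ = _ := by ring
    have h3 : 0 ≤ v ^ 2 * s * k := by positivity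
    change _ ≤ v ^ 3 * s ^ 2 + 3 * v ^ 2 * k * s
    nlinarith
  · change v ^ 3 * s ^ 2 + 3 * v ^ 2 * k * s ≤ _
    calc _ ≤ v ^ 2 * s ^ 2 + 3 * v ^ 2 * (2 * s) * s := by gcongr
      _ = _ := by ring
  · change |(-2 * v ^ 3 * s ^ 3 - 6 * v ^ 2 * k * s ^ 2 - 6 * v * k ^ 2 * s)| ≤ _
    rw [abs_of_nonpos (by
      have : 0 ≤ 2 * v ^ 3 * s ^ 3 + 6 * v ^ 2 * k * s ^ 2 + 6 * v * k ^ 2 * s := by positivity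
      linarith)]
    calc _ = 2 * (v ^ 3 * s ^ 3) + 6 * (v ^ 2 * k * s ^ 2) + 6 * (v * k ^ 2 * s) := by ring
      _ ≤ 2 * (v * s) + 6 * (v * (2 * 1) * s) + 6 * (v * (2 * 1) ^ 2 * s) := by
          have : k ≤ 2 * 1 := by linarith
          gcongr
      _ = _ := by ring
  · change -(v ^ 3 * s) ≤ 0
    have : 0 ≤ v ^ 3 * s := by positivity
    linarith


theorem ag {j q f α β c : ℝ} (hj : j ^ 2 ≤ q * f) (hq : 0 ≤ q) (hf : 0 ≤ f) (hα : 0 ≤ α) (hβ : 0 ≤ β)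
    (hc : c ^ 2 ≤ 4 * α * β) : |c * j| ≤ α * f + β * q := by
  apply abs_le_of_sq_le_sq _ (by positivity)
  calc (c * j) ^ 2 = c ^ 2 * j ^ 2 := by ring
    _ ≤ (4 * α * β) * (q * f) := by gcongr
    _ ≤ _ := by nlinarith [sq_nonneg (α * f - β * q)]

theorem csj (a b c d : ℝ) : (a * d - b * c) ^ 2 ≤ (a ^ 2 + b ^ 2) * (c ^ 2 + d ^ 2) := by
  nlinarith [sq_nonneg (a * c + b * d)]
theorem csd (a b c d : ℝ) : (a * c + b * d) ^ 2 ≤ (a ^ 2 + b ^ 2) * (c ^ 2 + d ^ 2) := by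
  nlinarith [sq_nonneg (a * d - b * c)]

theorem ps2_has (T t : ℝ) : HasDerivAt (fun t => ps T t ^ 2) (-4 * t * ps T t) t := by
  refine ((ps_has T t).fun_pow 2).congr_deriv ?_
  push_cast; ring

noncomputable def Gt (x y : ℝ × ℝ → ℝ) (b : ℝ) (p : ℝ × ℝ) : ℝ :=
  2 * F0 b p.2 * (dR x p * gA x y p + dR y p * gB x y p)
        + F1 b p.2 * (x p * gA x y p + y p * gB x y p)

theorem Gt_cont {x y : ℝ × ℝ → ℝ} (hx : Sm x) (hy : Sm y) (b : ℝ) : Continuous (Gt x y b) := by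
  have c1 := hx.cont; have c2 := hy.cont; have c3 := hx.dR.cont; have c4 := hy.dR.cont
  have c9 := (hx.gA hy).cont; have c10 := (hx.gB hy).cont
  have f0 := F0_cont b; have f1 := F1_cont b
  unfold Gt; fun_prop

theorem mor {x y : ℝ × ℝ → ℝ} (hx : Sm x) (hy : Sm y)
    (zx : ∀ t r, r < 1 / 2 → x (t, r) = 0) (zy : ∀ t r, r < 1 / 2 → y (t, r) = 0)
    {T b : ℝ} (hT : 0 < T) (hb : 1 ≤ b) :
    (5 / 4) * II (-T) T 0 b (fun p => ps T p.1 ^ 2 * ((vb b p.2 ^ 2 * rho p.2 ^ 2) * (dR x p ^ 2 + dR y p ^ 2)))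
    ≤ II (-T) T 0 b (fun p => (8 * T ^ 2 + 1444 * T ^ 4) * (x p ^ 2 + y p ^ 2) + ps T p.1 ^ 2 * (-Gt x y b p)) := by
  have c1 := hx.cont; have c2 := hy.cont; have c3 := hx.dR.cont; have c4 := hy.dR.cont
  have c9 := (hx.gA hy).cont; have c10 := (hx.gB hy).cont
  have f0 := F0_cont b; have f1 := F1_cont b; have f2 := F2_cont b; have cv := vb_cont b
  have cr := rho_cont; have cp := ps_cont T; have cG := Gt_cont hx hy b
  have bp : 0 < b := by linarith
  have id := morId hx hy zx zy (ps2_has T) (by fun_prop) (α := -T) (β := T) (by simp [ps]) (by simp [ps])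
    bp.le f0 f1 f2 (fun r hr => F0_has hr) (fun r hr => F1_has hr)
    (by simp [F0, vb, div_self bp.ne']) (by simp [F1, vb, div_self bp.ne'])
  rw [← II_mul]
  refine le_trans ?_ (le_of_eq ((congrArg (fun z => II (-T) T 0 b (fun p => (8 * T ^ 2 + 1444 * T ^ 4) * (x p ^ 2 + y p ^ 2) + ps T p.1 ^ 2 * (-Gt x y b p)) + z) id).trans (add_zero _)))
  rw [← II_add (by fun_prop) (by fun_prop)]
  refine II_mono (by linarith) bp.le (by fun_prop) (by fun_prop) fun t ht r hr => ?_
  obtain ⟨v0, v1, w0, w1, w2, w3, w4⟩ := wt hb hr.1 hr.2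
  have p0 := ps_nonneg ht
  have p1 : ps T t ≤ T ^ 2 := ps_le
  have r0 := (rho_pos r).le
  simp only [Gt]
  set a := vb b r * rho r with ha
  have a0 : 0 ≤ a := by positivity
  have ea : vb b r ^ 2 * rho r ^ 2 = a ^ 2 := by rw [ha]; ring
  rw [ea] at w1 ⊢
  set X := x (t, r); set Y := y (t, r); set Xr := dR x (t, r); set Yr := dR y (t, r)
  set P := ps T t
  have t2 : t ^ 2 ≤ T ^ 2 := by rw [← sq_abs t]; have := abs_le.2 ht; gcongr
  have F02 : F0 b r ^ 2 ≤ a ^ 2 := by rw [← sq_abs]; gcongr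
  have F22 : F2 b r ^ 2 ≤ (38 * a) ^ 2 := by rw [← sq_abs]; gcongr
  have i1 := (abs_le.1 (ag (c := -4 * t * P * F0 b r) (α := P ^ 2 * a ^ 2 / 2) (β := 8 * T ^ 2)
    (csj X Y Xr Yr) (by positivity) (by positivity) (by positivity) (by positivity) (by
      calc _ = 16 * P ^ 2 * (t ^ 2 * F0 b r ^ 2) := by ring
        _ ≤ 16 * P ^ 2 * (T ^ 2 * a ^ 2) := by gcongr
        _ = _ := by ring))).1
  have i2 := (abs_le.1 (ag (c := F2 b r) (α := a ^ 2 / 4) (β := 1444)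
    (csd X Y Xr Yr) (by positivity) (by positivity) (by positivity) (by positivity) (by
      refine F22.trans (le_of_eq (by ring))))).1
  have i3 := mul_le_mul_of_nonneg_left i2 (by positivity : 0 ≤ P ^ 2)
  have i4 : P ^ 2 * (2 * a ^ 2 * (Xr ^ 2 + Yr ^ 2)) ≤ P ^ 2 * (2 * F1 b r * (Xr ^ 2 + Yr ^ 2)) := by gcongr
  have i5 : P ^ 2 * (1444 * (X ^ 2 + Y ^ 2)) ≤ (T ^ 2) ^ 2 * (1444 * (X ^ 2 + Y ^ 2)) := by gcongr
  linarith


noncomputable def ir (r : ℝ) : ℝ := (max r 1)⁻¹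

theorem ir_cont : Continuous ir := by
  unfold ir
  exact (continuous_id.max continuous_const).inv₀ fun r => by
    have : (0:ℝ) < max r 1 := lt_of_lt_of_le one_pos (le_max_right _ _)
    exact this.ne'

theorem ir_eq {r : ℝ} (h : 1 ≤ r) : ir r = r⁻¹ := by unfold ir; rw [max_eq_left h]
theorem ir_nonneg (r : ℝ) : 0 ≤ ir r := by
  unfold ir
  have : (0:ℝ) < max r 1 := lt_of_lt_of_le one_pos (le_max_right _ _)
  positivity
theorem ir_half {r : ℝ} (h : 2 ≤ r) : ir r ≤ 1 / 2 := by
  rw [ir_eq (by linarith), inv_le_comm₀ (by linarith) (by norm_num)]; norm_num; exact h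

theorem ir_has {r : ℝ} (h : 1 < r) : HasDerivAt ir (-(ir r) ^ 2) r := by
  have h1 : HasDerivAt (fun s : ℝ => s⁻¹) (-(r ^ 2)⁻¹) r := hasDerivAt_inv (by linarith)
  have h2 : ir =ᶠ[𝓝 r] fun s => s⁻¹ := by
    filter_upwards [Ioi_mem_nhds h] with s hs
    exact ir_eq (le_of_lt hs)
  refine (h1.congr_of_eventuallyEq h2).congr_deriv ?_
  rw [ir_eq h.le, inv_pow]

theorem supA {x y : ℝ × ℝ → ℝ} (hx : Sm x) (hy : Sm y) {t b M l : ℝ} (hb : 1 ≤ b) (hl : 0 < l)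
    (z1 : x (t, 0) = 0) (z2 : y (t, 0) = 0)
    (hM : ∫ r in (0:ℝ)..b, (x (t, r) ^ 2 + y (t, r) ^ 2) ≤ M) {r : ℝ} (hr : r ∈ Icc 0 b) :
    vb b r ^ 2 * rho r ^ 2 * (x (t, r) ^ 2 + y (t, r) ^ 2) ≤
      l * (∫ r in (0:ℝ)..b, vb b r ^ 2 * rho r ^ 2 * (dR x (t, r) ^ 2 + dR y (t, r) ^ 2)) + l⁻¹ * M := by
  have c1 := hx.cont; have c2 := hy.cont; have c3 := hx.dR.cont; have c4 := hy.dR.cont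
  have cv := vb_cont b
  have cr := rho_cont
  have b0 : 0 ≤ b⁻¹ := by positivity
  have e0 : ∫ s in (0:ℝ)..r, ((2 * (vb b s * rho s) * (-b⁻¹ * rho s + vb b s * (-rho s ^ 2))) * (x (t, s) ^ 2 + y (t, s) ^ 2)
      + vb b s ^ 2 * rho s ^ 2 * (2 * (x (t, s) * dR x (t, s) + y (t, s) * dR y (t, s))))
      = vb b r ^ 2 * rho r ^ 2 * (x (t, r) ^ 2 + y (t, r) ^ 2) := by
    rw [intervalIntegral.integral_eq_sub_of_hasDerivAt (f := fun s => vb b s ^ 2 * rho s ^ 2 * (x (t, s) ^ 2 + y (t, s) ^ 2))]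
    · simp [z1, z2]
    · intro s hs
      rw [uIcc_of_le hr.1] at hs
      refine ((((vb_has b s).fun_pow 2).fun_mul ((rho_has hs.1).fun_pow 2)).fun_mul (q_hasR hx hy t s)).congr_deriv ?_
      push_cast; ring
    · apply Continuous.intervalIntegrable; fun_prop
  rw [← e0]
  set g : ℝ → ℝ := fun s => l * (vb b s ^ 2 * rho s ^ 2 * (dR x (t, s) ^ 2 + dR y (t, s) ^ 2)) + l⁻¹ * (x (t, s) ^ 2 + y (t, s) ^ 2) with hg
  have cg : Continuous g := by fun_prop
  calc _ ≤ ∫ s in (0:ℝ)..r, g s := by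
        apply intervalIntegral.integral_mono_on hr.1
        · apply Continuous.intervalIntegrable; fun_prop
        · exact cg.intervalIntegrable _ _
        · intro s hs
          obtain ⟨v0, v1, -⟩ := wt hb hs.1 (hs.2.trans hr.2)
          have r0 := (rho_pos s).le
          have r1 := rho_le hs.1
          have a1 : vb b s * rho s ≤ 1 := mul_le_one₀ v1 r0 r1
          have a0 : 0 ≤ vb b s * rho s := by positivity
          have i1 : (2 * (vb b s * rho s) * (-b⁻¹ * rho s + vb b s * (-rho s ^ 2))) * (x (t, s) ^ 2 + y (t, s) ^ 2) ≤ 0 := by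
            have : 0 ≤ (2 * (vb b s * rho s) * (b⁻¹ * rho s + vb b s * (rho s ^ 2))) * (x (t, s) ^ 2 + y (t, s) ^ 2) := by positivity
            linarith
          have i2 := (abs_le.1 (ag (c := 2 * (vb b s ^ 2 * rho s ^ 2)) (α := l * (vb b s ^ 2 * rho s ^ 2)) (β := l⁻¹)
            (csd (x (t, s)) (y (t, s)) (dR x (t, s)) (dR y (t, s))) (by positivity) (by positivity) (by positivity)
            (by positivity) (by
              rw [show 4 * (l * (vb b s ^ 2 * rho s ^ 2)) * l⁻¹ = 4 * (vb b s * rho s) ^ 2 * (l * l⁻¹) by ring,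
                mul_inv_cancel₀ hl.ne']
              have : (vb b s * rho s) ^ 2 ≤ 1 := pow_le_one₀ a0 a1
              nlinarith [sq_nonneg (vb b s * rho s)]))).2
          simp only [hg]
          linarith
    _ ≤ ∫ s in (0:ℝ)..b, g s := int_subset cg le_rfl hr.1 hr.2 fun _ _ => by positivity
    _ ≤ _ := by
        rw [hg, intervalIntegral.integral_add, intervalIntegral.integral_const_mul, intervalIntegral.integral_const_mul]
        · gcongr
        all_goals apply Continuous.intervalIntegrable; fun_prop

theorem int_lin3 {f g h : ℝ → ℝ} (hf : Continuous f) (hg : Continuous g) (hh : Continuous h) (a b u v w : ℝ) :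
    ∫ r in a..b, (u * f r + v * g r + w * h r) = u * (∫ r in a..b, f r) + v * (∫ r in a..b, g r) + w * ∫ r in a..b, h r := by
  rw [intervalIntegral.integral_add, intervalIntegral.integral_add]
  · simp
  all_goals apply Continuous.intervalIntegrable; fun_prop

theorem cubB {x y : ℝ × ℝ → ℝ} (hx : Sm x) (hy : Sm y) {t b M : ℝ} (hb : 2 ≤ b) (hM1 : 1 ≤ M)
    (z1 : x (t, 0) = 0) (z2 : y (t, 0) = 0)
    (hM : ∫ r in (0:ℝ)..b, (x (t, r) ^ 2 + y (t, r) ^ 2) ≤ M) :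
    ∫ r in (2:ℝ)..b, (F0 b r * (2 * (x (t, r) * dR x (t, r) + y (t, r) * dR y (t, r))) + F1 b r * (x (t, r) ^ 2 + y (t, r) ^ 2))
        * ((x (t, r) ^ 2 + y (t, r) ^ 2) * ir r)
    ≤ (x (t, 2) ^ 2 + y (t, 2) ^ 2) ^ 2 / 4 + 49 / 4 * M ^ 3
      + 1 / 4 * ∫ r in (0:ℝ)..b, vb b r ^ 2 * rho r ^ 2 * (dR x (t, r) ^ 2 + dR y (t, r) ^ 2) := by
  have c1 := hx.cont; have c2 := hy.cont; have c3 := hx.dR.cont; have c4 := hy.dR.cont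
  have c5 := ir_cont
  have f0 := F0_cont b; have f1 := F1_cont b; have cv := vb_cont b
  have cr := rho_cont
  set Y := ∫ r in (0:ℝ)..b, vb b r ^ 2 * rho r ^ 2 * (dR x (t, r) ^ 2 + dR y (t, r) ^ 2) with hY
  have e0 : ∫ r in (2:ℝ)..b, (F0 b r * (2 * (x (t, r) * dR x (t, r) + y (t, r) * dR y (t, r)))
        * ((x (t, r) ^ 2 + y (t, r) ^ 2) * ir r) + 1 / 2 * F1 b r * ((x (t, r) ^ 2 + y (t, r) ^ 2) ^ 2 * ir r)
        + 1 / 2 * F0 b r * (x (t, r) ^ 2 + y (t, r) ^ 2) ^ 2 * (-ir r ^ 2))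
      = - (1 / 2 * F0 b 2 * (x (t, 2) ^ 2 + y (t, 2) ^ 2) ^ 2 * ir 2) := by
    rw [intervalIntegral.integral_eq_sub_of_hasDerivAt (f := fun s => 1 / 2 * F0 b s * (x (t, s) ^ 2 + y (t, s) ^ 2) ^ 2 * ir s)]
    · have : F0 b b = 0 := by simp [F0, vb, div_self (show b ≠ 0 by linarith)]
      simp [this]
    · intro s hs
      rw [uIcc_of_le hb] at hs
      refine ((((F0_has (b := b) (by linarith [hs.1] : 0 ≤ s)).const_mul (1/2)).fun_mul
        ((q_hasR hx hy t s).fun_pow 2)).fun_mul (ir_has (by linarith [hs.1]))).congr_deriv ?_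
      push_cast; ring
    · apply Continuous.intervalIntegrable; fun_prop
  obtain ⟨-, -, w0, -⟩ := wt (b := b) (r := 2) (by linarith) (by norm_num) hb
  obtain ⟨v0, v1, -⟩ := wt (b := b) (r := 2) (by linarith) (by norm_num) hb
  have hF : |F0 b 2| ≤ 1 := w0.trans (mul_le_one₀ v1 (rho_pos 2).le (rho_le (by norm_num)))
  have h2 : ir 2 = 1 / 2 := by rw [ir_eq (by norm_num)]; norm_num
  have e1 : - (1 / 2 * F0 b 2 * (x (t, 2) ^ 2 + y (t, 2) ^ 2) ^ 2 * ir 2) ≤ (x (t, 2) ^ 2 + y (t, 2) ^ 2) ^ 2 / 4 := by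
    rw [h2]
    have := (abs_le.1 hF).1
    nlinarith [sq_nonneg (x (t, 2) ^ 2 + y (t, 2) ^ 2)]
  set S := (7 * M)⁻¹ * Y + 7 * M * M with hS
  have hMp : 0 < M := by linarith
  have hS' : ∀ r ∈ Icc 0 b, vb b r ^ 2 * rho r ^ 2 * (x (t, r) ^ 2 + y (t, r) ^ 2) ≤ S := by
    intro r hr
    have := supA hx hy (by linarith : 1 ≤ b) (by positivity : 0 < (7 * M)⁻¹) z1 z2 hM hr
    rwa [inv_inv] at this
  have hS0 : 0 ≤ S := le_trans (by positivity) (hS' 0 ⟨le_rfl, by linarith⟩)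
  have e2 : ∫ r in (2:ℝ)..b, (F0 b r * (2 * (x (t, r) * dR x (t, r) + y (t, r) * dR y (t, r))) + F1 b r * (x (t, r) ^ 2 + y (t, r) ^ 2))
        * ((x (t, r) ^ 2 + y (t, r) ^ 2) * ir r) ≤ ∫ r in (2:ℝ)..b, ((F0 b r * (2 * (x (t, r) * dR x (t, r) + y (t, r) * dR y (t, r)))
        * ((x (t, r) ^ 2 + y (t, r) ^ 2) * ir r) + 1 / 2 * F1 b r * ((x (t, r) ^ 2 + y (t, r) ^ 2) ^ 2 * ir r)
        + 1 / 2 * F0 b r * (x (t, r) ^ 2 + y (t, r) ^ 2) ^ 2 * (-ir r ^ 2)) + 7 / 4 * S * (x (t, r) ^ 2 + y (t, r) ^ 2)) := by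
    apply intervalIntegral.integral_mono_on hb
    · apply Continuous.intervalIntegrable; fun_prop
    · apply Continuous.intervalIntegrable; fun_prop
    · intro r hr
      have hr0 : 0 ≤ r := by linarith [hr.1]
      obtain ⟨v0, v1, w0, w1, w2, w3, w4⟩ := wt (b := b) (by linarith) hr0 hr.2
      have i0 := ir_nonneg r
      have i1 := ir_half hr.1
      have s1 := hS' r ⟨hr0, hr.2⟩
      set q := x (t, r) ^ 2 + y (t, r) ^ 2
      have q0 : 0 ≤ q := by positivity
      have k1 : 1 / 2 * F1 b r * (q ^ 2 * ir r) ≤ 7 / 4 * S * q := by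
        calc _ ≤ 1 / 2 * (7 * (vb b r ^ 2 * rho r ^ 2)) * (q ^ 2 * (1 / 2)) := by gcongr
          _ = 7 / 4 * (vb b r ^ 2 * rho r ^ 2 * q) * q := by ring
          _ ≤ _ := by gcongr
      have k2 : 0 ≤ 1 / 2 * (-F0 b r) * q ^ 2 * (ir r ^ 2) := by
        have : 0 ≤ -F0 b r := by linarith
        positivity
      linarith
  rw [intervalIntegral.integral_add, e0, intervalIntegral.integral_const_mul] at e2
  · have hM2 : ∫ r in (2:ℝ)..b, (x (t, r) ^ 2 + y (t, r) ^ 2) ≤ M :=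
        le_trans (int_subset (by fun_prop) (by norm_num) hb le_rfl fun _ _ => by positivity) hM
    have e3 : 7 / 4 * S * (∫ r in (2:ℝ)..b, (x (t, r) ^ 2 + y (t, r) ^ 2)) ≤ 7 / 4 * S * M := by gcongr
    have e4 : 7 / 4 * S * M = 49 / 4 * M ^ 3 + 1 / 4 * Y := by rw [hS]; field_simp; ring
    linarith
  all_goals apply Continuous.intervalIntegrable; fun_prop


theorem Gt_out {x y W : ℝ × ℝ → ℝ} {T c M : ℝ} (h : ZD x y W T c M) {b : ℝ} (hb : 2 ≤ b) {t : ℝ}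
    (ht : t ∈ Icc (-T) T) :
    ∫ r in (2:ℝ)..b, -Gt x y b (t, r) ≤ (x (t, 2) ^ 2 + y (t, 2) ^ 2) ^ 2 / 4 + 49 / 4 * M ^ 3 + (4 * c ^ 2 + 7 * c) * M
      + 1 / 2 * ∫ r in (0:ℝ)..b, vb b r ^ 2 * rho r ^ 2 * (dR x (t, r) ^ 2 + dR y (t, r) ^ 2) := by
  have hx := h.hx; have hy := h.hy; have hc := h.hc
  have c1 := hx.cont; have c2 := hy.cont; have c3 := hx.dR.cont; have c4 := hy.dR.cont
  have c5 := ir_cont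
  have f0 := F0_cont b; have f1 := F1_cont b; have cv := vb_cont b
  have cr := rho_cont; have cG := Gt_cont hx hy b
  have hMt := h.hM t ht b (by linarith)
  have cub := cubB hx hy hb h.hM1 (h.zx t 0 (by norm_num)) (h.zy t 0 (by norm_num)) hMt
  set B : ℝ → ℝ := fun r => (F0 b r * (2 * (x (t, r) * dR x (t, r) + y (t, r) * dR y (t, r))) + F1 b r * (x (t, r) ^ 2 + y (t, r) ^ 2))
        * ((x (t, r) ^ 2 + y (t, r) ^ 2) * ir r) with hB
  set q : ℝ → ℝ := fun r => x (t, r) ^ 2 + y (t, r) ^ 2 with hq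
  set fr : ℝ → ℝ := fun r => vb b r ^ 2 * rho r ^ 2 * (dR x (t, r) ^ 2 + dR y (t, r) ^ 2) with hfr
  have cq : Continuous q := by fun_prop
  have cfr : Continuous fr := by fun_prop
  have cB : Continuous B := by fun_prop
  have step : ∫ r in (2:ℝ)..b, -Gt x y b (t, r) ≤ ∫ r in (2:ℝ)..b, (1 * B r + 1 / 4 * fr r + (4 * c ^ 2 + 7 * c) * q r) := by
    apply intervalIntegral.integral_mono_on hb
    · exact (_root_.cr cG.neg t).intervalIntegrable _ _
    · apply Continuous.intervalIntegrable; fun_prop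
    · intro r hr
      have hr0 : 0 ≤ r := by linarith [hr.1]
      obtain ⟨v0, v1, w0, w1, w2, w3, w4⟩ := wt (b := b) (by linarith) hr0 hr.2
      have r0 := (rho_pos r).le
      have hw := h.hW t ht r hr.1
      simp only [Gt, hB, hq, hfr, h.e1 t ht r hr.1, h.e2 t ht r hr.1, ir_eq (show 1 ≤ r by linarith [hr.1])]
      set a := vb b r * rho r with ha
      have a0 : 0 ≤ a := by positivity
      have a1 : a ≤ 1 := mul_le_one₀ v1 r0 (rho_le hr0)
      have ea : vb b r ^ 2 * rho r ^ 2 = a ^ 2 := by rw [ha]; ring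
      rw [ea] at w1 w2 ⊢
      set X := x (t, r); set Y := y (t, r); set Xr := dR x (t, r); set Yr := dR y (t, r)
      set w := W (t, r)
      have F02 : F0 b r ^ 2 ≤ a ^ 2 := by rw [← sq_abs]; gcongr
      have hw2 : w ^ 2 ≤ c ^ 2 := by rw [← sq_abs]; gcongr
      have i1 := (abs_le.1 (ag (c := 2 * w * F0 b r) (α := a ^ 2 / 4) (β := 4 * c ^ 2)
        (csd X Y Xr Yr) (by positivity) (by positivity) (by positivity) (by positivity) (by
          calc _ = 4 * (w ^ 2 * F0 b r ^ 2) := by ring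
            _ ≤ 4 * (c ^ 2 * a ^ 2) := by gcongr
            _ = _ := by ring))).2
      have i2 : w * (F1 b r * (X ^ 2 + Y ^ 2)) ≤ 7 * c * (X ^ 2 + Y ^ 2) := by
        have F10 : 0 ≤ F1 b r := le_trans (by positivity) w1
        have F17 : F1 b r ≤ 7 := by nlinarith
        calc _ ≤ c * (F1 b r * (X ^ 2 + Y ^ 2)) := by gcongr; exact (abs_le.1 hw).2
          _ ≤ c * (7 * (X ^ 2 + Y ^ 2)) := by gcongr
          _ = _ := by ring
      rw [div_eq_mul_inv]
      linarith
  rw [int_lin3 cB cfr cq] at step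
  have hM2 : ∫ r in (2:ℝ)..b, q r ≤ M :=
        le_trans (int_subset cq (by norm_num) hb le_rfl fun _ _ => by positivity) hMt
  have hfr2 : ∫ r in (2:ℝ)..b, fr r ≤ ∫ r in (0:ℝ)..b, fr r :=
        int_subset cfr (by norm_num) hb le_rfl fun _ _ => by positivity
  have e1 : (4 * c ^ 2 + 7 * c) * (∫ r in (2:ℝ)..b, q r) ≤ (4 * c ^ 2 + 7 * c) * M := by gcongr
  linarith

theorem Gt_in {x y : ℝ × ℝ → ℝ} {b t r K : ℝ} (hb : 2 ≤ b) (hr : r ∈ Icc (0:ℝ) 2) (hK : 0 ≤ K)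
    (k1 : |x (t, r)| ≤ K) (k2 : |y (t, r)| ≤ K) (k3 : |dR x (t, r)| ≤ K) (k4 : |dR y (t, r)| ≤ K)
    (k5 : |gA x y (t, r)| ≤ K) (k6 : |gB x y (t, r)| ≤ K) : |Gt x y b (t, r)| ≤ 18 * K ^ 2 := by
  obtain ⟨v0, v1, w0, w1, w2, w3, w4⟩ := wt (b := b) (by linarith) hr.1 (hr.2.trans hb)
  have r0 := (rho_pos r).le
  have a0 : 0 ≤ vb b r * rho r := by positivity
  have a1 : vb b r * rho r ≤ 1 := mul_le_one₀ v1 r0 (rho_le hr.1)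
  have F10 : 0 ≤ F1 b r := le_trans (by positivity) w1
  have F17 : F1 b r ≤ 7 := by nlinarith
  have m : ∀ {u v : ℝ}, |u| ≤ K → |v| ≤ K → |u * v| ≤ K * K := fun h1 h2 => by
    rw [abs_mul]; gcongr
  have s1 : |dR x (t, r) * gA x y (t, r) + dR y (t, r) * gB x y (t, r)| ≤ K * K + K * K :=
    (abs_add_le _ _).trans (add_le_add (m k3 k5) (m k4 k6))
  have s2 : |x (t, r) * gA x y (t, r) + y (t, r) * gB x y (t, r)| ≤ K * K + K * K :=
    (abs_add_le _ _).trans (add_le_add (m k1 k5) (m k2 k6))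
  simp only [Gt]
  calc _ ≤ _ := abs_add_le _ _
    _ ≤ 2 * 1 * (K * K + K * K) + 7 * (K * K + K * K) := by
        rw [abs_mul, abs_mul, abs_mul, abs_two, abs_of_nonneg F10]
        have := w0.trans a1
        gcongr
    _ = _ := by ring

theorem zd_mor {x y W : ℝ × ℝ → ℝ} {T c M : ℝ} (h : ZD x y W T c M) : ∃ C, 0 ≤ C ∧ ∀ b, 2 ≤ b →
    II (-T) T 0 b (fun p => ps T p.1 ^ 2 * ((vb b p.2 ^ 2 * rho p.2 ^ 2) * (dR x p ^ 2 + dR y p ^ 2))) ≤ C := by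
  have hx := h.hx; have hy := h.hy; have hT := h.hT
  have c1 := hx.cont; have c2 := hy.cont; have c3 := hx.dR.cont; have c4 := hy.dR.cont
  have c5 := (hx.gA hy).cont; have c6 := (hx.gB hy).cont
  have cr := rho_cont; have cp := ps_cont T
  obtain ⟨K, hK0, hK⟩ := bdd6 c1 c2 c3 c4 c5 c6 (-T) T 0 2
  have hM0 : 0 ≤ M := by linarith [h.hM1]
  have hc := h.hc
  set C1 := (K ^ 2 + K ^ 2) ^ 2 / 4 + 49 / 4 * M ^ 3 + (4 * c ^ 2 + 7 * c) * M + 36 * K ^ 2 with hC1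
  set C2 := (8 * T ^ 2 + 1444 * T ^ 4) * M + T ^ 4 * C1 with hC2
  have hC10 : 0 ≤ C1 := by positivity
  refine ⟨4 * T * C2, by positivity, fun b hb => ?_⟩
  have cv := vb_cont b; have cG := Gt_cont hx hy b
  have hm := mor hx hy (fun t r hr => h.zx t r (by linarith))
    (fun t r hr => h.zy t r (by linarith)) hT (by linarith : 1 ≤ b)
  have per : ∀ t ∈ Icc (-T) T, ∫ r in (0:ℝ)..b, ((8 * T ^ 2 + 1444 * T ^ 4) * (x (t, r) ^ 2 + y (t, r) ^ 2) + ps T t ^ 2 * (-Gt x y b (t, r)))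
     ≤ C2 + 1 / 2 * ∫ r in (0:ℝ)..b, ps T t ^ 2 * ((vb b r ^ 2 * rho r ^ 2) * (dR x (t, r) ^ 2 + dR y (t, r) ^ 2)) := by
    intro t ht
    have p0 := ps_nonneg ht
    have p1 : ps T t ≤ T ^ 2 := ps_le
    have p2 : ps T t ^ 2 ≤ T ^ 4 := by
      calc ps T t ^ 2 ≤ (T ^ 2) ^ 2 := by gcongr
        _ = _ := by ring
    have cGt := _root_.cr cG t
    have o := Gt_out h hb ht
    have i : ∫ r in (0:ℝ)..2, -Gt x y b (t, r) ≤ 36 * K ^ 2 := by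
      calc _ ≤ ∫ r in (0:ℝ)..2, 18 * K ^ 2 := by
            apply intervalIntegral.integral_mono_on (by norm_num)
            · exact cGt.neg.intervalIntegrable _ _
            · exact intervalIntegrable_const
            · intro r hr
              obtain ⟨k1, k2, k3, k4, k5, k6⟩ := hK t ht r hr
              have := (abs_le.1 (Gt_in hb hr hK0 k1 k2 k3 k4 k5 k6)).1
              linarith
        _ = _ := by rw [intervalIntegral.integral_const, smul_eq_mul]; ring
    have sp : ∫ r in (0:ℝ)..b, -Gt x y b (t, r) = (∫ r in (0:ℝ)..2, -Gt x y b (t, r)) + ∫ r in (2:ℝ)..b, -Gt x y b (t, r) :=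
      (intervalIntegral.integral_add_adjacent_intervals (cGt.neg.intervalIntegrable _ _)
        (cGt.neg.intervalIntegrable _ _)).symm
    obtain ⟨k1, k2, -⟩ := hK t ht 2 ⟨by norm_num, le_rfl⟩
    have k1' : x (t, 2) ^ 2 ≤ K ^ 2 := by rw [← sq_abs]; gcongr
    have k2' : y (t, 2) ^ 2 ≤ K ^ 2 := by rw [← sq_abs]; gcongr
    have k3 : (x (t, 2) ^ 2 + y (t, 2) ^ 2) ^ 2 ≤ (K ^ 2 + K ^ 2) ^ 2 := by gcongr
    have hMt := h.hM t ht b (by linarith)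
    have tot : ∫ r in (0:ℝ)..b, -Gt x y b (t, r) ≤ C1 + 1 / 2 * ∫ r in (0:ℝ)..b, vb b r ^ 2 * rho r ^ 2 * (dR x (t, r) ^ 2 + dR y (t, r) ^ 2) := by
      rw [sp, hC1]; linarith
    have eq1 : ∫ r in (0:ℝ)..b, ((8 * T ^ 2 + 1444 * T ^ 4) * (x (t, r) ^ 2 + y (t, r) ^ 2) + ps T t ^ 2 * (-Gt x y b (t, r)))
      = (8 * T ^ 2 + 1444 * T ^ 4) * (∫ r in (0:ℝ)..b, (x (t, r) ^ 2 + y (t, r) ^ 2)) + ps T t ^ 2 * ∫ r in (0:ℝ)..b, -Gt x y b (t, r) := by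
      rw [intervalIntegral.integral_add]
      · simp only [intervalIntegral.integral_const_mul]
      all_goals apply Continuous.intervalIntegrable; fun_prop
    rw [eq1, intervalIntegral.integral_const_mul (ps T t ^ 2)]
    have a1 : (8 * T ^ 2 + 1444 * T ^ 4) * (∫ r in (0:ℝ)..b, (x (t, r) ^ 2 + y (t, r) ^ 2)) ≤ (8 * T ^ 2 + 1444 * T ^ 4) * M := by gcongr
    have a2 := mul_le_mul_of_nonneg_left tot (by positivity : 0 ≤ ps T t ^ 2)
    have a3 : ps T t ^ 2 * C1 ≤ T ^ 4 * C1 := by gcongr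
    rw [hC2]; linarith
  set F : ℝ × ℝ → ℝ := fun p => (8 * T ^ 2 + 1444 * T ^ 4) * (x p ^ 2 + y p ^ 2) + ps T p.1 ^ 2 * (-Gt x y b p) with hF
  have cF : Continuous F := by fun_prop
  set Z : ℝ × ℝ → ℝ := fun p => ps T p.1 ^ 2 * ((vb b p.2 ^ 2 * rho p.2 ^ 2) * (dR x p ^ 2 + dR y p ^ 2)) with hZ
  have cZ : Continuous Z := by fun_prop
  have iZ := ci cZ 0 b
  have : ∫ t in (-T)..T, ∫ r in (0:ℝ)..b, F (t, r) ≤ ∫ t in (-T)..T, (C2 + 1 / 2 * ∫ r in (0:ℝ)..b, Z (t, r)) :=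
    intervalIntegral.integral_mono_on (μ := volume) (by linarith : -T ≤ T) ((ci cF 0 b).intervalIntegrable _ _)
      (Continuous.intervalIntegrable (by fun_prop) _ _) per
  rw [intervalIntegral.integral_add, intervalIntegral.integral_const_mul,
      intervalIntegral.integral_const, smul_eq_mul] at this
  · have e : II (-T) T 0 b F ≤ (T - -T) * C2 + 1 / 2 * II (-T) T 0 b Z := this
    have hZ0 : 0 ≤ II (-T) T 0 b Z := II_nonneg (by linarith) (by linarith) fun t ht r _ => by
      have := ps_nonneg ht
      simp only [hZ]
      positivity
    have : 0 ≤ T * C2 := by positivity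
    linarith
  · exact intervalIntegrable_const
  · exact (continuous_const.mul (ci cZ 0 b)).intervalIntegrable _ _

theorem unw {F : ℝ × ℝ → ℝ} (cF : Continuous F) (F0 : ∀ p, 0 ≤ F p) {T C : ℝ} (hT : 0 < T)
    (h : ∀ b, 2 ≤ b → II (-T) T 0 b (fun p => ps T p.1 ^ 2 * ((vb b p.2 ^ 2 * rho p.2 ^ 2) * F p)) ≤ C) :
    ∀ R, 1 ≤ R → II (-(T / 2)) (T / 2) 0 R (fun p => rho p.2 ^ 2 * F p) ≤ (9 / 64 * T ^ 4)⁻¹ * C := by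
  intro R hR
  have h1 := h (2 * R) (by linarith)
  have cv := vb_cont (2 * R); have cr := rho_cont; have cp := ps_cont T
  rw [inv_mul_eq_div, le_div_iff₀ (by positivity), mul_comm]
  refine le_trans ?_ h1
  rw [← II_mul]
  refine le_trans ?_ (II_subset (by linarith) (by linarith) (by linarith) le_rfl (by linarith)
      (by linarith : R ≤ 2 * R) (by fun_prop) ?_ (α' := -(T / 2)) (β' := T / 2))
  · refine II_mono (by linarith) (by linarith) (by fun_prop) (by fun_prop) fun t ht r hr => ?_
    have p1 : 3 / 4 * T ^ 2 ≤ ps T t := by unfold ps; nlinarith [ht.1, ht.2]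
    have v1 : 1 / 2 ≤ vb (2 * R) r := by
      unfold vb
      have : r / (2 * R) ≤ 1 / 2 := by rw [div_le_iff₀ (by linarith)]; linarith [hr.2]
      linarith
    have f0 := F0 (t, r)
    simp only
    calc _ = (3 / 4 * T ^ 2) ^ 2 * (((1 / 2) ^ 2 * rho r ^ 2) * F (t, r)) := by ring
      _ ≤ _ := by gcongr
  · intro t _ r _
    have f0 := F0 (t, r)
    simp only
    positivity

theorem zd_mor' {x y W : ℝ × ℝ → ℝ} {T c M : ℝ} (h : ZD x y W T c M) : ∃ C, 0 ≤ C ∧ ∀ R, 1 ≤ R →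
    II (-(T / 2)) (T / 2) 0 R (fun p => rho p.2 ^ 2 * (dR x p ^ 2 + dR y p ^ 2)) ≤ C := by
  obtain ⟨C, hC, hA⟩ := zd_mor h
  have hT := h.hT
  have c3 := h.hx.dR.cont; have c4 := h.hy.dR.cont
  exact ⟨(9 / 64 * T ^ 4)⁻¹ * C, by positivity, unw (by fun_prop) (fun _ => by positivity) hT hA⟩


theorem w_bd {x y : ℝ × ℝ → ℝ} (hx : Sm x) (hy : Sm y) {t B M : ℝ}
    (z1 : x (t, 0) = 0) (z2 : y (t, 0) = 0)
    (hM : ∫ r in (0:ℝ)..B, (x (t, r) ^ 2 + y (t, r) ^ 2) ≤ M) {r : ℝ} (hr : r ∈ Icc 0 B) :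
    (rho r * (x (t, r) ^ 2 + y (t, r) ^ 2)) ^ 2 ≤
      16 * M * ∫ r in (0:ℝ)..B, rho r ^ 2 * (dR x (t, r) ^ 2 + dR y (t, r) ^ 2) := by
  have c1 := hx.cont; have c2 := hy.cont; have c3 := hx.dR.cont; have c4 := hy.dR.cont
  have cr := rho_cont
  set N := ∫ r in (0:ℝ)..B, rho r ^ 2 * (dR x (t, r) ^ 2 + dR y (t, r) ^ 2) with hN
  have aux : ∀ z : ℝ × ℝ → ℝ, Continuous z → Continuous (dR z) → (∀ s, z (t, s) ^ 2 ≤ x (t, s) ^ 2 + y (t, s) ^ 2) →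
      (∀ s, dR z (t, s) ^ 2 ≤ dR x (t, s) ^ 2 + dR y (t, s) ^ 2) →
      (∫ s in (0:ℝ)..r, z (t, s) * (rho s * dR z (t, s))) ^ 2 ≤ M * N := by
    intro z k1 k2 h1 h2
    refine (int_cs (by fun_prop) (by fun_prop) hr.1).trans ?_
    have a1 : ∫ s in (0:ℝ)..r, z (t, s) ^ 2 ≤ M := by
      refine le_trans ?_ hM
      refine le_trans ?_ (int_subset (by fun_prop) le_rfl hr.1 hr.2 (fun _ _ => by positivity))
      exact intervalIntegral.integral_mono_on (μ := volume) hr.1 (Continuous.intervalIntegrable (by fun_prop) _ _)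
        (Continuous.intervalIntegrable (by fun_prop) _ _) fun s _ => h1 s
    have a2 : ∫ s in (0:ℝ)..r, (rho s * dR z (t, s)) ^ 2 ≤ N := by
      refine le_trans ?_ (int_subset (by fun_prop) le_rfl hr.1 hr.2 (fun _ _ => by positivity))
      refine intervalIntegral.integral_mono_on (μ := volume) hr.1 (Continuous.intervalIntegrable (by fun_prop) _ _)
        (Continuous.intervalIntegrable (by fun_prop) _ _) fun s _ => ?_
      rw [mul_pow]; exact mul_le_mul_of_nonneg_left (h2 s) (by positivity)
    have a3 : 0 ≤ ∫ s in (0:ℝ)..r, (rho s * dR z (t, s)) ^ 2 := intervalIntegral.integral_nonneg hr.1 fun _ _ => by positivity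
    have a4 : 0 ≤ ∫ s in (0:ℝ)..r, z (t, s) ^ 2 := intervalIntegral.integral_nonneg hr.1 fun _ _ => by positivity
    exact mul_le_mul a1 a2 a3 (a4.trans a1)
  have A1 := aux x c1 c3 (fun s => by nlinarith [sq_nonneg (y (t, s))]) (fun s => by nlinarith [sq_nonneg (dR y (t, s))])
  have A2 := aux y c2 c4 (fun s => by nlinarith [sq_nonneg (x (t, s))]) (fun s => by nlinarith [sq_nonneg (dR x (t, s))])
  have ftc : ∫ s in (0:ℝ)..r, (-(rho s) ^ 2 * (x (t, s) ^ 2 + y (t, s) ^ 2) + rho s * (2 * (x (t, s) * dR x (t, s) + y (t, s) * dR y (t, s))))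
      = rho r * (x (t, r) ^ 2 + y (t, r) ^ 2) := by
    rw [intervalIntegral.integral_eq_sub_of_hasDerivAt (f := fun s => rho s * (x (t, s) ^ 2 + y (t, s) ^ 2))]
    · simp [z1, z2]
    · intro s hs
      rw [uIcc_of_le hr.1] at hs
      exact (rho_has hs.1).fun_mul (q_hasR hx hy t s)
    · apply Continuous.intervalIntegrable; fun_prop
  have up : rho r * (x (t, r) ^ 2 + y (t, r) ^ 2) ≤ 2 * (∫ s in (0:ℝ)..r, x (t, s) * (rho s * dR x (t, s)))
      + 2 * (∫ s in (0:ℝ)..r, y (t, s) * (rho s * dR y (t, s))) := by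
    rw [← ftc, ← intervalIntegral.integral_const_mul, ← intervalIntegral.integral_const_mul, ← intervalIntegral.integral_add]
    · refine intervalIntegral.integral_mono_on (μ := volume) hr.1 (Continuous.intervalIntegrable (by fun_prop) _ _)
        (Continuous.intervalIntegrable (by fun_prop) _ _) fun s _ => ?_
      have : 0 ≤ (rho s) ^ 2 * (x (t, s) ^ 2 + y (t, s) ^ 2) := by positivity
      linarith
    all_goals apply Continuous.intervalIntegrable; fun_prop
  have p0 : 0 ≤ rho r * (x (t, r) ^ 2 + y (t, r) ^ 2) := by have := rho_pos r; positivity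
  set I1 := ∫ s in (0:ℝ)..r, x (t, s) * (rho s * dR x (t, s))
  set I2 := ∫ s in (0:ℝ)..r, y (t, s) * (rho s * dR y (t, s))
  calc _ ≤ (2 * I1 + 2 * I2) ^ 2 := by gcongr
    _ ≤ 8 * (I1 ^ 2 + I2 ^ 2) := by nlinarith [sq_nonneg (I1 - I2)]
    _ ≤ _ := by linarith

noncomputable def chi (b r : ℝ) : ℝ := 1 + Real.log (rho r) / Real.log (1 + b)
theorem chi_cont (b : ℝ) : Continuous (chi b) := by
  unfold chi
  exact continuous_const.add ((rho_cont.log fun r => (rho_pos r).ne').div_const _)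
theorem chi_has {b r : ℝ} (h : 0 ≤ r) : HasDerivAt (chi b) (-(Real.log (1 + b))⁻¹ * rho r) r := by
  refine ((((rho_has h).log (rho_pos r).ne').div_const (Real.log (1 + b))).const_add 1).congr_deriv ?_
  have := (rho_pos r).ne'
  field_simp
theorem chi_eq {b r : ℝ} (h : 0 ≤ r) : chi b r = 1 - Real.log (1 + r) / Real.log (1 + b) := by
  unfold chi; rw [rho_eq (by linarith), Real.log_inv]; ring
theorem logb_pos {b : ℝ} (hb : 0 < b) : 0 < Real.log (1 + b) := Real.log_pos (by linarith)
theorem chi_b {b : ℝ} (hb : 0 < b) : chi b b = 0 := by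
  rw [chi_eq hb.le, div_self (logb_pos hb).ne', sub_self]
theorem chi_nonneg {b r : ℝ} (hb : 0 < b) (h : 0 ≤ r) (h2 : r ≤ b) : 0 ≤ chi b r := by
  rw [chi_eq h, sub_nonneg, div_le_one (logb_pos hb)]
  exact Real.log_le_log (by linarith) (by linarith)
theorem chi_le {b r : ℝ} (hb : 0 < b) (h : 0 ≤ r) : chi b r ≤ 1 := by
  rw [chi_eq h]
  have := div_nonneg (Real.log_nonneg (by linarith : 1 ≤ 1 + r)) (logb_pos hb).le
  linarith
theorem chi_half {b r R : ℝ} (h : 0 ≤ r) (h2 : r ≤ R) (hR : 0 < R) (hb : (1 + R) ^ 2 ≤ 1 + b) : 1 / 2 ≤ chi b r := by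
  rw [chi_eq h]
  have h3 : 2 * Real.log (1 + R) ≤ Real.log (1 + b) := by
    have := Real.log_le_log (by positivity) hb
    rwa [Real.log_pow] at this
  have h4 : Real.log (1 + r) ≤ Real.log (1 + R) := Real.log_le_log (by linarith) (by linarith)
  have hp := logb_pos hR
  have : Real.log (1 + r) / Real.log (1 + b) ≤ 1 / 2 := by
    rw [div_le_iff₀ (by linarith)]; linarith
  linarith

theorem gron1 {m m' l g : ℝ → ℝ} {S A : ℝ} (hS : 0 ≤ S) (hA : 0 ≤ A) (hm : ∀ t, HasDerivAt m (m' t) t)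
    (cl : Continuous l) (cg : Continuous g) (g0 : ∀ t, 0 ≤ g t) (l0 : ∀ t, 0 ≤ l t)
    (h : ∀ t ∈ Icc 0 S, m' t ≤ l t * (m t + A) + g t) :
    m S + A ≤ Real.exp (∫ t in (0:ℝ)..S, l t) * (m 0 + A + ∫ t in (0:ℝ)..S, g t) := by
  set n : ℝ → ℝ := fun t => (m t + A) * Real.exp (-∫ s in (0:ℝ)..t, l s) - ∫ s in (0:ℝ)..t, g s with hn
  have dl : ∀ t, HasDerivAt (fun t => ∫ s in (0:ℝ)..t, l s) (l t) t := fun t =>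
    intervalIntegral.integral_hasDerivAt_right (cl.intervalIntegrable _ _) (cl.stronglyMeasurableAtFilter _ _) cl.continuousAt
  have dg : ∀ t, HasDerivAt (fun t => ∫ s in (0:ℝ)..t, g s) (g t) t := fun t =>
    intervalIntegral.integral_hasDerivAt_right (cg.intervalIntegrable _ _) (cg.stronglyMeasurableAtFilter _ _) cg.continuousAt
  have dn : ∀ t, HasDerivAt n (m' t * Real.exp (-∫ s in (0:ℝ)..t, l s) + (m t + A) * (Real.exp (-∫ s in (0:ℝ)..t, l s) * (-l t)) - g t) t :=
    fun t => (((hm t).add_const A).fun_mul ((dl t).fun_neg.exp)).fun_sub (dg t)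
  have an : AntitoneOn n (Icc 0 S) := by
    apply antitoneOn_of_deriv_nonpos (convex_Icc 0 S)
    · exact fun t _ => (dn t).continuousAt.continuousWithinAt
    · exact fun t _ => (dn t).differentiableAt.differentiableWithinAt
    · intro t ht
      rw [interior_Icc] at ht
      rw [(dn t).deriv]
      have h1 := h t ⟨ht.1.le, ht.2.le⟩
      have e1 : Real.exp (-∫ s in (0:ℝ)..t, l s) ≤ 1 := by
        rw [Real.exp_le_one_iff]
        have : 0 ≤ ∫ s in (0:ℝ)..t, l s := intervalIntegral.integral_nonneg ht.1.le fun _ _ => l0 _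
        linarith
      have e0 := Real.exp_pos (-∫ s in (0:ℝ)..t, l s)
      nlinarith [mul_le_mul_of_nonneg_right h1 e0.le, mul_le_mul_of_nonneg_left e1 (g0 t)]
  have := an ⟨le_rfl, hS⟩ ⟨hS, le_rfl⟩ hS
  simp only [hn, intervalIntegral.integral_same, neg_zero, Real.exp_zero, mul_one, sub_zero] at this
  have e : Real.exp (∫ t in (0:ℝ)..S, l t) * Real.exp (-∫ t in (0:ℝ)..S, l t) = 1 := by
    rw [← Real.exp_add]; simp
  have e0 := Real.exp_pos (∫ t in (0:ℝ)..S, l t)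
  calc m S + A = (m S + A) * (Real.exp (∫ t in (0:ℝ)..S, l t) * Real.exp (-∫ t in (0:ℝ)..S, l t)) := by rw [e, mul_one]
    _ = Real.exp (∫ t in (0:ℝ)..S, l t) * ((m S + A) * Real.exp (-∫ t in (0:ℝ)..S, l t)) := by ring
    _ ≤ _ := by gcongr; linarith

theorem gron {m m' l g : ℝ → ℝ} {S A L G : ℝ} (hA : 0 ≤ A) (hm : ∀ t, HasDerivAt m (m' t) t)
    (m0 : 0 ≤ m 0)
    (cl : Continuous l) (cg : Continuous g) (g0 : ∀ t, 0 ≤ g t) (l0 : ∀ t, 0 ≤ l t)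
    (h : ∀ t ∈ Icc (-S) S, |m' t| ≤ l t * (m t + A) + g t)
    (hL : ∫ t in (-S)..S, l t ≤ L) (hG : ∫ t in (-S)..S, g t ≤ G) :
    ∀ t ∈ Icc (-S) S, m t ≤ Real.exp L * (m 0 + A + G) := by
  intro t ht
  have hS : 0 ≤ S := by linarith [ht.1, ht.2]
  have fin : ∀ a b : ℝ, a ≤ L → 0 ≤ b → b ≤ G → m t + A ≤ Real.exp a * (m 0 + A + b) → m t ≤ Real.exp L * (m 0 + A + G) := by
    intro a b h1 h0 h2 h3
    have : Real.exp a * (m 0 + A + b) ≤ Real.exp L * (m 0 + A + G) := by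
      gcongr
    linarith
  rcases le_total 0 t with h0 | h0
  · refine fin _ _ ((int_subset cl (by linarith) h0 ht.2 fun r _ => l0 r).trans hL)
      (intervalIntegral.integral_nonneg h0 fun r _ => g0 r)
      ((int_subset cg (by linarith) h0 ht.2 fun r _ => g0 r).trans hG)
      (gron1 h0 hA hm cl cg g0 l0 fun s hs => (le_abs_self _).trans (h s ⟨by linarith [hs.1], by linarith [hs.2, ht.2]⟩))
  · have := gron1 (m := fun s => m (-s)) (m' := fun s => -m' (-s)) (l := fun s => l (-s)) (g := fun s => g (-s)) (S := -t)
      (by linarith) hA (fun s => by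
        have := (hm (-s)).comp s (hasDerivAt_neg s)
        simpa [Function.comp_def] using this) (by fun_prop) (by fun_prop) (fun _ => g0 _) (fun _ => l0 _)
        (fun s hs => (neg_le_abs _).trans (h (-s) ⟨by linarith [hs.2, ht.1], by linarith [hs.1]⟩))
    simp only [intervalIntegral.integral_comp_neg, neg_neg, neg_zero] at this
    refine fin _ _ ((int_subset cl ht.1 h0 hS fun r _ => l0 r).trans hL)
      (intervalIntegral.integral_nonneg h0 fun r _ => g0 r)
      ((int_subset cg ht.1 h0 hS fun r _ => g0 r).trans hG) this

theorem cutId {x y : ℝ × ℝ → ℝ} (hx : Sm x) (hy : Sm y)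
    (z1 : ∀ t, x (t, 0) = 0) (z2 : ∀ t, y (t, 0) = 0) {b : ℝ} (hb : 0 < b) (t : ℝ) :
    HasDerivAt (fun t => ∫ r in (0:ℝ)..b, chi b r * (x (t, r) ^ 2 + y (t, r) ^ 2))
      ((∫ r in (0:ℝ)..b, chi b r * (2 * (x (t, r) * gB x y (t, r) - y (t, r) * gA x y (t, r))))
        - (Real.log (1 + b))⁻¹ * ∫ r in (0:ℝ)..b, rho r * (2 * (x (t, r) * dR y (t, r) - y (t, r) * dR x (t, r)))) t := by
  have c1 := hx.cont; have c2 := hy.cont; have c3 := hx.dR.cont; have c4 := hy.dR.cont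
  have c5 := hx.dT.cont; have c6 := hy.dT.cont; have c7 := hx.dR.dR.cont
  have c8 := hy.dR.dR.cont; have c9 := (hx.gA hy).cont; have c10 := (hx.gB hy).cont
  have cc := chi_cont b; have crr := rho_cont
  have h := hasDerivAt_int' (f := fun p => chi b p.2 * (x p ^ 2 + y p ^ 2))
    (f' := fun p => chi b p.2 * (2 * (x p * dT x p + y p * dT y p))) (by fun_prop) (by fun_prop)
    (fun t r => (q_hasT hx hy t r).const_mul (chi b r)) 0 b t
  refine h.congr_deriv ?_
  have ftc : ∫ r in (0:ℝ)..b, ((-(Real.log (1 + b))⁻¹ * rho r) * (2 * (x (t, r) * dR y (t, r) - y (t, r) * dR x (t, r)))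
      + chi b r * (2 * (x (t, r) * dR (dR y) (t, r) - y (t, r) * dR (dR x) (t, r)))) = 0 := by
    rw [intervalIntegral.integral_eq_sub_of_hasDerivAt (f := fun s => chi b s * (2 * (x (t, s) * dR y (t, s) - y (t, s) * dR x (t, s))))]
    · simp [z1, z2, chi_b hb]
    · intro s hs
      rw [uIcc_of_le hb.le] at hs
      exact (chi_has hs.1).fun_mul (j_hasR hx hy t s)
    · apply Continuous.intervalIntegrable; fun_prop
  rw [← intervalIntegral.integral_const_mul, ← intervalIntegral.integral_sub]
  · refine (add_zero _).symm.trans ((congrArg (fun z => (∫ r in (0:ℝ)..b, chi b r * (2 * (x (t, r) * dT x (t, r) + y (t, r) * dT y (t, r)))) + z) ftc.symm).trans ?_)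
    rw [← intervalIntegral.integral_add]
    · congr 1; ext r
      simp only [gA, gB]; ring
    all_goals apply Continuous.intervalIntegrable; fun_prop
  all_goals apply Continuous.intervalIntegrable; fun_prop


noncomputable def dq (h : ℝ) (x : ℝ × ℝ → ℝ) (p : ℝ × ℝ) : ℝ := (x (p.1, p.2 + h) - x p) / h

theorem Sm.dq {x : ℝ × ℝ → ℝ} (hx : Sm x) (h : ℝ) : Sm (dq h x) := by
  have h1 : ContDiff ℝ ∞ (fun p : ℝ × ℝ => x (p.1, p.2 + h)) :=
    ContDiff.comp (g := x) hx (contDiff_fst.prodMk (contDiff_snd.add contDiff_const))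
  exact (h1.sub hx).div_const h

theorem dR_dq {x : ℝ × ℝ → ℝ} (hx : Sm x) (h : ℝ) : dR (dq h x) = dq h (dR x) := by
  ext ⟨t, r⟩
  refine ((hx.dq h).hasR t r).unique ?_
  exact (((hx.hasR t (r + h)).comp_add_const r h).fun_sub (hx.hasR t r)).div_const h

theorem dT_dq {x : ℝ × ℝ → ℝ} (hx : Sm x) (h : ℝ) : dT (dq h x) = dq h (dT x) := by
  ext ⟨t, r⟩
  refine ((hx.dq h).hasT t r).unique ?_
  exact ((hx.hasT t (r + h)).fun_sub (hx.hasT t r)).div_const h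

theorem gA_dq {x y : ℝ × ℝ → ℝ} (hx : Sm x) (hy : Sm y) (h : ℝ) : gA (dq h x) (dq h y) = dq h (gA x y) := by
  ext p
  simp only [gA, dR_dq hx, dR_dq hx.dR, dT_dq hy]
  simp only [dq, gA]; ring
theorem gB_dq {x y : ℝ × ℝ → ℝ} (hx : Sm x) (hy : Sm y) (h : ℝ) : gB (dq h x) (dq h y) = dq h (gB x y) := by
  ext p
  simp only [gB, dR_dq hy, dR_dq hy.dR, dT_dq hx]
  simp only [dq, gB]; ring

theorem dq_mvt {x : ℝ × ℝ → ℝ} (hx : Sm x) {h : ℝ} (hh : 0 < h) (t r : ℝ) :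
    ∃ s ∈ Ioo r (r + h), dq h x (t, r) = dR x (t, s) := by
  obtain ⟨s, hs, e⟩ := exists_hasDerivAt_eq_slope (fun r => x (t, r)) (fun r => dR x (t, r)) (by linarith : r < r + h)
    (cr hx.cont t).continuousOn (fun s _ => hx.hasR t s)
  refine ⟨s, hs, ?_⟩
  rw [e]; simp [dq]

theorem dq_bdd {x : ℝ × ℝ → ℝ} (hx : Sm x) {T K : ℝ} 
    (hK : ∀ t ∈ Icc (-T) T, ∀ r ∈ Icc (0:ℝ) 3, |dR x (t, r)| ≤ K) {h : ℝ} (hh : 0 < h) (h1 : h ≤ 1 / 2) :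
    ∀ t ∈ Icc (-T) T, ∀ r ∈ Icc (0:ℝ) 2, |dq h x (t, r)| ≤ K := by
  intro t ht r hr
  obtain ⟨s, hs, e⟩ := dq_mvt hx hh t r
  rw [e]; exact hK t ht s ⟨by linarith [hs.1, hr.1], by linarith [hs.2, hr.2]⟩

theorem dq_close {x : ℝ × ℝ → ℝ} (hx : Sm x) (T R : ℝ) :
    ∃ K, 0 ≤ K ∧ ∀ h, 0 < h → h ≤ 1 / 2 → ∀ t ∈ Icc (-T) T, ∀ r ∈ Icc (0:ℝ) R,
      dR x (t, r) ^ 2 ≤ 2 * dq h x (t, r) ^ 2 + K * h := by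
  obtain ⟨K, k0, hK⟩ := bdd hx.dR.dR.cont (-T) T 0 (R + 1)
  refine ⟨2 * K ^ 2, by positivity, fun h hh h1 t ht r hr => ?_⟩
  obtain ⟨s, hs, e⟩ := dq_mvt hx hh t r
  obtain ⟨s', hs', e'⟩ := exists_hasDerivAt_eq_slope (fun r => dR x (t, r)) (fun r => dR (dR x) (t, r)) hs.1
    (_root_.cr hx.dR.cont t).continuousOn (fun s _ => hx.dR.hasR t s)
  have k := hK t ht s' ⟨by linarith [hs'.1, hr.1], by linarith [hs'.2, hs.2, hr.2]⟩
  rw [eq_div_iff (by linarith [hs.1])] at e'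
  rw [e]
  have e2 : (dR (dR x) (t, s') * (s - r)) ^ 2 ≤ K ^ 2 * h := by
    rw [mul_pow, ← sq_abs (dR (dR x) (t, s'))]
    have : (s - r) ^ 2 ≤ h := by nlinarith [hs.1, hs.2]
    gcongr
  have : dR x (t, r) = dR x (t, s) - dR (dR x) (t, s') * (s - r) := by linarith
  rw [this]
  nlinarith [sq_nonneg (dR x (t, s) + dR (dR x) (t, s') * (s - r))]

theorem dq_int {g g' : ℝ → ℝ} (hg : ∀ r, HasDerivAt g (g' r) r) (cg : Continuous g') {h b : ℝ} (hh : 0 < h)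
    (h1 : h ≤ 1) (hb : 0 ≤ b) :
    ∫ r in (0:ℝ)..b, ((g (r + h) - g r) / h) ^ 2 ≤ ∫ r in (0:ℝ)..(b + 1), g' r ^ 2 := by
  have cgg : Continuous g := continuous_iff_continuousAt.2 fun t => (hg t).continuousAt
  have key : ∀ r, ((g (r + h) - g r) / h) ^ 2 ≤ ∫ s in (0:ℝ)..1, g' (r + h * s) ^ 2 := by
    intro r
    have e : ∫ s in (0:ℝ)..1, g' (r + h * s) = (g (r + h) - g r) / h := by
      rw [intervalIntegral.integral_comp_add_mul (fun s => g' s) hh.ne']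
      rw [intervalIntegral.integral_eq_sub_of_hasDerivAt (f := g) (fun s _ => hg s) (cg.intervalIntegrable _ _)]
      simp; ring
    have := int_cs (f := fun s => g' (r + h * s)) (g := fun _ => 1) (by fun_prop) (by fun_prop) (zero_le_one)
    simpa [e] using this
  calc _ ≤ II 0 b 0 1 (fun p => g' (p.1 + h * p.2) ^ 2) := by
        refine intervalIntegral.integral_mono_on (μ := volume) hb (Continuous.intervalIntegrable (by fun_prop) _ _)
          ((ci (F := fun p => g' (p.1 + h * p.2) ^ 2) (by fun_prop) 0 1).intervalIntegrable _ _) fun r _ => key r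
    _ = ∫ s in (0:ℝ)..1, ∫ r in (0:ℝ)..b, g' (r + h * s) ^ 2 := II_swap (by fun_prop)
    _ ≤ ∫ s in (0:ℝ)..1, ∫ r in (0:ℝ)..(b + 1), g' r ^ 2 := by
        refine intervalIntegral.integral_mono_on (μ := volume) zero_le_one
          ((ci (F := fun p => g' (p.2 + h * p.1) ^ 2) (by fun_prop) 0 b).intervalIntegrable _ _)
          (intervalIntegrable_const) fun s hs => ?_
        rw [intervalIntegral.integral_comp_add_right (fun r => g' r ^ 2)]
        have : 0 ≤ h * s := mul_nonneg hh.le hs.1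
        have : h * s ≤ 1 := mul_le_one₀ h1 hs.1 hs.2
        exact int_subset (by fun_prop) (by linarith) (by linarith) (by linarith) fun _ _ => by positivity
    _ = _ := by simp

theorem sq3 (X Y Z : ℝ) : (X + Y + Z) ^ 2 ≤ 3 * (X ^ 2 + Y ^ 2 + Z ^ 2) := by
  nlinarith [sq_nonneg (X - Y), sq_nonneg (X - Z), sq_nonneg (Y - Z)]
theorem sq22 (V d1 d2 D a b : ℝ) : (-V * d1 - D * a) ^ 2 + (-V * d2 - D * b) ^ 2 ≤ 2 * V ^ 2 * (d1 ^ 2 + d2 ^ 2) + 2 * (D ^ 2 * (a ^ 2 + b ^ 2)) := by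
  nlinarith [sq_nonneg (V * d1 - D * a), sq_nonneg (V * d2 - D * b)]

set_option maxHeartbeats 800000 in
theorem Gpt {a b a' b' i i' W W' h w c : ℝ} (hh : 0 < h) (i0 : 0 ≤ i) (i1 : i ≤ 1) (i0' : 0 ≤ i') (ii : i' ≤ i)
    (hi : |i' - i| ≤ h * i) (hc : 0 ≤ c) (w0 : 0 ≤ w) (hW : |W'| ≤ c) (hL : |W' - W| ≤ c * h)
    (h1 : (a ^ 2 + b ^ 2) * i ≤ w) (h2 : (a' ^ 2 + b' ^ 2) * i ≤ w) {d1 d2 A B : ℝ}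
    (e1 : d1 = (a' - a) / h) (e2 : d2 = (b' - b) / h)
    (e3 : A = (-((a' ^ 2 + b' ^ 2) * i' + W') * a' - -((a ^ 2 + b ^ 2) * i + W) * a) / h)
    (e4 : B = (-((a' ^ 2 + b' ^ 2) * i' + W') * b' - -((a ^ 2 + b ^ 2) * i + W) * b) / h) :
    |2 * (d1 * B - d2 * A)| ≤ 8 * (w + c) * (d1 ^ 2 + d2 ^ 2 + (a ^ 2 + b ^ 2)) ∧
    A ^ 2 + B ^ 2 ≤ 28 * (w ^ 2 + c ^ 2) * (d1 ^ 2 + d2 ^ 2 + (a ^ 2 + b ^ 2)) := by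
  set q := a ^ 2 + b ^ 2 with hq
  set q' := a' ^ 2 + b' ^ 2 with hq'
  set f := d1 ^ 2 + d2 ^ 2 with hf
  have q0 : 0 ≤ q := by positivity
  have q0' : 0 ≤ q' := by positivity
  have f0 : 0 ≤ f := by positivity
  set V := q' * i' + W' with hV
  set D := (V - (q * i + W)) / h with hD
  have E1 : A = -V * d1 - D * a := by rw [e3, e1, hD]; field_simp; ring
  have E2 : B = -V * d2 - D * b := by rw [e4, e2, hD]; field_simp; ring
  have P : D = (d1 * (a' + a) + d2 * (b' + b)) * i' + q * ((i' - i) / h) + (W' - W) / h := by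
    rw [hD, hV, e1, e2, hq, hq']; field_simp; ring
  have u1 : ((i' - i) / h) ^ 2 ≤ i ^ 2 := by
    rw [← sq_abs, abs_div, abs_of_pos hh]
    have : |i' - i| / h ≤ i := by rw [div_le_iff₀ hh]; linarith
    gcongr
  have u2 : ((W' - W) / h) ^ 2 ≤ c ^ 2 := by
    rw [← sq_abs, abs_div, abs_of_pos hh]
    have : |W' - W| / h ≤ c := by rw [div_le_iff₀ hh]; linarith
    gcongr
  have u3 : (d1 * (a' + a) + d2 * (b' + b)) ^ 2 ≤ f * (2 * (q + q')) := by
    refine (csd d1 d2 (a' + a) (b' + b)).trans ?_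
    gcongr
    have k1 := sq_nonneg (a' - a)
    have k2 := sq_nonneg (b' - b)
    have e : (a' + a) ^ 2 + (b' + b) ^ 2 = 2 * (q + q') - (a' - a) ^ 2 - (b' - b) ^ 2 := by rw [hq, hq']; ring
    linarith
  have u4 : i' ^ 2 ≤ i ^ 2 := by gcongr
  have D2 : D ^ 2 ≤ 3 * (f * (2 * (q + q')) * i ^ 2 + q ^ 2 * i ^ 2 + c ^ 2) := by
    rw [P]
    have t1 : ((d1 * (a' + a) + d2 * (b' + b)) * i') ^ 2 ≤ f * (2 * (q + q')) * i ^ 2 := by rw [mul_pow]; gcongr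
    have t2 : (q * ((i' - i) / h)) ^ 2 ≤ q ^ 2 * i ^ 2 := by rw [mul_pow]; gcongr
    set X := (d1 * (a' + a) + d2 * (b' + b)) * i'
    set Y := q * ((i' - i) / h)
    set Z := (W' - W) / h
    exact (sq3 X Y Z).trans (by linarith)
  have w2 : (q * i) * (q * i + q' * i) ≤ w * (w + w) := by gcongr
  have w3 : (q * i) ^ 2 ≤ w ^ 2 := by gcongr
  have D2q : D ^ 2 * q ≤ 12 * w ^ 2 * f + 3 * (w ^ 2 + c ^ 2) * q := by
    calc _ ≤ 3 * (f * (2 * (q + q')) * i ^ 2 + q ^ 2 * i ^ 2 + c ^ 2) * q := by gcongr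
      _ = 6 * f * ((q * i) * (q * i + q' * i)) + 3 * ((q * i) ^ 2 + c ^ 2) * q := by ring
      _ ≤ 6 * f * (w * (w + w)) + 3 * (w ^ 2 + c ^ 2) * q := by gcongr
      _ = _ := by ring
  constructor
  · apply abs_le_of_sq_le_sq _ (by positivity)
    have : d1 * B - d2 * A = - D * (d1 * b - d2 * a) := by rw [E1, E2]; ring
    rw [this]
    have cs := csj d1 d2 a b
    calc (2 * (-D * (d1 * b - d2 * a))) ^ 2 = 4 * D ^ 2 * (d1 * b - d2 * a) ^ 2 := by ring
      _ ≤ 4 * D ^ 2 * (f * q) := by gcongr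
      _ = 4 * f * (D ^ 2 * q) := by ring
      _ ≤ 4 * f * (12 * w ^ 2 * f + 3 * (w ^ 2 + c ^ 2) * q) := by gcongr
      _ ≤ 4 * (f + q) * (12 * (w + c) ^ 2 * f + 12 * (w + c) ^ 2 * q) := by
          have k0 : w ^ 2 ≤ (w + c) ^ 2 := by gcongr; linarith
          have k1 := mul_nonneg w0 hc
          have k2 := sq_nonneg w
          have k3 := sq_nonneg c
          have k4 : (w + c) ^ 2 = w ^ 2 + 2 * (w * c) + c ^ 2 := by ring
          have k5 : 3 * (w ^ 2 + c ^ 2) ≤ 12 * (w + c) ^ 2 := by linarith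
          have k6 : 4 * f ≤ 4 * (f + q) := by linarith
          have k7 : 12 * w ^ 2 * f + 3 * (w ^ 2 + c ^ 2) * q ≤ 12 * (w + c) ^ 2 * f + 12 * (w + c) ^ 2 * q :=
            add_le_add (mul_le_mul_of_nonneg_right (by linarith) f0) (mul_le_mul_of_nonneg_right k5 q0)
          exact mul_le_mul k6 k7 (by positivity) (by positivity)
      _ = 48 * ((w + c) ^ 2 * (f + q) ^ 2) := by ring
      _ ≤ 64 * ((w + c) ^ 2 * (f + q) ^ 2) := mul_le_mul_of_nonneg_right (by norm_num) (by positivity)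
      _ = _ := by ring
  · have V2 : V ^ 2 ≤ 2 * (w ^ 2 + c ^ 2) := by
      have : q' * i' ≤ w := le_trans (by gcongr) h2
      have : (q' * i') ^ 2 ≤ w ^ 2 := by gcongr
      have : W' ^ 2 ≤ c ^ 2 := by rw [← sq_abs]; gcongr
      have := sq_nonneg (q' * i' - W')
      have e : V ^ 2 = 2 * ((q' * i') ^ 2 + W' ^ 2) - (q' * i' - W') ^ 2 := by rw [hV]; ring
      linarith
    have : A ^ 2 + B ^ 2 ≤ 2 * V ^ 2 * f + 2 * (D ^ 2 * q) := by
      rw [E1, E2]; exact sq22 V d1 d2 D a b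
    refine this.trans ?_
    calc _ ≤ 2 * (2 * (w ^ 2 + c ^ 2)) * f + 2 * (12 * w ^ 2 * f + 3 * (w ^ 2 + c ^ 2) * q) := by gcongr
      _ = 28 * (w ^ 2 + c ^ 2) * (f + q) - (24 * (c ^ 2 * f) + 22 * ((w ^ 2 + c ^ 2) * q)) := by ring
      _ ≤ _ := sub_le_self _ (by positivity)


noncomputable def nb (x y : ℝ × ℝ → ℝ) (B t : ℝ) : ℝ := ∫ r in (0:ℝ)..B, rho r ^ 2 * (dR x (t, r) ^ 2 + dR y (t, r) ^ 2)
noncomputable def ww (x y : ℝ × ℝ → ℝ) (M B t : ℝ) : ℝ := 8 * √(M * nb x y B t)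

theorem nb_nonneg {x y : ℝ × ℝ → ℝ} {B t : ℝ} (hB : 0 ≤ B) : 0 ≤ nb x y B t :=
  intervalIntegral.integral_nonneg hB fun _ _ => by positivity
theorem nb_cont {x y : ℝ × ℝ → ℝ} (hx : Sm x) (hy : Sm y) (B : ℝ) : Continuous (nb x y B) := by
  have c3 := hx.dR.cont; have c4 := hy.dR.cont; have := rho_cont
  exact ci (F := fun p => rho p.2 ^ 2 * (dR x p ^ 2 + dR y p ^ 2)) (by fun_prop) 0 B
theorem ww_cont {x y : ℝ × ℝ → ℝ} (hx : Sm x) (hy : Sm y) (M B : ℝ) : Continuous (ww x y M B) := by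
  have := nb_cont hx hy B
  unfold ww; fun_prop
theorem ww_nonneg {x y : ℝ × ℝ → ℝ} {M B t : ℝ} : 0 ≤ ww x y M B t := by unfold ww; positivity
theorem ww_sq {x y : ℝ × ℝ → ℝ} {M B t : ℝ} (hM : 0 ≤ M) (hB : 0 ≤ B) : ww x y M B t ^ 2 = 64 * (M * nb x y B t) := by
  unfold ww
  rw [mul_pow, Real.sq_sqrt (mul_nonneg hM (nb_nonneg hB))]; norm_num

theorem ZD.qw {x y W : ℝ × ℝ → ℝ} {T c M : ℝ} (H : ZD x y W T c M) {t : ℝ} (ht : t ∈ Icc (-T) T) {B r : ℝ}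
    (hr : r ∈ Icc 0 B) : 2 * (rho r * (x (t, r) ^ 2 + y (t, r) ^ 2)) ≤ ww x y M B t := by
  have hB : 0 ≤ B := hr.1.trans hr.2
  have hM0 : 0 ≤ M := by linarith [H.hM1]
  have h1 := w_bd H.hx H.hy (H.zx t 0 (by norm_num)) (H.zy t 0 (by norm_num)) (H.hM t ht B hB) hr
  refine (le_abs_self _).trans (abs_le_of_sq_le_sq ?_ ww_nonneg)
  rw [ww_sq hM0 hB, mul_pow]
  have : (16 * M * ∫ r in (0:ℝ)..B, rho r ^ 2 * (dR x (t, r) ^ 2 + dR y (t, r) ^ 2)) = 16 * (M * nb x y B t) := by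
    unfold nb; ring
  linarith

theorem inv_rho {r s : ℝ} (hr : 2 ≤ r) (hs : s ≤ r + 1 / 2) (h0 : 0 ≤ s) : r⁻¹ ≤ 2 * rho s := by
  rw [rho_eq (by linarith), inv_le_iff_one_le_mul₀ (by linarith)]
  have : 1 = (1 + s)⁻¹ * (1 + s) := (inv_mul_cancel₀ (by linarith)).symm
  have h2 : 0 ≤ (1 + s)⁻¹ := by positivity
  nlinarith

theorem ZD.out {x y W : ℝ × ℝ → ℝ} {T c M : ℝ} (H : ZD x y W T c M) {t : ℝ} (ht : t ∈ Icc (-T) T) {b r h : ℝ}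
    (hh : 0 < h) (h1 : h ≤ 1 / 2) (hr : r ∈ Icc 2 b) :
    |2 * (dq h x (t, r) * gB (dq h x) (dq h y) (t, r) - dq h y (t, r) * gA (dq h x) (dq h y) (t, r))| ≤
      8 * (ww x y M (b + 1) t + c) * (dq h x (t, r) ^ 2 + dq h y (t, r) ^ 2 + (x (t, r) ^ 2 + y (t, r) ^ 2)) ∧
    gA (dq h x) (dq h y) (t, r) ^ 2 + gB (dq h x) (dq h y) (t, r) ^ 2 ≤
      28 * (ww x y M (b + 1) t ^ 2 + c ^ 2) * (dq h x (t, r) ^ 2 + dq h y (t, r) ^ 2 + (x (t, r) ^ 2 + y (t, r) ^ 2)) := by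
  have hr1 := hr.1; have hr2 := hr.2
  have rp : 0 < r := by linarith
  have rp' : 0 < r + h := by linarith
  have q1 := H.qw ht (B := b + 1) (r := r) ⟨by linarith, by linarith⟩
  have q2 := H.qw ht (B := b + 1) (r := r + h) ⟨by linarith, by linarith⟩
  have i1 := inv_rho hr1 (by linarith : r ≤ r + 1 / 2) (by linarith)
  have i2 := inv_rho hr1 (by linarith : r + h ≤ r + 1 / 2) (by linarith)
  have hi1 : r⁻¹ ≤ 1 := inv_le_one_of_one_le₀ (by linarith)
  have hii : (r + h)⁻¹ ≤ r⁻¹ := by gcongr; linarith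
  refine Gpt (i := r⁻¹) (i' := (r + h)⁻¹) (W := W (t, r)) (W' := W (t, r + h)) (h := h) (a' := x (t, r + h)) (b' := y (t, r + h)) hh
    (by positivity) hi1
    (by positivity) hii ?_ H.hc ww_nonneg (H.hW t ht _ (by linarith)) ?_ ?_ ?_ rfl rfl ?_ ?_
  · have e : (r + h)⁻¹ - r⁻¹ = -(h * r⁻¹ * (r + h)⁻¹) := by field_simp; ring
    rw [e, abs_neg, abs_of_nonneg (by positivity)]
    have : h * r⁻¹ * (r + h)⁻¹ ≤ h * r⁻¹ * 1 := by gcongr; linarith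
    linarith
  · have := H.hL t ht (r + h) r (by linarith) hr1
    rwa [add_sub_cancel_left, abs_of_pos hh] at this
  · refine le_trans ?_ q1
    calc _ ≤ (x (t, r) ^ 2 + y (t, r) ^ 2) * (2 * rho r) := by gcongr
      _ = _ := by ring
  · refine le_trans ?_ q2
    calc _ ≤ (x (t, r + h) ^ 2 + y (t, r + h) ^ 2) * (2 * rho (r + h)) := by gcongr
      _ = _ := by ring
  · rw [gA_dq H.hx H.hy, dq, H.e1 t ht r hr1, H.e1 t ht (r + h) (by linarith)]; simp only [div_eq_mul_inv]
  · rw [gB_dq H.hx H.hy, dq, H.e2 t ht r hr1, H.e2 t ht (r + h) (by linarith)]; simp only [div_eq_mul_inv]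

theorem dq_zero {x : ℝ × ℝ → ℝ} (zx : ∀ t r, r ≤ 1 → x (t, r) = 0) {h : ℝ} (hh : 0 < h) (h1 : h ≤ 1 / 2) :
    ∀ t r, r < 1 / 2 → dq h x (t, r) = 0 := by
  intro t r hr
  simp [dq, zx t r (by linarith), zx t (r + h) (by linarith)]

theorem shift_int {F : ℝ → ℝ} (cF : Continuous F) (F0 : ∀ r, 0 ≤ F r) {h b : ℝ} (hh : 0 < h) (h1 : h ≤ 1 / 2) (hb : 0 ≤ b) :
    ∫ r in (0:ℝ)..b, (F (r + h) + F r) ≤ 2 * ∫ r in (0:ℝ)..(b + 1), F r := by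
  rw [intervalIntegral.integral_add, intervalIntegral.integral_comp_add_right]
  · have a1 := int_subset cF (a := 0) (b := b + 1) (c := 0 + h) (d := b + h) (by linarith) (by linarith) (by linarith) fun _ _ => F0 _
    have a2 := int_subset cF (a := 0) (b := b + 1) (c := 0) (d := b) (by linarith) (by linarith) (by linarith) fun _ _ => F0 _
    linarith
  all_goals apply Continuous.intervalIntegrable; fun_prop

theorem ZD.flux {x y W : ℝ × ℝ → ℝ} {T c M : ℝ} (H : ZD x y W T c M) {t : ℝ} (ht : t ∈ Icc (-T) T) {b h : ℝ}
    (hh : 0 < h) (h1 : h ≤ 1 / 2) (hb : 0 ≤ b) :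
    |∫ r in (0:ℝ)..b, rho r * (2 * (dq h x (t, r) * dR (dq h y) (t, r) - dq h y (t, r) * dR (dq h x) (t, r)))| ≤
      16 / h ^ 2 * (M + nb x y (b + 1) t) := by
  have hx := H.hx; have hy := H.hy
  have c1 := hx.cont; have c2 := hy.cont; have c3 := hx.dR.cont; have c4 := hy.dR.cont
  have d1 := (hx.dq h).cont; have d2 := (hy.dq h).cont; have d3 := (hx.dq h).dR.cont; have d4 := (hy.dq h).dR.cont
  have crr := rho_cont
  refine (intervalIntegral.abs_integral_le_integral_abs hb).trans ?_
  set F : ℝ → ℝ := fun r => (x (t, r) ^ 2 + y (t, r) ^ 2) + rho r ^ 2 * (dR x (t, r) ^ 2 + dR y (t, r) ^ 2) with hF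
  have cF : Continuous F := by fun_prop
  have F0 : ∀ r, 0 ≤ F r := fun r => by simp only [hF]; positivity
  have e : ∫ r in (0:ℝ)..(b + 1), F r ≤ M + nb x y (b + 1) t := by
    simp only [hF]
    rw [intervalIntegral.integral_add]
    · have := H.hM t ht (b + 1) (by linarith)
      unfold nb; linarith
    all_goals apply Continuous.intervalIntegrable; fun_prop
  calc _ ≤ ∫ r in (0:ℝ)..b, 8 / h ^ 2 * (F (r + h) + F r) := by
        refine intervalIntegral.integral_mono_on (μ := volume) hb (Continuous.intervalIntegrable (by fun_prop) _ _)
          (Continuous.intervalIntegrable (by fun_prop) _ _) fun r hr => ?_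
        have r0 := rho_pos r
        have rr : rho r ≤ 2 * rho (r + h) := by
          rw [rho_eq (by linarith [hr.1]), rho_eq (by linarith [hr.1]), inv_le_iff_one_le_mul₀ (by linarith [hr.1])]
          have e : 1 = (1 + (r + h))⁻¹ * (1 + (r + h)) := (inv_mul_cancel₀ (by linarith [hr.1])).symm
          have h2 : 0 ≤ (1 + (r + h))⁻¹ := by have := hr.1; positivity
          nlinarith [hr.1]
        have rr2 : rho r ^ 2 ≤ 4 * rho (r + h) ^ 2 := by
          calc _ ≤ (2 * rho (r + h)) ^ 2 := by gcongr
            _ = _ := by ring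
        have key := ag (c := 2 * rho r) (α := rho r ^ 2) (β := 1) (csj (dq h x (t, r)) (dq h y (t, r)) (dR (dq h x) (t, r)) (dR (dq h y) (t, r)))
          (by positivity) (by positivity) (by positivity) (by positivity) (by linarith [mul_pow 2 (rho r) 2])
        have e1 : rho r * (2 * (dq h x (t, r) * dR (dq h y) (t, r) - dq h y (t, r) * dR (dq h x) (t, r))) =
          2 * rho r * (dq h x (t, r) * dR (dq h y) (t, r) - dq h y (t, r) * dR (dq h x) (t, r)) := by ring
        rw [e1]
        refine key.trans ?_
        have g : ∀ z : ℝ × ℝ → ℝ, dq h z (t, r) ^ 2 ≤ 2 / h ^ 2 * (z (t, r + h) ^ 2 + z (t, r) ^ 2) := by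
          intro z
          simp only [dq]
          rw [div_pow, div_mul_eq_mul_div]
          gcongr
          nlinarith [sq_nonneg (z (t, r + h) + z (t, r))]
        rw [dR_dq hx, dR_dq hy]
        have g1 := g x; have g2 := g y; have g3 := g (dR x); have g4 := g (dR y)
        have hp : 0 ≤ 2 / h ^ 2 := by positivity
        have E : 8 / h ^ 2 = 4 * (2 / h ^ 2) := by ring
        rw [E]
        set k := 2 / h ^ 2
        have s1 : rho r ^ 2 * (dq h (dR x) (t, r) ^ 2 + dq h (dR y) (t, r) ^ 2) ≤
            rho r ^ 2 * (k * ((dR x (t, r + h) ^ 2 + dR y (t, r + h) ^ 2)) + k * (dR x (t, r) ^ 2 + dR y (t, r) ^ 2)) := by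
          refine mul_le_mul_of_nonneg_left ?_ (by positivity); linarith
        have s2 : rho r ^ 2 * (k * (dR x (t, r + h) ^ 2 + dR y (t, r + h) ^ 2)) ≤ 4 * rho (r + h) ^ 2 * (k * (dR x (t, r + h) ^ 2 + dR y (t, r + h) ^ 2)) := by
          gcongr
        have s3 : 0 ≤ rho r ^ 2 * (k * (dR x (t, r) ^ 2 + dR y (t, r) ^ 2)) := by positivity
        have s4 : 0 ≤ k * ((x (t, r) ^ 2 + y (t, r) ^ 2) + (x (t, r + h) ^ 2 + y (t, r + h) ^ 2)) := by positivity
        simp only [hF]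
        linarith
    _ = 8 / h ^ 2 * ∫ r in (0:ℝ)..b, (F (r + h) + F r) := intervalIntegral.integral_const_mul _ _
    _ ≤ 8 / h ^ 2 * (2 * (M + nb x y (b + 1) t)) := by
        gcongr
        exact (shift_int cF F0 hh h1 hb).trans (by linarith)
    _ = _ := by ring


theorem ex_b (X R : ℝ) (hR : 0 ≤ R) : ∃ b : ℝ, 2 ≤ b ∧ X ≤ Real.log (1 + b) ∧ (1 + R) ^ 2 ≤ 1 + b ∧ R ≤ b := by
  refine ⟨2 + Real.exp X + (1 + R) ^ 2, ?_, ?_, ?_, ?_⟩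
  · have := Real.exp_pos X; have := sq_nonneg (1 + R); linarith
  · rw [Real.le_log_iff_exp_le]
    · have := sq_nonneg (1 + R); linarith
    · have := Real.exp_pos X; have := sq_nonneg (1 + R); linarith
  · have := Real.exp_pos X; linarith
  · have := Real.exp_pos X; nlinarith

theorem ZD.inn {x y W : ℝ × ℝ → ℝ} {T c M : ℝ} (H : ZD x y W T c M) :
    ∃ K, 0 ≤ K ∧ ∀ h, 0 < h → h ≤ 1 / 2 → ∀ t ∈ Icc (-T) T, ∀ r ∈ Icc (0:ℝ) 2,
      |dq h x (t, r)| ≤ K ∧ |dq h y (t, r)| ≤ K ∧ |gA (dq h x) (dq h y) (t, r)| ≤ K ∧ |gB (dq h x) (dq h y) (t, r)| ≤ K := by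
  have hx := H.hx; have hy := H.hy
  obtain ⟨K, K0, hK⟩ := bdd6 hx.dR.cont hy.dR.cont (hx.gA hy).dR.cont (hx.gB hy).dR.cont hx.cont hx.cont (-T) T 0 3
  refine ⟨K, K0, fun h hh h1 t ht r hr => ?_⟩
  rw [gA_dq hx hy, gB_dq hx hy]
  exact ⟨dq_bdd hx (fun t ht r hr => (hK t ht r hr).1) hh h1 t ht r hr,
    dq_bdd hy (fun t ht r hr => (hK t ht r hr).2.1) hh h1 t ht r hr,
    dq_bdd (hx.gA hy) (fun t ht r hr => (hK t ht r hr).2.2.1) hh h1 t ht r hr,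
    dq_bdd (hx.gB hy) (fun t ht r hr => (hK t ht r hr).2.2.2.1) hh h1 t ht r hr⟩

theorem ZD.nbI {x y W : ℝ × ℝ → ℝ} {T c M : ℝ} (H : ZD x y W T c M) : ∃ C, 0 ≤ C ∧ ∀ B, 1 ≤ B →
    ∫ t in (-(T / 2))..(T / 2), nb x y B t ≤ C := zd_mor' H

theorem int_mono0 {f g : ℝ → ℝ} (cf : Continuous f) (cg : Continuous g) {a b : ℝ} (hab : a ≤ b)
    (h : ∀ r ∈ Icc a b, f r ≤ g r) : ∫ r in a..b, f r ≤ ∫ r in a..b, g r :=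
  intervalIntegral.integral_mono_on hab (cf.intervalIntegrable _ _) (cg.intervalIntegrable _ _) h

theorem int_aff {f : ℝ → ℝ} (cf : Continuous f) (u v a b : ℝ) :
    ∫ t in a..b, (u + v * f t) = (b - a) * u + v * ∫ t in a..b, f t := by
  rw [intervalIntegral.integral_add intervalIntegrable_const (Continuous.intervalIntegrable (by fun_prop) _ _)]
  simp

theorem ZD.H1 {x y W : ℝ × ℝ → ℝ} {T c M : ℝ} (H : ZD x y W T c M) {E0 : ℝ}
    (hE : ∀ B, 0 ≤ B → ∫ r in (0:ℝ)..B, (dR x (0, r) ^ 2 + dR y (0, r) ^ 2) ≤ E0) :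
    ∃ C, 0 ≤ C ∧ ∀ h, 0 < h → h ≤ 1 / 2 → ∀ t ∈ Icc (-(T / 2)) (T / 2), ∀ R, 0 ≤ R →
      ∫ r in (0:ℝ)..R, (dq h x (t, r) ^ 2 + dq h y (t, r) ^ 2) ≤ C := by
  have hx := H.hx; have hy := H.hy; have hT := H.hT; have hc := H.hc
  have hM0 : 0 ≤ M := by linarith [H.hM1]
  have c1 := hx.cont; have c2 := hy.cont; have c3 := hx.dR.cont; have c4 := hy.dR.cont
  have crr := rho_cont
  obtain ⟨K, K0, hK⟩ := H.inn
  obtain ⟨C0, C00, hC0⟩ := H.nbI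
  have hE0 : 0 ≤ E0 := by simpa using hE 0 le_rfl
  set L := 8 * ((1 + c) * T + 64 * M * C0) with hL
  set G := 8 * K ^ 2 * T + 1 with hG
  refine ⟨2 * (Real.exp L * (E0 + M + G)), by positivity, fun h hh h1 t ht R hR => ?_⟩
  obtain ⟨b, b2, bX, bR, hRb⟩ := ex_b (16 / h ^ 2 * (M * T + C0)) R hR
  have b0 : 0 < b := by linarith
  have d1 := (hx.dq h).cont; have d2 := (hy.dq h).cont; have d3 := (hx.dq h).dR.cont; have d4 := (hy.dq h).dR.cont
  have d5 := ((hx.dq h).gA (hy.dq h)).cont; have d6 := ((hx.dq h).gB (hy.dq h)).cont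
  have cc := chi_cont b
  have lp := logb_pos b0
  have cw := ww_cont hx hy M (b + 1)
  have cn := nb_cont hx hy (b + 1)
  have zz : ∀ t, dq h x (t, 0) = 0 := fun t => dq_zero H.zx hh h1 t 0 (by norm_num)
  have zz' : ∀ t, dq h y (t, 0) = 0 := fun t => dq_zero H.zy hh h1 t 0 (by norm_num)
  set Fl : ℝ → ℝ := fun t => ∫ r in (0:ℝ)..b, rho r * (2 * (dq h x (t, r) * dR (dq h y) (t, r) - dq h y (t, r) * dR (dq h x) (t, r))) with hFl
  have cFl : Continuous Fl := ci (F := fun p => rho p.2 * (2 * (dq h x p * dR (dq h y) p - dq h y p * dR (dq h x) p))) (by fun_prop) 0 b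
  set P : ℝ × ℝ → ℝ := fun p => chi b p.2 * (2 * (dq h x p * gB (dq h x) (dq h y) p - dq h y p * gA (dq h x) (dq h y) p)) with hP
  have cP : Continuous P := by fun_prop
  have sub : ∀ t ∈ Icc (-(T / 2)) (T / 2), t ∈ Icc (-T) T := fun t ht => ⟨by linarith [ht.1], by linarith [ht.2]⟩
  have hm0 : 0 ≤ ∫ r in (0:ℝ)..b, chi b r * (dq h x (0, r) ^ 2 + dq h y (0, r) ^ 2) :=
    intervalIntegral.integral_nonneg b0.le fun r hr => mul_nonneg (chi_nonneg b0 hr.1 hr.2) (by positivity)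
  have key := gron (m := fun t => ∫ r in (0:ℝ)..b, chi b r * (dq h x (t, r) ^ 2 + dq h y (t, r) ^ 2))
    (m' := fun t => (∫ r in (0:ℝ)..b, P (t, r)) - (Real.log (1 + b))⁻¹ * Fl t)
    (l := fun t => 8 * (ww x y M (b + 1) t + c)) (g := fun t => 8 * K ^ 2 + (Real.log (1 + b))⁻¹ * |Fl t|)
    (A := M) (S := T / 2) (L := L) (G := G) hM0 (fun t => cutId (hx.dq h) (hy.dq h) zz zz' b0 t)
    hm0 (by fun_prop) (by fun_prop) (fun t => by positivity)
    (fun t => by have := ww_nonneg (x := x) (y := y) (M := M) (B := b + 1) (t := t); positivity) ?_ ?_ ?_ t ht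
  · have m0 : ∫ r in (0:ℝ)..b, chi b r * (dq h x (0, r) ^ 2 + dq h y (0, r) ^ 2) ≤ E0 := by
      refine le_trans ?_ (hE (b + 1) (by linarith))
      have i1 := dq_int (hx.hasR 0) (_root_.cr c3 0) hh (by linarith) b0.le
      have i2 := dq_int (hy.hasR 0) (_root_.cr c4 0) hh (by linarith) b0.le
      rw [intervalIntegral.integral_add (Continuous.intervalIntegrable (by fun_prop) _ _) (Continuous.intervalIntegrable (by fun_prop) _ _)]
      refine le_trans ?_ (add_le_add i1 i2)
      change _ ≤ (∫ r in (0:ℝ)..b, dq h x (0, r) ^ 2) + ∫ r in (0:ℝ)..b, dq h y (0, r) ^ 2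
      rw [← intervalIntegral.integral_add (Continuous.intervalIntegrable (by fun_prop) _ _) (Continuous.intervalIntegrable (by fun_prop) _ _)]
      refine int_mono0 (by fun_prop) (by fun_prop) b0.le fun r hr => ?_
      exact mul_le_of_le_one_left (by positivity) (chi_le b0 hr.1)
    have st : ∫ r in (0:ℝ)..R, (dq h x (t, r) ^ 2 + dq h y (t, r) ^ 2) ≤ 2 * ∫ r in (0:ℝ)..b, chi b r * (dq h x (t, r) ^ 2 + dq h y (t, r) ^ 2) := by
      rw [← intervalIntegral.integral_const_mul]
      refine le_trans ?_ (int_subset (by fun_prop) le_rfl hR hRb fun r hr => ?_)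
      · refine int_mono0 (by fun_prop) (by fun_prop) hR fun r hr => ?_
        rcases hR.eq_or_lt with e | e
        · have : r = 0 := by linarith [hr.1, hr.2]
          subst this; simp [zz, zz']
        · have := chi_half hr.1 hr.2 e bR
          have f0 : 0 ≤ dq h x (t, r) ^ 2 + dq h y (t, r) ^ 2 := by positivity
          nlinarith
      · have := chi_nonneg b0 hr.1 hr.2
        positivity
    refine st.trans ?_
    have : Real.exp L * ((∫ r in (0:ℝ)..b, chi b r * (dq h x (0, r) ^ 2 + dq h y (0, r) ^ 2)) + M + G) ≤ Real.exp L * (E0 + M + G) := by gcongr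
    linarith
  · intro t ht
    have ht' := sub t ht
    set w := ww x y M (b + 1) t
    have w0 : 0 ≤ w := ww_nonneg
    have a1 : |∫ r in (0:ℝ)..2, P (t, r)| ≤ 8 * K ^ 2 := by
      refine (intervalIntegral.abs_integral_le_integral_abs (by norm_num)).trans ?_
      refine (int_mono0 (g := fun _ => 4 * K ^ 2) (by fun_prop) (by fun_prop) (by norm_num) fun r hr => ?_).trans ?_
      · obtain ⟨k1, k2, k3, k4⟩ := hK h hh h1 t ht' r hr
        simp only [hP]
        have x0 := chi_nonneg b0 hr.1 (hr.2.trans b2)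
        rw [abs_mul, abs_of_nonneg x0]
        refine (mul_le_of_le_one_left (abs_nonneg _) (chi_le b0 hr.1)).trans ?_
        rw [abs_mul, abs_two]
        have := abs_sub (dq h x (t, r) * gB (dq h x) (dq h y) (t, r)) (dq h y (t, r) * gA (dq h x) (dq h y) (t, r))
        rw [abs_mul, abs_mul] at this
        have e1 := mul_le_mul k1 k4 (abs_nonneg _) K0
        have e2 := mul_le_mul k2 k3 (abs_nonneg _) K0
        linarith [pow_two K]
      · simp; linarith
    have a2 : |∫ r in (2:ℝ)..b, P (t, r)| ≤ 8 * (w + c) * ((∫ r in (0:ℝ)..b, chi b r * (dq h x (t, r) ^ 2 + dq h y (t, r) ^ 2)) + M) := by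
      refine (intervalIntegral.abs_integral_le_integral_abs b2).trans ?_
      calc _ ≤ ∫ r in (2:ℝ)..b, 8 * (w + c) * (chi b r * (dq h x (t, r) ^ 2 + dq h y (t, r) ^ 2) + (x (t, r) ^ 2 + y (t, r) ^ 2)) := by
            refine int_mono0 (by fun_prop) (by fun_prop) b2 fun r hr => ?_
            have o := (H.out ht' hh h1 hr).1
            have r0 : 0 ≤ r := by linarith [hr.1]
            have x0 := chi_nonneg b0 r0 hr.2
            have x1 := chi_le b0 r0
            simp only [hP]
            rw [abs_mul, abs_of_nonneg x0]
            refine (mul_le_mul_of_nonneg_left o x0).trans ?_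
            have q0 : 0 ≤ x (t, r) ^ 2 + y (t, r) ^ 2 := by positivity
            calc _ = 8 * (w + c) * (chi b r * (dq h x (t, r) ^ 2 + dq h y (t, r) ^ 2) + chi b r * (x (t, r) ^ 2 + y (t, r) ^ 2)) := by ring
              _ ≤ _ := by
                gcongr
                exact mul_le_of_le_one_left q0 x1
        _ = 8 * (w + c) * ∫ r in (2:ℝ)..b, (chi b r * (dq h x (t, r) ^ 2 + dq h y (t, r) ^ 2) + (x (t, r) ^ 2 + y (t, r) ^ 2)) :=
            intervalIntegral.integral_const_mul _ _
        _ ≤ _ := by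
            gcongr
            refine (int_subset (by fun_prop) (by norm_num : (0:ℝ) ≤ 2) b2 le_rfl fun r hr => ?_).trans ?_
            · have := chi_nonneg b0 hr.1 hr.2
              positivity
            · rw [intervalIntegral.integral_add (Continuous.intervalIntegrable (by fun_prop) _ _) (Continuous.intervalIntegrable (by fun_prop) _ _)]
              have := H.hM t ht' b b0.le
              linarith
    have sp : ∫ r in (0:ℝ)..b, P (t, r) = (∫ r in (0:ℝ)..2, P (t, r)) + ∫ r in (2:ℝ)..b, P (t, r) :=
      (intervalIntegral.integral_add_adjacent_intervals (Continuous.intervalIntegrable (by fun_prop) _ _) (Continuous.intervalIntegrable (by fun_prop) _ _)).symm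
    have a3 := abs_sub (∫ r in (0:ℝ)..b, P (t, r)) ((Real.log (1 + b))⁻¹ * Fl t)
    have a4 := abs_add_le (∫ r in (0:ℝ)..2, P (t, r)) (∫ r in (2:ℝ)..b, P (t, r))
    rw [← sp] at a4
    rw [abs_mul, abs_of_nonneg (inv_nonneg.2 lp.le)] at a3
    linarith
  · calc ∫ t in (-(T / 2))..(T / 2), 8 * (ww x y M (b + 1) t + c) ≤ ∫ t in (-(T / 2))..(T / 2), (8 * (1 + c) + 512 * M * nb x y (b + 1) t) := by
          refine int_mono0 (by fun_prop) (by fun_prop) (by linarith) fun t ht => ?_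
          have := ww_sq (x := x) (y := y) (t := t) hM0 (by linarith : 0 ≤ b + 1)
          nlinarith [sq_nonneg (ww x y M (b + 1) t - 1), sq_nonneg (ww x y M (b + 1) t)]
      _ = 8 * (1 + c) * T + 512 * M * ∫ t in (-(T / 2))..(T / 2), nb x y (b + 1) t := by
          rw [int_aff cn]; ring
      _ ≤ 8 * (1 + c) * T + 512 * M * C0 := by
          gcongr; exact hC0 (b + 1) (by linarith)
      _ = L := by rw [hL]; ring
  · calc ∫ t in (-(T / 2))..(T / 2), (8 * K ^ 2 + (Real.log (1 + b))⁻¹ * |Fl t|) ≤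
          ∫ t in (-(T / 2))..(T / 2), ((8 * K ^ 2 + (Real.log (1 + b))⁻¹ * (16 / h ^ 2 * M)) + (Real.log (1 + b))⁻¹ * (16 / h ^ 2) * nb x y (b + 1) t) := by
          refine int_mono0 (by fun_prop) (by fun_prop) (by linarith) fun t ht => ?_
          have := mul_le_mul_of_nonneg_left (H.flux (sub t ht) hh h1 b0.le) (inv_nonneg.2 lp.le)
          simp only [hFl]
          linarith
      _ = (8 * K ^ 2 + (Real.log (1 + b))⁻¹ * (16 / h ^ 2 * M)) * T + (Real.log (1 + b))⁻¹ * (16 / h ^ 2) * ∫ t in (-(T / 2))..(T / 2), nb x y (b + 1) t := by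
          rw [int_aff cn]; ring
      _ ≤ (8 * K ^ 2 + (Real.log (1 + b))⁻¹ * (16 / h ^ 2 * M)) * T + (Real.log (1 + b))⁻¹ * (16 / h ^ 2) * C0 := by
          gcongr; exact hC0 (b + 1) (by linarith)
      _ = 8 * K ^ 2 * T + (Real.log (1 + b))⁻¹ * (16 / h ^ 2 * (M * T + C0)) := by ring
      _ ≤ G := by
          rw [hG]; gcongr
          rw [inv_mul_le_iff₀ lp]; linarith


theorem ex_h (X : ℝ) (hX : 0 ≤ X) : ∃ h : ℝ, 0 < h ∧ h ≤ 1 / 2 ∧ X * h ≤ 1 := by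
  refine ⟨min (1 / 2) (1 / (1 + X)), by positivity, min_le_left _ _, ?_⟩
  calc X * min (1 / 2) (1 / (1 + X)) ≤ X * (1 / (1 + X)) := by gcongr; exact min_le_right _ _
    _ ≤ 1 := by rw [mul_one_div, div_le_one (by positivity)]; linarith

theorem ZD.H1r {x y W : ℝ × ℝ → ℝ} {T c M : ℝ} (H : ZD x y W T c M) {E0 : ℝ}
    (hE : ∀ B, 0 ≤ B → ∫ r in (0:ℝ)..B, (dR x (0, r) ^ 2 + dR y (0, r) ^ 2) ≤ E0) :
    ∃ C, 0 ≤ C ∧ ∀ t ∈ Icc (-(T / 2)) (T / 2), ∀ R, 0 ≤ R →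
      ∫ r in (0:ℝ)..R, (dR x (t, r) ^ 2 + dR y (t, r) ^ 2) ≤ C := by
  obtain ⟨C, C0, hC⟩ := H.H1 hE
  have hx := H.hx; have hy := H.hy
  refine ⟨2 * C + 1, by positivity, fun t ht R hR => ?_⟩
  obtain ⟨K1, k1, h1⟩ := dq_close hx (T / 2) R
  obtain ⟨K2, k2, h2⟩ := dq_close hy (T / 2) R
  obtain ⟨h, hh, hh1, hX⟩ := ex_h ((K1 + K2) * R) (by positivity)
  have c3 := hx.dR.cont; have c4 := hy.dR.cont
  have d1 := (hx.dq h).cont; have d2 := (hy.dq h).cont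
  calc _ ≤ ∫ r in (0:ℝ)..R, ((K1 + K2) * h + 2 * (dq h x (t, r) ^ 2 + dq h y (t, r) ^ 2)) := by
        refine int_mono0 (by fun_prop) (by fun_prop) hR fun r hr => ?_
        linarith [h1 h hh hh1 t ht r hr, h2 h hh hh1 t ht r hr]
    _ = (R - 0) * ((K1 + K2) * h) + 2 * ∫ r in (0:ℝ)..R, (dq h x (t, r) ^ 2 + dq h y (t, r) ^ 2) :=
        int_aff (by fun_prop) _ _ _ _
    _ ≤ _ := by
        have := hC h hh hh1 t ht R hR
        linarith

theorem Gt_le {x y : ℝ × ℝ → ℝ} {b t r : ℝ} (hb : 1 ≤ b) (hr : r ∈ Icc 0 b) :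
    -Gt x y b (t, r) ≤ 1 / 4 * ((vb b r ^ 2 * rho r ^ 2) * (dR x (t, r) ^ 2 + dR y (t, r) ^ 2))
      + 8 * (gA x y (t, r) ^ 2 + gB x y (t, r) ^ 2) + 4 * (x (t, r) ^ 2 + y (t, r) ^ 2) := by
  obtain ⟨v0, v1, w1, w2, w3, _, _⟩ := wt hb hr.1 hr.2
  have r0 := (rho_pos r).le
  have r1 := rho_le hr.1
  unfold Gt
  generalize dR x (t, r) = xr
  generalize dR y (t, r) = yr
  generalize gA x y (t, r) = A
  generalize gB x y (t, r) = B
  generalize x (t, r) = X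
  generalize y (t, r) = Y
  have a1 : vb b r * rho r ≤ 1 := mul_le_one₀ v1 r0 r1
  have F0b : F0 b r ^ 2 ≤ (vb b r * rho r) ^ 2 := sq_le_sq' (by linarith [(abs_le.1 w1).1]) (abs_le.1 w1).2
  have aa : vb b r ^ 2 * rho r ^ 2 ≤ 1 := by
    rw [← mul_pow]; exact pow_le_one₀ (by positivity) a1
  rw [mul_pow] at F0b
  have F1p : 0 ≤ F1 b r := le_trans (by positivity) w2
  generalize vb b r ^ 2 * rho r ^ 2 = a at *
  generalize F0 b r = f0 at *
  generalize F1 b r = f1 at *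
  have a0 : 0 ≤ a := le_trans (sq_nonneg _) F0b
  have e1 := ag (α := a / 4) (β := 4) (c := 2 * f0) (csd A B xr yr)
    (by positivity) (by positivity) (by positivity) (by norm_num) (by nlinarith)
  have e2 := ag (α := 1 / 2) (β := 1 / 2) (c := 1) (csd X Y A B)
    (by positivity) (by positivity) (by positivity) (by norm_num) (by norm_num)
  rw [one_mul] at e2
  have e3 : f1 * |X * A + Y * B| ≤ 7 * (1 / 2 * (A ^ 2 + B ^ 2) + 1 / 2 * (X ^ 2 + Y ^ 2)) :=
    mul_le_mul (by linarith) e2 (abs_nonneg _) (by norm_num)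
  have u1 := neg_abs_le (2 * f0 * (A * xr + B * yr))
  have u2 := mul_le_mul_of_nonneg_left (neg_abs_le (X * A + Y * B)) F1p
  have s1 := sq_nonneg A
  have s2 := sq_nonneg B
  have s3 := sq_nonneg X
  have s4 := sq_nonneg Y
  linarith

theorem ZD.H2 {x y W : ℝ × ℝ → ℝ} {T c M : ℝ} (H : ZD x y W T c M) {E0 : ℝ}
    (hE : ∀ B, 0 ≤ B → ∫ r in (0:ℝ)..B, (dR x (0, r) ^ 2 + dR y (0, r) ^ 2) ≤ E0) :
    ∃ C, 0 ≤ C ∧ ∀ h, 0 < h → h ≤ 1 / 2 → ∀ b, 2 ≤ b →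
      II (-(T / 2)) (T / 2) 0 b (fun p => ps (T / 2) p.1 ^ 2 * ((vb b p.2 ^ 2 * rho p.2 ^ 2) * (dR (dq h x) p ^ 2 + dR (dq h y) p ^ 2))) ≤ C := by
  have hx := H.hx; have hy := H.hy; have hT := H.hT; have hc := H.hc
  have hM0 : 0 ≤ M := by linarith [H.hM1]
  have crr := rho_cont
  obtain ⟨K, K0, hK⟩ := H.inn
  obtain ⟨C0, C00, hC0⟩ := H.nbI
  obtain ⟨C, C1, hC⟩ := H.H1 hE
  set S := T / 2 with hS
  have S0 : 0 < S := by positivity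
  set CG := (2 * S) * (4 * K ^ 2 + 28 * (C + M) * c ^ 2) + 28 * (C + M) * (64 * M) * C0 with hCG
  set A := 8 * S ^ 2 + 1444 * S ^ 4 + 4 * S ^ 4 with hA
  have A0 : 0 ≤ A := by positivity
  refine ⟨A * (2 * S * C) + 8 * S ^ 4 * CG, by positivity, fun h hh h1 b b2 => ?_⟩
  have b0 : 0 ≤ b := by linarith
  have d1 := (hx.dq h).cont; have d2 := (hy.dq h).cont; have d3 := (hx.dq h).dR.cont; have d4 := (hy.dq h).dR.cont
  have d5 := ((hx.dq h).gA (hy.dq h)).cont; have d6 := ((hx.dq h).gB (hy.dq h)).cont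
  have c1 := hx.cont; have c2 := hy.cont
  have cn := nb_cont hx hy (b + 1)
  have cv := vb_cont b; have cp := ps_cont S
  have cG := Gt_cont (hx.dq h) (hy.dq h) b
  have sub : ∀ t ∈ Icc (-S) S, t ∈ Icc (-T) T := fun t ht => ⟨by linarith [ht.1], by linarith [ht.2]⟩
  have m := mor (hx.dq h) (hy.dq h) (dq_zero H.zx hh h1) (dq_zero H.zy hh h1) S0 (by linarith : 1 ≤ b)
  set f : ℝ × ℝ → ℝ := fun p => dq h x p ^ 2 + dq h y p ^ 2 with hf
  have cf : Continuous f := by fun_prop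
  set g : ℝ × ℝ → ℝ := fun p => gA (dq h x) (dq h y) p ^ 2 + gB (dq h x) (dq h y) p ^ 2 with hg
  have cg : Continuous g := by fun_prop
  set J : ℝ × ℝ → ℝ := fun p => ps S p.1 ^ 2 * ((vb b p.2 ^ 2 * rho p.2 ^ 2) * (dR (dq h x) p ^ 2 + dR (dq h y) p ^ 2)) with hJ
  have cJ : Continuous J := by fun_prop
  have fI : II (-S) S 0 b f ≤ 2 * S * C := by
    calc _ ≤ ∫ t in (-S)..S, C := by
          refine int_mono0 (ci cf 0 b) continuous_const (by linarith) fun t ht => hC h hh h1 t ht b b0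
      _ = _ := by rw [intervalIntegral.integral_const, smul_eq_mul]; ring
  have gI : II (-S) S 0 b g ≤ CG := by
    calc _ ≤ ∫ t in (-S)..S, ((4 * K ^ 2 + 28 * (C + M) * c ^ 2) + 28 * (C + M) * (64 * M) * nb x y (b + 1) t) := by
          refine int_mono0 (ci cg 0 b) (by fun_prop) (by linarith) fun t ht => ?_
          rw [← intervalIntegral.integral_add_adjacent_intervals (b := 2) ((_root_.cr cg t).intervalIntegrable _ _) ((_root_.cr cg t).intervalIntegrable _ _)]
          have i1 : ∫ r in (0:ℝ)..2, g (t, r) ≤ 4 * K ^ 2 := by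
            calc _ ≤ ∫ r in (0:ℝ)..2, 2 * K ^ 2 := by
                  refine int_mono0 (by fun_prop) (by fun_prop) (by norm_num) fun r hr => ?_
                  obtain ⟨_, _, k3, k4⟩ := hK h hh h1 t (sub t ht) r hr
                  have := sq_le_sq' (abs_le.1 k3).1 (abs_le.1 k3).2
                  have := sq_le_sq' (abs_le.1 k4).1 (abs_le.1 k4).2
                  simp only [hg]; linarith
              _ = _ := by rw [intervalIntegral.integral_const, smul_eq_mul]; ring
          have w0 : 0 ≤ 28 * (ww x y M (b + 1) t ^ 2 + c ^ 2) := by positivity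
          have i2 : ∫ r in (2:ℝ)..b, g (t, r) ≤ 28 * (ww x y M (b + 1) t ^ 2 + c ^ 2) * (C + M) := by
            calc _ ≤ ∫ r in (2:ℝ)..b, 28 * (ww x y M (b + 1) t ^ 2 + c ^ 2) * (dq h x (t, r) ^ 2 + dq h y (t, r) ^ 2 + (x (t, r) ^ 2 + y (t, r) ^ 2)) := by
                  refine int_mono0 (by fun_prop) (by fun_prop) b2 fun r hr => ?_
                  exact (H.out (sub t ht) hh h1 hr).2
              _ = 28 * (ww x y M (b + 1) t ^ 2 + c ^ 2) * ∫ r in (2:ℝ)..b, (dq h x (t, r) ^ 2 + dq h y (t, r) ^ 2 + (x (t, r) ^ 2 + y (t, r) ^ 2)) :=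
                  intervalIntegral.integral_const_mul _ _
              _ ≤ _ := by
                  refine mul_le_mul_of_nonneg_left ?_ w0
                  refine (int_subset (by fun_prop) (by norm_num : (0:ℝ) ≤ 2) b2 le_rfl fun r hr => by positivity).trans ?_
                  rw [intervalIntegral.integral_add (Continuous.intervalIntegrable (by fun_prop) _ _) (Continuous.intervalIntegrable (by fun_prop) _ _)]
                  exact add_le_add (hC h hh h1 t ht b b0) (H.hM t (sub t ht) b b0)
          rw [ww_sq hM0 (by linarith)] at i2
          linarith
      _ = (S - -S) * (4 * K ^ 2 + 28 * (C + M) * c ^ 2) + 28 * (C + M) * (64 * M) * ∫ t in (-S)..S, nb x y (b + 1) t := int_aff cn _ _ _ _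
      _ ≤ CG := by
          have := mul_le_mul_of_nonneg_left (hC0 (b + 1) (by linarith)) (by positivity : 0 ≤ 28 * (C + M) * (64 * M))
          rw [hCG]; linarith
  have key : II (-S) S 0 b (fun p => (8 * S ^ 2 + 1444 * S ^ 4) * (dq h x p ^ 2 + dq h y p ^ 2) + ps S p.1 ^ 2 * (-Gt (dq h x) (dq h y) b p)) ≤
      II (-S) S 0 b (fun p => (1 / 4 * J p + A * f p) + 8 * S ^ 4 * g p) := by
    refine II_mono (by linarith) b0 (by fun_prop) (by fun_prop) fun t ht r hr => ?_
    have q0 := ps_nonneg (T := S) ht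
    have q1 := ps_le (T := S) (t := t)
    have e4 := Gt_le (x := dq h x) (y := dq h y) (t := t) (by linarith : 1 ≤ b) hr
    have p4 : ps S t ^ 2 ≤ S ^ 4 := by
      calc _ ≤ (S ^ 2) ^ 2 := pow_le_pow_left₀ q0 q1 2
        _ = _ := by ring
    have e5 := mul_le_mul_of_nonneg_left e4 (sq_nonneg (ps S t))
    have f0 : 0 ≤ 8 * g (t, r) + 4 * f (t, r) := by simp only [hf, hg]; positivity
    have e6 := mul_le_mul_of_nonneg_right p4 f0
    simp only [hf, hg, hA, hJ] at e6 ⊢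
    linarith
  have key2 : II (-S) S 0 b (fun p => (1 / 4 * J p + A * f p) + 8 * S ^ 4 * g p) =
      1 / 4 * II (-S) S 0 b J + A * II (-S) S 0 b f + 8 * S ^ 4 * II (-S) S 0 b g := by
    rw [II_add (by fun_prop) (by fun_prop), II_add (by fun_prop) (by fun_prop), II_mul, II_mul, II_mul]
  rw [key2] at key
  have k1 := mul_le_mul_of_nonneg_left fI A0
  have k2 := mul_le_mul_of_nonneg_left gI (by positivity : 0 ≤ 8 * S ^ 4)
  linarith

theorem ZD.H2r {x y W : ℝ × ℝ → ℝ} {T c M : ℝ} (H : ZD x y W T c M) {E0 : ℝ}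
    (hE : ∀ B, 0 ≤ B → ∫ r in (0:ℝ)..B, (dR x (0, r) ^ 2 + dR y (0, r) ^ 2) ≤ E0) :
    ∃ C, 0 ≤ C ∧ ∀ R, 1 ≤ R → II (-(T / 4)) (T / 4) 0 R (fun p => rho p.2 ^ 2 * (dR (dR x) p ^ 2 + dR (dR y) p ^ 2)) ≤ C := by
  obtain ⟨C, C0, hC⟩ := H.H2 hE
  have hx := H.hx; have hy := H.hy; have hT := H.hT
  have crr := rho_cont
  refine ⟨2 * ((9 / 64 * (T / 2) ^ 4)⁻¹ * C) + 1, by positivity, fun R hR => ?_⟩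
  obtain ⟨K1, k1, h1⟩ := dq_close hx.dR (T / 4) R
  obtain ⟨K2, k2, h2⟩ := dq_close hy.dR (T / 4) R
  have R0 : 0 ≤ R := by linarith
  obtain ⟨h, hh, hh1, hX⟩ := ex_h ((K1 + K2) * (T / 2) * R) (by positivity)
  have c3 := hx.dR.dR.cont; have c4 := hy.dR.dR.cont
  have d1 := (hx.dq h).dR.cont; have d2 := (hy.dq h).dR.cont
  have u := unw (F := fun p => dR (dq h x) p ^ 2 + dR (dq h y) p ^ 2) (by fun_prop) (fun _ => by positivity) (by positivity : 0 < T / 2) (hC h hh hh1) R hR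
  have e : T / 2 / 2 = T / 4 := by ring
  rw [e] at u
  calc _ ≤ II (-(T / 4)) (T / 4) 0 R (fun p => 2 * (rho p.2 ^ 2 * (dR (dq h x) p ^ 2 + dR (dq h y) p ^ 2)) + (K1 + K2) * h) := by
        refine II_mono (by linarith) R0 (by fun_prop) (by fun_prop) fun t ht r hr => ?_
        have e1 := h1 h hh hh1 t ht r hr
        have e2 := h2 h hh hh1 t ht r hr
        rw [← dR_dq hx] at e1
        rw [← dR_dq hy] at e2
        have r1 : rho r ^ 2 ≤ 1 := pow_le_one₀ (rho_pos r).le (rho_le hr.1)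
        have e3 := mul_le_mul_of_nonneg_left (add_le_add e1 e2) (sq_nonneg (rho r))
        have e4 := mul_le_mul_of_nonneg_right r1 (by positivity : 0 ≤ (K1 + K2) * h)
        simp only
        linarith
    _ = 2 * II (-(T / 4)) (T / 4) 0 R (fun p => rho p.2 ^ 2 * (dR (dq h x) p ^ 2 + dR (dq h y) p ^ 2)) + (K1 + K2) * h * (T / 4 - -(T / 4)) * (R - 0) := by
        rw [II_add (by fun_prop) (by fun_prop), II_mul, II_const]
    _ ≤ _ := by linarith


noncomputable def kf (r : ℝ) : ℝ := Real.smoothTransition (2 * (r - 1))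
noncomputable def kk (r : ℝ) : ℝ := kf r * √(kf r * r + (1 - kf r))

theorem kf_zero {r : ℝ} (h : r ≤ 1) : kf r = 0 := Real.smoothTransition.zero_of_nonpos (by linarith)
theorem kf_one {r : ℝ} (h : 3 / 2 ≤ r) : kf r = 1 := Real.smoothTransition.one_of_one_le (by linarith)
theorem kf_nonneg (r : ℝ) : 0 ≤ kf r := Real.smoothTransition.nonneg _
theorem kf_le (r : ℝ) : kf r ≤ 1 := Real.smoothTransition.le_one _
theorem kf_sm : ContDiff ℝ ∞ kf := Real.smoothTransition.contDiff.comp (by fun_prop)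
theorem kf_pos (r : ℝ) : 0 < kf r * r + (1 - kf r) := by
  rcases le_or_gt r 1 with h | h
  · rw [kf_zero h]; norm_num
  · have := kf_nonneg r; nlinarith
theorem kk_sm : ContDiff ℝ ∞ kk := by
  unfold kk
  have := kf_sm
  exact this.mul (ContDiff.sqrt (by fun_prop) fun r => (kf_pos r).ne')
theorem kk_zero {r : ℝ} (h : r ≤ 1) : kk r = 0 := by simp [kk, kf_zero h]
theorem kk_eq {r : ℝ} (h : 3 / 2 ≤ r) : kk r = √r := by simp [kk, kf_one h]
theorem kk_sq {r : ℝ} (h : 0 ≤ r) : kk r ^ 2 ≤ r := by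
  rcases le_or_gt r 1 with h1 | h1
  · rw [kk_zero h1]; simpa using h
  · unfold kk
    rw [mul_pow, Real.sq_sqrt (kf_pos r).le]
    have a := kf_nonneg r; have b := kf_le r
    have : kf r * r + (1 - kf r) ≤ r := by nlinarith
    calc _ ≤ 1 * r := mul_le_mul (pow_le_one₀ a b) this (kf_pos r).le zero_le_one
      _ = r := one_mul r

theorem kk_sm2 : Sm (fun z : ℝ × ℝ => kk z.2) := kk_sm.comp contDiff_snd

theorem kk_has {r : ℝ} (h : 2 ≤ r) : HasDerivAt kk (1 / (2 * √r)) r := by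
  refine (Real.hasDerivAt_sqrt (by linarith)).congr_of_eventuallyEq ?_
  filter_upwards [Ioi_mem_nhds (show 3 / 2 < r by linarith)] with s hs using kk_eq (le_of_lt hs)

theorem kkd : ∃ K, 0 ≤ K ∧ ∀ r, 0 ≤ r → deriv kk r ^ 2 ≤ K * r := by
  have cd : Continuous (deriv kk) := kk_sm.continuous_deriv (by simp)
  obtain ⟨K, hK⟩ := (isCompact_Icc (a := (1:ℝ)) (b := 2)).exists_bound_of_continuousOn cd.continuousOn
  refine ⟨K ^ 2 + 1, by positivity, fun r hr => ?_⟩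
  rcases lt_or_ge r 1 with h1 | h1
  · have : deriv kk r = 0 := by
      have : kk =ᶠ[𝓝 r] fun _ => 0 := by
        filter_upwards [Iio_mem_nhds h1] with s hs using kk_zero (le_of_lt hs)
      rw [this.deriv_eq]; simp
    rw [this]; nlinarith [sq_nonneg K]
  · rcases le_or_gt r 2 with h2 | h2
    · have := hK r ⟨h1, h2⟩
      have := sq_le_sq' (abs_le.1 this).1 (abs_le.1 this).2
      nlinarith [sq_nonneg K]
    · rw [(kk_has h2.le).deriv, div_pow, mul_pow, Real.sq_sqrt hr]
      have : (1:ℝ) ^ 2 / (2 ^ 2 * r) ≤ 1 := by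
        rw [div_le_one (by positivity)]; linarith
      nlinarith [sq_nonneg K]

noncomputable def ath (p s : ℝ × ℝ → ℝ) (z : ℝ × ℝ) : ℝ := -(1 / 2) * ∫ σ in (0:ℝ)..z.2, (p (z.1, σ) ^ 2 + s (z.1, σ) ^ 2) * σ

structure UD (m : ℝ) (p s A : ℝ × ℝ → ℝ) (T M : ℝ) : Prop where
  hp : Sm p
  hs : Sm s
  p0 : ∀ t, p (t, 0) = 0
  s0 : ∀ t, s (t, 0) = 0
  hT : 0 < T
  hM : 1 ≤ M
  hm : 0 ≤ m
  mass : ∀ t ∈ Icc (-T) T, ∀ b, 0 ≤ b → ∫ r in (0:ℝ)..b, (p (t, r) ^ 2 + s (t, r) ^ 2) * r ≤ M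
  e1 : ∀ t ∈ Icc (-T) T, ∀ r, 0 < r → -dT s (t, r) - A (t, r) * p (t, r) + dR (dR p) (t, r) + dR p (t, r) / r
    - ((m + ath p s (t, r)) / r) ^ 2 * p (t, r) + (p (t, r) ^ 2 + s (t, r) ^ 2) * p (t, r) = 0
  e2 : ∀ t ∈ Icc (-T) T, ∀ r, 0 < r → dT p (t, r) - A (t, r) * s (t, r) + dR (dR s) (t, r) + dR s (t, r) / r
    - ((m + ath p s (t, r)) / r) ^ 2 * s (t, r) + (p (t, r) ^ 2 + s (t, r) ^ 2) * s (t, r) = 0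
  hA : ∀ t ∈ Icc (-T) T, ∀ r, 0 < r → HasDerivAt (fun r => A (t, r)) ((m + ath p s (t, r)) * (p (t, r) ^ 2 + s (t, r) ^ 2) / r) r
  Abd : ∃ c, 0 ≤ c ∧ ∀ t ∈ Icc (-T) T, ∀ r, 2 ≤ r → |A (t, r)| ≤ c

theorem ath_hasR {p s : ℝ × ℝ → ℝ} (hp : Sm p) (hs : Sm s) (t r : ℝ) :
    HasDerivAt (fun r => ath p s (t, r)) (-(1 / 2) * ((p (t, r) ^ 2 + s (t, r) ^ 2) * r)) r := by
  have c1 := hp.cont; have c2 := hs.cont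
  have cl : Continuous fun σ => (p (t, σ) ^ 2 + s (t, σ) ^ 2) * σ := by fun_prop
  exact (intervalIntegral.integral_hasDerivAt_right (cl.intervalIntegrable _ _)
    (cl.stronglyMeasurableAtFilter _ _) cl.continuousAt).const_mul _

theorem ath_cont {p s : ℝ × ℝ → ℝ} (hp : Sm p) (hs : Sm s) : Continuous (ath p s) := by
  have c1 := hp.cont; have c2 := hs.cont
  unfold ath
  refine continuous_const.mul ?_
  exact intervalIntegral.continuous_parametric_intervalIntegral_of_continuous
    (f := fun (z : ℝ × ℝ) σ => (p (z.1, σ) ^ 2 + s (z.1, σ) ^ 2) * σ) (by fun_prop) continuous_snd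

theorem UD.ath_bd {m T M : ℝ} {p s A : ℝ × ℝ → ℝ} (H : UD m p s A T M) {t : ℝ} (ht : t ∈ Icc (-T) T) {r : ℝ} (hr : 0 ≤ r) :
    |ath p s (t, r)| ≤ M := by
  have h1 := H.mass t ht r hr
  have h2 : 0 ≤ ∫ r in (0:ℝ)..r, (p (t, r) ^ 2 + s (t, r) ^ 2) * r :=
    intervalIntegral.integral_nonneg hr fun σ hσ => mul_nonneg (by positivity) hσ.1
  have h3 := H.hM
  rw [ath, abs_le]
  constructor <;> dsimp only <;> linarith

theorem UD.D_bd {m T M : ℝ} {p s A : ℝ × ℝ → ℝ} (H : UD m p s A T M) {t : ℝ} (ht : t ∈ Icc (-T) T) {r : ℝ} (hr : 0 ≤ r) :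
    (m + ath p s (t, r)) ^ 2 ≤ (m + M) ^ 2 := by
  have h := abs_le.1 (H.ath_bd ht hr)
  have := H.hm
  exact sq_le_sq' (by linarith [h.1]) (by linarith [h.2])

noncomputable def Wf (m : ℝ) (p s A : ℝ × ℝ → ℝ) (z : ℝ × ℝ) : ℝ :=
  1 / (4 * z.2 ^ 2) - A z - ((m + ath p s z) / z.2) ^ 2

theorem UD.W_has {m T M : ℝ} {p s A : ℝ × ℝ → ℝ} (H : UD m p s A T M) {t : ℝ} (ht : t ∈ Icc (-T) T) {r : ℝ} (hr : 0 < r) :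
    HasDerivAt (fun r => Wf m p s A (t, r)) ((2 * (m + ath p s (t, r)) ^ 2 - 1 / 2) / r ^ 3) r := by
  have h1 : HasDerivAt (fun r : ℝ => 1 / (4 * r ^ 2)) (-(4 * (2 * r)) / (4 * r ^ 2) ^ 2) r := by
    have := (((hasDerivAt_pow 2 r).const_mul (4:ℝ)).fun_inv (by positivity))
    simp only [one_div]
    refine this.congr_deriv ?_
    norm_num
  have h2 := ((((ath_hasR H.hp H.hs t r).const_add m).fun_div (hasDerivAt_id' r) hr.ne').fun_pow 2)
  refine ((h1.fun_sub (H.hA t ht r hr)).fun_sub h2).congr_deriv ?_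
  push_cast
  field_simp
  ring

theorem kx_sm {p : ℝ × ℝ → ℝ} (hp : Sm p) : Sm (fun z => kk z.2 * p z) := ContDiff.mul kk_sm2 hp

theorem kx_R {p : ℝ × ℝ → ℝ} (hp : Sm p) (t : ℝ) {r : ℝ} (hr : 3 / 2 < r) :
    dR (fun z => kk z.2 * p z) (t, r) = √r * dR p (t, r) + 1 / (2 * √r) * p (t, r) := by
  refine ((kx_sm hp).hasR t r).unique ?_
  have h := (Real.hasDerivAt_sqrt (by linarith : r ≠ 0)).fun_mul (hp.hasR t r)
  refine (h.congr_deriv (by ring)).congr_of_eventuallyEq ?_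
  filter_upwards [Ioi_mem_nhds hr] with s hs
  rw [kk_eq (le_of_lt hs)]

theorem kx_T {p : ℝ × ℝ → ℝ} (hp : Sm p) (t : ℝ) {r : ℝ} (hr : 3 / 2 < r) :
    dT (fun z => kk z.2 * p z) (t, r) = √r * dT p (t, r) := by
  refine ((kx_sm hp).hasT t r).unique ?_
  have h := (hp.hasT t r).const_mul (√r)
  simpa only [kk_eq hr.le] using h

theorem kx_RR {p : ℝ × ℝ → ℝ} (hp : Sm p) (t : ℝ) {r : ℝ} (hr : 3 / 2 < r) :
    dR (dR (fun z => kk z.2 * p z)) (t, r) = √r * (dR (dR p) (t, r) + dR p (t, r) / r - p (t, r) / (4 * r ^ 2)) := by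
  refine ((kx_sm hp).dR.hasR t r).unique ?_
  have r0 : 0 < r := by linarith
  have q0 := Real.sqrt_pos.2 r0
  have s1 := Real.hasDerivAt_sqrt r0.ne'
  have s2 := (s1.const_mul (2:ℝ)).fun_inv (by positivity)
  have h := (s1.fun_mul (hp.dR.hasR t r)).fun_add (s2.fun_mul (hp.hasR t r))
  refine (h.congr_deriv ?_).congr_of_eventuallyEq ?_
  · have e : √r ^ 2 = r := Real.sq_sqrt r0.le
    generalize dR (dR p) (t, r) = P2
    generalize dR p (t, r) = P1
    generalize p (t, r) = P0
    generalize √r = w at *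
    clear h s2 s1
    subst e
    field_simp
    ring
  · filter_upwards [Ioi_mem_nhds hr] with s hs
    rw [kx_R hp t hs, one_div]

theorem UD.zd {m T M : ℝ} {p s A : ℝ × ℝ → ℝ} (H : UD m p s A T M) :
    ∃ c, ZD (fun z => kk z.2 * p z) (fun z => kk z.2 * s z) (Wf m p s A) T c M := by
  obtain ⟨c, c0, hc⟩ := H.Abd
  have hp := H.hp; have hs := H.hs
  have M0 := H.hM
  have m0 := H.hm
  refine ⟨c + 1 + 2 * (m + M) ^ 2, kx_sm hp, kx_sm hs, fun t r h => ?_, fun t r h => ?_, H.hT, by positivity, H.hM, ?_, ?_, ?_, ?_, ?_⟩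
  · simp [kk_zero h]
  · simp [kk_zero h]
  · intro t ht r hr
    have e := H.e1 t ht r (by linarith)
    rw [gA, kx_RR hp t (by linarith), kx_T hs t (by linarith)]
    simp only [kk_eq (by linarith : 3 / 2 ≤ r), mul_pow, Real.sq_sqrt (by linarith : 0 ≤ r), Wf]
    have r0 : r ≠ 0 := by linarith
    have e5 : (r * p (t, r) ^ 2 + r * s (t, r) ^ 2) / r = p (t, r) ^ 2 + s (t, r) ^ 2 := by field_simp
    rw [e5]
    linear_combination √r * e
  · intro t ht r hr
    have e := H.e2 t ht r (by linarith)
    rw [gB, kx_RR hs t (by linarith), kx_T hp t (by linarith)]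
    simp only [kk_eq (by linarith : 3 / 2 ≤ r), mul_pow, Real.sq_sqrt (by linarith : 0 ≤ r), Wf]
    have r0 : r ≠ 0 := by linarith
    have e5 : (r * p (t, r) ^ 2 + r * s (t, r) ^ 2) / r = p (t, r) ^ 2 + s (t, r) ^ 2 := by field_simp
    rw [e5]
    linear_combination √r * e
  · intro t ht r hr
    have a1 := abs_le.1 (hc t ht r hr)
    have a2 := H.D_bd ht (by linarith : 0 ≤ r)
    have r2 : 1 ≤ r ^ 2 := one_le_pow₀ (by linarith)
    have a3 : 1 / (4 * r ^ 2) ≤ 1 := by rw [div_le_one (by positivity)]; linarith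
    have a4 : 0 ≤ 1 / (4 * r ^ 2) := by positivity
    have a5 : ((m + ath p s (t, r)) / r) ^ 2 ≤ (m + M) ^ 2 := by
      rw [div_pow]
      exact (div_le_self (sq_nonneg _) r2).trans a2
    have a6 := sq_nonneg ((m + ath p s (t, r)) / r)
    rw [Wf, abs_le]
    constructor <;> dsimp only <;> linarith [a1.1, a1.2]
  · intro t ht r s' hr hs'
    have key := Convex.norm_image_sub_le_of_norm_hasDerivWithin_le (s := Ici (2:ℝ)) (x := s') (y := r)
      (f := fun r => Wf m p s A (t, r)) (C := c + 1 + 2 * (m + M) ^ 2)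
      (fun r hr => (H.W_has ht (lt_of_lt_of_le two_pos hr)).hasDerivWithinAt) (fun r hr => ?_) (convex_Ici 2) hs' hr
    · exact key
    · have hr : 2 ≤ r := hr
      have r3 : 1 ≤ r ^ 3 := one_le_pow₀ (by linarith)
      have a2 := H.D_bd ht (by linarith : 0 ≤ r)
      rw [Real.norm_eq_abs, abs_div, abs_of_pos (by linarith : 0 < r ^ 3)]
      refine (div_le_self (abs_nonneg _) r3).trans ?_
      have := sq_nonneg (m + ath p s (t, r))
      rw [abs_le]; constructor <;> linarith
  · intro t ht b hb
    have c1 := hp.cont; have c2 := hs.cont; have c3 := kk_sm.continuous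
    refine le_trans (int_mono0 (by fun_prop) (by fun_prop) hb fun r hr => ?_) (H.mass t ht b hb)
    have := mul_le_mul_of_nonneg_right (kk_sq hr.1) (by positivity : 0 ≤ p (t, r) ^ 2 + s (t, r) ^ 2)
    simp only [mul_pow]
    linarith


theorem iff_bdd {g : ℝ → ℝ} (cg : Continuous g) (g0 : ∀ r, 0 ≤ r → 0 ≤ g r) :
    IntegrableOn g (Ioi 0) ↔ ∃ C, ∀ B, 0 ≤ B → ∫ r in (0:ℝ)..B, g r ≤ C := by
  constructor
  · intro h
    refine ⟨∫ r in Ioi 0, g r, fun B hB => ?_⟩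
    rw [intervalIntegral.integral_of_le hB]
    refine setIntegral_mono_set h ?_ (Ioc_subset_Ioi_self.eventuallyLE)
    exact (ae_restrict_iff' measurableSet_Ioi).2 (Eventually.of_forall fun r hr => g0 r (le_of_lt hr))
  · rintro ⟨C, hC⟩
    refine integrableOn_Ioi_of_intervalIntegral_norm_bounded C 0 (b := fun x : ℝ => x) (l := atTop)
      (fun B => cg.integrableOn_Ioc) tendsto_id ?_
    filter_upwards [eventually_ge_atTop 0] with B hB
    refine le_trans (le_of_eq ?_) (hC B hB)
    refine intervalIntegral.integral_congr fun r hr => ?_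
    rw [uIcc_of_le hB] at hr
    exact abs_of_nonneg (g0 r hr.1)

structure OV (P S P1 S1 : ℝ → ℝ) (M : ℝ) : Prop where
  hP : ∀ r, HasDerivAt P (P1 r) r
  hS : ∀ r, HasDerivAt S (S1 r) r
  cP : Continuous P1
  cS : Continuous S1
  hM : 1 ≤ M
  mass : ∀ b, 0 ≤ b → ∫ r in (0:ℝ)..b, (P r ^ 2 + S r ^ 2) * r ≤ M

theorem OV.c1 {P S P1 S1 : ℝ → ℝ} {M : ℝ} (H : OV P S P1 S1 M) : Continuous P :=
  continuous_iff_continuousAt.2 fun r => (H.hP r).continuousAt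
theorem OV.c2 {P S P1 S1 : ℝ → ℝ} {M : ℝ} (H : OV P S P1 S1 M) : Continuous S :=
  continuous_iff_continuousAt.2 fun r => (H.hS r).continuousAt

theorem OV.rq {P S P1 S1 : ℝ → ℝ} {M : ℝ} (H : OV P S P1 S1 M) {B l : ℝ} (hB : 1 ≤ B) (hl : 0 < l) {r : ℝ} (hr : r ∈ Icc 0 B) :
    r * (P r ^ 2 + S r ^ 2) ≤ (∫ σ in (0:ℝ)..1, (P σ ^ 2 + S σ ^ 2)) + M + l⁻¹ * M + l * ∫ σ in (0:ℝ)..B, (P1 σ ^ 2 + S1 σ ^ 2) * σ := by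
  have c1 := H.c1; have c2 := H.c2; have c3 := H.cP; have c4 := H.cS
  have B0 : 0 ≤ B := by linarith
  have ftc : ∫ σ in (0:ℝ)..r, ((P σ ^ 2 + S σ ^ 2) + 2 * σ * (P σ * P1 σ + S σ * S1 σ)) = r * (P r ^ 2 + S r ^ 2) := by
    rw [intervalIntegral.integral_eq_sub_of_hasDerivAt (f := fun σ => σ * (P σ ^ 2 + S σ ^ 2))]
    · simp
    · intro σ _
      refine ((hasDerivAt_id' σ).fun_mul (((H.hP σ).fun_pow 2).fun_add ((H.hS σ).fun_pow 2))).congr_deriv ?_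
      push_cast; ring
    · exact Continuous.intervalIntegrable (by fun_prop) _ _
  have l0 : 0 < l⁻¹ := inv_pos.2 hl
  have ll : l * l⁻¹ = 1 := mul_inv_cancel₀ hl.ne'
  have up : ∫ σ in (0:ℝ)..r, ((P σ ^ 2 + S σ ^ 2) + 2 * σ * (P σ * P1 σ + S σ * S1 σ)) ≤
      ∫ σ in (0:ℝ)..r, ((P σ ^ 2 + S σ ^ 2) + (l⁻¹ * ((P σ ^ 2 + S σ ^ 2) * σ) + l * ((P1 σ ^ 2 + S1 σ ^ 2) * σ))) := by
    refine int_mono0 (by fun_prop) (by fun_prop) hr.1 fun σ hσ => ?_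
    have k : ∀ a b : ℝ, 2 * (a * b) ≤ l⁻¹ * a ^ 2 + l * b ^ 2 := by
      intro a b
      have := mul_nonneg l0.le (sq_nonneg (a - l * b))
      have e : l⁻¹ * (a - l * b) ^ 2 = l⁻¹ * a ^ 2 - (l * l⁻¹) * (2 * (a * b)) + (l * l⁻¹) * (l * b ^ 2) := by ring
      rw [e, ll] at this
      linarith
    have := mul_le_mul_of_nonneg_right (add_le_add (k (P σ) (P1 σ)) (k (S σ) (S1 σ))) hσ.1
    linarith
  have ext : ∫ σ in (0:ℝ)..r, ((P σ ^ 2 + S σ ^ 2) + (l⁻¹ * ((P σ ^ 2 + S σ ^ 2) * σ) + l * ((P1 σ ^ 2 + S1 σ ^ 2) * σ))) ≤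
      ∫ σ in (0:ℝ)..B, ((P σ ^ 2 + S σ ^ 2) + (l⁻¹ * ((P σ ^ 2 + S σ ^ 2) * σ) + l * ((P1 σ ^ 2 + S1 σ ^ 2) * σ))) :=
    int_subset (by fun_prop) le_rfl hr.1 hr.2 fun σ hσ => by have := hσ.1; positivity
  rw [ftc] at up
  refine up.trans (ext.trans ?_)
  have sp1 : ∫ σ in (0:ℝ)..B, ((P σ ^ 2 + S σ ^ 2) + (l⁻¹ * ((P σ ^ 2 + S σ ^ 2) * σ) + l * ((P1 σ ^ 2 + S1 σ ^ 2) * σ))) =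
      (∫ σ in (0:ℝ)..B, (P σ ^ 2 + S σ ^ 2)) + ∫ σ in (0:ℝ)..B, (l⁻¹ * ((P σ ^ 2 + S σ ^ 2) * σ) + l * ((P1 σ ^ 2 + S1 σ ^ 2) * σ)) :=
    intervalIntegral.integral_add (f := fun σ => P σ ^ 2 + S σ ^ 2) (Continuous.intervalIntegrable (by fun_prop) _ _) (Continuous.intervalIntegrable (by fun_prop) _ _)
  have sp2 : ∫ σ in (0:ℝ)..B, (l⁻¹ * ((P σ ^ 2 + S σ ^ 2) * σ) + l * ((P1 σ ^ 2 + S1 σ ^ 2) * σ)) =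
      l⁻¹ * (∫ σ in (0:ℝ)..B, (P σ ^ 2 + S σ ^ 2) * σ) + l * ∫ σ in (0:ℝ)..B, (P1 σ ^ 2 + S1 σ ^ 2) * σ := by
    rw [← intervalIntegral.integral_const_mul, ← intervalIntegral.integral_const_mul]
    exact intervalIntegral.integral_add (Continuous.intervalIntegrable (by fun_prop) _ _) (Continuous.intervalIntegrable (by fun_prop) _ _)
  rw [sp1, sp2, ← intervalIntegral.integral_add_adjacent_intervals (b := 1) (f := fun σ => P σ ^ 2 + S σ ^ 2) (Continuous.intervalIntegrable (by fun_prop) _ _) (Continuous.intervalIntegrable (by fun_prop) _ _)]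
  have a1 : ∫ σ in (1:ℝ)..B, (P σ ^ 2 + S σ ^ 2) ≤ M := by
    calc _ ≤ ∫ σ in (1:ℝ)..B, (P σ ^ 2 + S σ ^ 2) * σ := by
          refine int_mono0 (by fun_prop) (by fun_prop) hB fun σ hσ => ?_
          exact le_mul_of_one_le_right (by positivity) hσ.1
      _ ≤ ∫ σ in (0:ℝ)..B, (P σ ^ 2 + S σ ^ 2) * σ :=
          int_subset (by fun_prop) zero_le_one hB le_rfl fun σ hσ => by have := hσ.1; positivity
      _ ≤ M := H.mass B B0
  have a2 := mul_le_mul_of_nonneg_left (H.mass B B0) l0.le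
  linarith

theorem OV.g3 {P S P1 S1 : ℝ → ℝ} {M : ℝ} (H : OV P S P1 S1 M) : ∃ K, ∀ B l : ℝ, 1 ≤ B → 0 < l →
    ∫ r in (0:ℝ)..B, (P r ^ 2 + S r ^ 2) ^ 2 * r ≤ K + M * (K + l⁻¹ * M + l * ∫ σ in (0:ℝ)..B, (P1 σ ^ 2 + S1 σ ^ 2) * σ) := by
  have c1 := H.c1; have c2 := H.c2; have c3 := H.cP; have c4 := H.cS
  have M1 := H.hM
  have i1 : 0 ≤ ∫ σ in (0:ℝ)..1, (P σ ^ 2 + S σ ^ 2) := intervalIntegral.integral_nonneg zero_le_one fun _ _ => by positivity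
  have i2 : 0 ≤ ∫ r in (0:ℝ)..1, (P r ^ 2 + S r ^ 2) ^ 2 * r := intervalIntegral.integral_nonneg zero_le_one fun r hr => by have := hr.1; positivity
  refine ⟨(∫ r in (0:ℝ)..1, (P r ^ 2 + S r ^ 2) ^ 2 * r) + ((∫ σ in (0:ℝ)..1, (P σ ^ 2 + S σ ^ 2)) + M), fun B l hB hl => ?_⟩
  have l0 : 0 < l⁻¹ := inv_pos.2 hl
  set X := ∫ σ in (0:ℝ)..B, (P1 σ ^ 2 + S1 σ ^ 2) * σ with hX
  have X0 : 0 ≤ X := intervalIntegral.integral_nonneg (by linarith) fun r hr => by have := hr.1; positivity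
  set Z := (∫ σ in (0:ℝ)..1, (P σ ^ 2 + S σ ^ 2)) + M + l⁻¹ * M + l * X with hZ
  have Z0 : 0 ≤ Z := by positivity
  rw [← intervalIntegral.integral_add_adjacent_intervals (b := 1) (Continuous.intervalIntegrable (by fun_prop) _ _) (Continuous.intervalIntegrable (by fun_prop) _ _)]
  have a1 : ∫ r in (1:ℝ)..B, (P r ^ 2 + S r ^ 2) ^ 2 * r ≤ Z * M := by
    calc _ ≤ ∫ r in (1:ℝ)..B, Z * ((P r ^ 2 + S r ^ 2) * r) := by
          refine int_mono0 (by fun_prop) (by fun_prop) hB fun r hr => ?_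
          have h := H.rq hB hl (r := r) ⟨by linarith [hr.1], hr.2⟩
          have r0 : 0 ≤ r := by linarith [hr.1]
          have q0 : 0 ≤ P r ^ 2 + S r ^ 2 := by positivity
          have : P r ^ 2 + S r ^ 2 ≤ Z := le_trans (le_mul_of_one_le_left q0 hr.1) h
          have := mul_le_mul_of_nonneg_right this (mul_nonneg q0 r0)
          calc _ = (P r ^ 2 + S r ^ 2) * ((P r ^ 2 + S r ^ 2) * r) := by ring
            _ ≤ _ := this
      _ = Z * ∫ r in (1:ℝ)..B, (P r ^ 2 + S r ^ 2) * r := intervalIntegral.integral_const_mul _ _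
      _ ≤ _ := by
          refine mul_le_mul_of_nonneg_left (le_trans ?_ (H.mass B (by linarith))) Z0
          exact int_subset (by fun_prop) zero_le_one hB le_rfl fun σ hσ => by have := hσ.1; positivity
  have a2 : 0 ≤ M * ∫ r in (0:ℝ)..1, (P r ^ 2 + S r ^ 2) ^ 2 * r := by positivity
  rw [hZ] at a1
  linarith

noncomputable def ee (P S P1 S1 a b D : ℝ → ℝ) (r : ℝ) : ℝ :=
  1 / 2 * ((P1 r ^ 2 + S1 r ^ 2) * r) + 1 / 2 * (D r ^ 2 * (a r ^ 2 + b r ^ 2) * r) - 1 / 4 * ((P r ^ 2 + S r ^ 2) ^ 2 * r)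

theorem OV.g2 {P S P1 S1 a b D : ℝ → ℝ} {M D0 : ℝ} (H : OV P S P1 S1 M) (ca : Continuous a) (cb : Continuous b)
    (cD : Continuous D) (ha : ∀ r, r * a r = P r) (hb : ∀ r, r * b r = S r) (hD : ∀ r, 0 ≤ r → D r ^ 2 ≤ D0) :
    IntegrableOn (fun r => D r ^ 2 * (a r ^ 2 + b r ^ 2) * r) (Ioi 0) := by
  have c1 := H.c1; have c2 := H.c2
  have D00 : 0 ≤ D0 := (sq_nonneg _).trans (hD 0 le_rfl)
  rw [iff_bdd (by fun_prop) fun r hr => by positivity]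
  refine ⟨(∫ r in (0:ℝ)..1, D r ^ 2 * (a r ^ 2 + b r ^ 2) * r) + D0 * M, fun B hB => ?_⟩
  have hB1 : 1 ≤ max B 1 := le_max_right _ _
  refine (int_subset (b := max B 1) (by fun_prop) le_rfl hB (le_max_left _ _) fun r hr => by have := hr.1; positivity).trans ?_
  rw [← intervalIntegral.integral_add_adjacent_intervals (b := 1) (Continuous.intervalIntegrable (by fun_prop) _ _) (Continuous.intervalIntegrable (by fun_prop) _ _)]
  gcongr
  calc _ ≤ ∫ r in (1:ℝ)..(max B 1), D0 * ((P r ^ 2 + S r ^ 2) * r) := by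
        refine int_mono0 (by fun_prop) (by fun_prop) hB1 fun r hr => ?_
        have r0 : 0 ≤ r := by linarith [hr.1]
        rw [← ha, ← hb, mul_assoc]
        refine mul_le_mul (hD r r0) ?_ (by positivity) D00
        refine mul_le_mul_of_nonneg_right ?_ r0
        rw [mul_pow, mul_pow, ← mul_add]
        exact le_mul_of_one_le_left (by positivity) (one_le_pow₀ hr.1)
    _ = D0 * ∫ r in (1:ℝ)..(max B 1), (P r ^ 2 + S r ^ 2) * r := intervalIntegral.integral_const_mul _ _
    _ ≤ _ := by
        refine mul_le_mul_of_nonneg_left (le_trans ?_ (H.mass (max B 1) (by linarith))) D00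
        exact int_subset (by fun_prop) zero_le_one hB1 le_rfl fun σ hσ => by have := hσ.1; positivity

theorem OV.eint {P S P1 S1 a b D : ℝ → ℝ} {M D0 : ℝ} (H : OV P S P1 S1 M) (ca : Continuous a) (cb : Continuous b)
    (cD : Continuous D) (ha : ∀ r, r * a r = P r) (hb : ∀ r, r * b r = S r) (hD : ∀ r, 0 ≤ r → D r ^ 2 ≤ D0) :
    IntegrableOn (ee P S P1 S1 a b D) (Ioi 0) ↔ ∃ C, ∀ B, 0 ≤ B → ∫ r in (0:ℝ)..B, (P1 r ^ 2 + S1 r ^ 2) * r ≤ C := by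
  have c1 := H.c1; have c2 := H.c2; have c3 := H.cP; have c4 := H.cS
  have M1 := H.hM
  have g2 := H.g2 ca cb cD ha hb hD
  obtain ⟨K, hK⟩ := H.g3
  have mono1 : ∀ B, 0 ≤ B → ∫ r in (0:ℝ)..B, (P1 r ^ 2 + S1 r ^ 2) * r ≤ ∫ r in (0:ℝ)..(max B 1), (P1 r ^ 2 + S1 r ^ 2) * r := fun B hB =>
    int_subset (by fun_prop) le_rfl hB (le_max_left _ _) fun r hr => by have := hr.1; positivity
  have mono3 : ∀ B, 0 ≤ B → ∫ r in (0:ℝ)..B, (P r ^ 2 + S r ^ 2) ^ 2 * r ≤ ∫ r in (0:ℝ)..(max B 1), (P r ^ 2 + S r ^ 2) ^ 2 * r := fun B hB =>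
    int_subset (by fun_prop) le_rfl hB (le_max_left _ _) fun r hr => by have := hr.1; positivity
  constructor
  · intro h
    obtain ⟨N, hN⟩ : ∃ N, ∀ B, 0 ≤ B → ∫ r in (0:ℝ)..B, ee P S P1 S1 a b D r ≤ N := by
      have ce : Continuous (ee P S P1 S1 a b D) := by unfold ee; fun_prop
      have h' : IntegrableOn (fun r => |ee P S P1 S1 a b D r|) (Ioi 0) := Integrable.abs h
      obtain ⟨N, hN⟩ := (iff_bdd ce.abs fun r _ => abs_nonneg _).1 h'
      exact ⟨N, fun B hB => (int_mono0 ce ce.abs hB fun r _ => le_abs_self _).trans (hN B hB)⟩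
    refine ⟨4 * (N + 1 / 4 * (K + M * (K + M * M))), fun B hB => (mono1 B hB).trans ?_⟩
    have B1 : 1 ≤ max B 1 := le_max_right _ _
    generalize max B 1 = B at *
    have B0 : 0 ≤ B := by linarith
    have k := hK B M⁻¹ B1 (by positivity)
    rw [inv_inv] at k
    have n := hN B B0
    unfold ee at n
    rw [intervalIntegral.integral_sub (Continuous.intervalIntegrable (by fun_prop) _ _) (Continuous.intervalIntegrable (by fun_prop) _ _),
      intervalIntegral.integral_add (Continuous.intervalIntegrable (by fun_prop) _ _) (Continuous.intervalIntegrable (by fun_prop) _ _),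
      intervalIntegral.integral_const_mul, intervalIntegral.integral_const_mul, intervalIntegral.integral_const_mul] at n
    have g20 : 0 ≤ ∫ r in (0:ℝ)..B, D r ^ 2 * (a r ^ 2 + b r ^ 2) * r :=
      intervalIntegral.integral_nonneg B0 fun r hr => by have := hr.1; positivity
    have e : M * (K + M * M + M⁻¹ * ∫ σ in (0:ℝ)..B, (P1 σ ^ 2 + S1 σ ^ 2) * σ) = M * (K + M * M) + ∫ σ in (0:ℝ)..B, (P1 σ ^ 2 + S1 σ ^ 2) * σ := by
      have : M ≠ 0 := by positivity
      field_simp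
    rw [e] at k
    linarith
  · intro h
    have g1 := (iff_bdd (g := fun r => (P1 r ^ 2 + S1 r ^ 2) * r) (by fun_prop) fun r hr => by positivity).2 h
    obtain ⟨C, hC⟩ := h
    have g3 : IntegrableOn (fun r => (P r ^ 2 + S r ^ 2) ^ 2 * r) (Ioi 0) := by
      refine (iff_bdd (by fun_prop) fun r hr => by positivity).2 ⟨K + M * (K + M + C), fun B hB => (mono3 B hB).trans ?_⟩
      have B1 : 1 ≤ max B 1 := le_max_right _ _
      have k := hK _ 1 B1 one_pos
      have := mul_le_mul_of_nonneg_left (hC (max B 1) (by linarith)) (by linarith : 0 ≤ M)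
      rw [inv_one] at k
      linarith
    exact (((g1.const_mul (1 / 2)).add (g2.const_mul (1 / 2))).sub (g3.const_mul (1 / 4)))


theorem dom1 {f g : ℝ → ℝ} (cf : Continuous f) (cg : Continuous g) {K : ℝ} (K0 : 0 ≤ K)
    (g0 : ∀ r, 0 ≤ r → 0 ≤ g r) (h1 : ∀ r ∈ Icc (0:ℝ) 2, f r ≤ K) (h2 : ∀ r, 2 ≤ r → f r ≤ g r) {R : ℝ} (hR : 0 ≤ R) :
    ∫ r in (0:ℝ)..R, f r ≤ 2 * K + ∫ r in (0:ℝ)..R, g r := by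
  have kc : ∀ a, ∫ _ in (0:ℝ)..a, K = a * K := fun a => by
    rw [intervalIntegral.integral_const, smul_eq_mul]; ring
  have ig : 0 ≤ ∫ r in (0:ℝ)..R, g r := intervalIntegral.integral_nonneg hR fun r hr => g0 r hr.1
  rcases le_or_gt R 2 with h | h
  · have : ∫ r in (0:ℝ)..R, f r ≤ ∫ _ in (0:ℝ)..R, K :=
      int_mono0 cf continuous_const hR fun r hr => h1 r ⟨hr.1, hr.2.trans h⟩
    rw [kc] at this
    nlinarith
  · have a1 : ∫ r in (0:ℝ)..2, f r ≤ ∫ _ in (0:ℝ)..2, K :=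
      int_mono0 cf continuous_const two_pos.le fun r hr => h1 r hr
    rw [kc] at a1
    have a2 : ∫ r in (2:ℝ)..R, f r ≤ ∫ r in (2:ℝ)..R, g r := int_mono0 cf cg h.le fun r hr => h2 r hr.1
    have a3 : ∫ r in (2:ℝ)..R, g r ≤ ∫ r in (0:ℝ)..R, g r := int_subset cg two_pos.le h.le le_rfl fun r hr => g0 r hr.1
    rw [← intervalIntegral.integral_add_adjacent_intervals (cf.intervalIntegrable 0 2) (cf.intervalIntegrable 2 R)]
    linarith

theorem dom2 {F G : ℝ × ℝ → ℝ} (cF : Continuous F) (cG : Continuous G) {K α β : ℝ} (K0 : 0 ≤ K) (hab : α ≤ β)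
    (g0 : ∀ t ∈ Icc α β, ∀ r, 0 ≤ r → 0 ≤ G (t, r)) (h1 : ∀ t ∈ Icc α β, ∀ r ∈ Icc (0:ℝ) 2, F (t, r) ≤ K)
    (h2 : ∀ t ∈ Icc α β, ∀ r, 2 ≤ r → F (t, r) ≤ G (t, r)) {R : ℝ} (hR : 0 ≤ R) :
    II α β 0 R F ≤ (β - α) * (2 * K) + II α β 0 R G := by
  have := int_mono0 (f := fun t => ∫ r in (0:ℝ)..R, F (t, r)) (g := fun t => 2 * K + 1 * ∫ r in (0:ℝ)..R, G (t, r))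
    (ci cF 0 R) (continuous_const.add (continuous_const.mul (ci cG 0 R))) hab fun t ht => by
      rw [one_mul]
      exact dom1 (cr cF t) (cr cG t) K0 (g0 t ht) (h1 t ht) (h2 t ht) hR
  rw [int_aff (ci cG 0 R), one_mul] at this
  exact this

theorem II_ub {F : ℝ × ℝ → ℝ} (cF : Continuous F) {α β R C : ℝ} (hab : α ≤ β)
    (h : ∀ t ∈ Icc α β, ∫ r in (0:ℝ)..R, F (t, r) ≤ C) : II α β 0 R F ≤ (β - α) * C := by
  have := int_mono0 (f := fun t => ∫ r in (0:ℝ)..R, F (t, r)) (g := fun _ => C)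
    (ci cF 0 R) continuous_const hab h
  rw [intervalIntegral.integral_const, smul_eq_mul] at this
  exact this

theorem int_add2 {f g : ℝ → ℝ} (cf : Continuous f) (cg : Continuous g) (u v a b : ℝ) :
    ∫ t in a..b, (u * f t + v * g t) = u * (∫ t in a..b, f t) + v * ∫ t in a..b, g t := by
  rw [intervalIntegral.integral_add (Continuous.intervalIntegrable (by fun_prop) _ _) (Continuous.intervalIntegrable (by fun_prop) _ _)]
  simp

theorem kx_R' {p : ℝ × ℝ → ℝ} (hp : Sm p) (t r : ℝ) :
    dR (fun z => kk z.2 * p z) (t, r) = deriv kk r * p (t, r) + kk r * dR p (t, r) := by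
  refine ((kx_sm hp).hasR t r).unique ?_
  exact ((kk_sm.differentiable (by simp) r).hasDerivAt).fun_mul (hp.hasR t r)

theorem UD.E0 {m T M : ℝ} {p s A : ℝ × ℝ → ℝ} (H : UD m p s A T M) {E1 : ℝ}
    (hE : ∀ B, 0 ≤ B → ∫ r in (0:ℝ)..B, (dR p (0, r) ^ 2 + dR s (0, r) ^ 2) * r ≤ E1) :
    ∃ E0, ∀ B, 0 ≤ B → ∫ r in (0:ℝ)..B, (dR (fun z => kk z.2 * p z) (0, r) ^ 2 + dR (fun z => kk z.2 * s z) (0, r) ^ 2) ≤ E0 := by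
  obtain ⟨K, K0, hK⟩ := kkd
  have hp := H.hp; have hs := H.hs; have hT := H.hT
  have c1 := hp.cont; have c2 := hs.cont; have c3 := hp.dR.cont; have c4 := hs.dR.cont
  have c5 := (kx_sm hp).dR.cont; have c6 := (kx_sm hs).dR.cont
  refine ⟨2 * K * M + 2 * E1, fun B hB => ?_⟩
  have a1 := H.mass 0 ⟨by linarith, hT.le⟩ B hB
  have a2 := hE B hB
  have := int_mono0 (f := fun r => dR (fun z => kk z.2 * p z) (0, r) ^ 2 + dR (fun z => kk z.2 * s z) (0, r) ^ 2)
    (g := fun r => 2 * K * ((p (0, r) ^ 2 + s (0, r) ^ 2) * r) + 2 * ((dR p (0, r) ^ 2 + dR s (0, r) ^ 2) * r))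
    (by fun_prop) (by fun_prop) hB fun r hr => by
      have k1 := hK r hr.1
      have k2 := kk_sq hr.1
      simp only [kx_R' hp, kx_R' hs]
      generalize deriv kk r = d at *
      generalize kk r = k at *
      have g : ∀ a b : ℝ, (d * a + k * b) ^ 2 ≤ 2 * (K * r * a ^ 2) + 2 * (r * b ^ 2) := fun a b => by
        have e1 := mul_le_mul_of_nonneg_right k1 (sq_nonneg a)
        have e2 := mul_le_mul_of_nonneg_right k2 (sq_nonneg b)
        nlinarith [sq_nonneg (d * a - k * b)]
      have := g (p (0, r)) (dR p (0, r))
      have := g (s (0, r)) (dR s (0, r))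
      linarith
  rw [int_add2 (by fun_prop) (by fun_prop)] at this
  have := mul_le_mul_of_nonneg_left a1 (by linarith : 0 ≤ 2 * K)
  linarith

theorem alg1 {w P0 P1 X r : ℝ} (hw : 0 < w) (e : w ^ 2 = r) (hr : 2 ≤ r) (hX : X = w * P1 + 1 / (2 * w) * P0) :
    P1 ^ 2 * r ≤ 2 * X ^ 2 + P0 ^ 2 * r := by
  have h : w * P1 = X - 1 / (2 * w) * P0 := by rw [hX]; ring
  have h2 : P1 ^ 2 * r = (X - 1 / (2 * w) * P0) ^ 2 := by rw [← h, ← e]; ring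
  have h3 : (1 / (2 * w)) ^ 2 ≤ 1 := by
    rw [div_pow, one_pow, div_le_one (by positivity), mul_pow, e]; linarith
  have h4 := mul_le_mul_of_nonneg_right h3 (sq_nonneg P0)
  rw [h2]
  nlinarith [sq_nonneg (X + 1 / (2 * w) * P0), sq_nonneg P0]

theorem alg2 {w P0 P1 P2 X r : ℝ} (hw : 0 < w) (e : w ^ 2 = r) (hr : 2 ≤ r) (hX : X = w * (P2 + P1 / r - P0 / (4 * r ^ 2))) :
    P2 ^ 2 * r ≤ 3 * X ^ 2 + 3 * (P1 ^ 2 * r) + 3 * (P0 ^ 2 * r) := by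
  have r0 : 0 < r := by linarith
  have h2 : P2 ^ 2 * r = (X - w * (P1 / r) + w * (P0 / (4 * r ^ 2))) ^ 2 := by rw [hX, ← e]; ring
  have a1 : (w * (P1 / r)) ^ 2 ≤ P1 ^ 2 * r := by
    rw [mul_pow, e, div_pow, mul_comm]
    refine mul_le_mul_of_nonneg_right (div_le_self (sq_nonneg _) (one_le_pow₀ (by linarith))) r0.le
  have a2 : (w * (P0 / (4 * r ^ 2))) ^ 2 ≤ P0 ^ 2 * r := by
    rw [mul_pow, e, div_pow, mul_comm]
    refine mul_le_mul_of_nonneg_right (div_le_self (sq_nonneg _) (one_le_pow₀ (by nlinarith))) r0.le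
  rw [h2]
  generalize w * (P1 / r) = u at *
  generalize w * (P0 / (4 * r ^ 2)) = v at *
  nlinarith [sq_nonneg (X + u), sq_nonneg (X - v), sq_nonneg (u + v)]

theorem UD.H1 {m T M : ℝ} {p s A : ℝ × ℝ → ℝ} (H : UD m p s A T M) {E1 : ℝ}
    (hE : ∀ B, 0 ≤ B → ∫ r in (0:ℝ)..B, (dR p (0, r) ^ 2 + dR s (0, r) ^ 2) * r ≤ E1) :
    ∃ C, 0 ≤ C ∧ ∀ t ∈ Icc (-(T / 2)) (T / 2), ∀ R, 0 ≤ R → ∫ r in (0:ℝ)..R, (dR p (t, r) ^ 2 + dR s (t, r) ^ 2) * r ≤ C := by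
  obtain ⟨E0, hE0⟩ := H.E0 hE
  obtain ⟨c, hz⟩ := H.zd
  obtain ⟨C, C0, hC⟩ := hz.H1r hE0
  have hp := H.hp; have hs := H.hs; have hT := H.hT; have hM := H.hM
  have c1 := hp.cont; have c2 := hs.cont; have c3 := hp.dR.cont; have c4 := hs.dR.cont
  have c5 := (kx_sm hp).dR.cont; have c6 := (kx_sm hs).dR.cont
  obtain ⟨K, K0, hK⟩ := bdd (F := fun z => (dR p z ^ 2 + dR s z ^ 2) * z.2) (by fun_prop) (-(T / 2)) (T / 2) 0 2
  refine ⟨2 * K + (2 * C + M), by positivity, fun t ht R hR => ?_⟩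
  have := dom1 (f := fun r => (dR p (t, r) ^ 2 + dR s (t, r) ^ 2) * r)
    (g := fun r => 2 * (dR (fun z => kk z.2 * p z) (t, r) ^ 2 + dR (fun z => kk z.2 * s z) (t, r) ^ 2) + 1 * ((p (t, r) ^ 2 + s (t, r) ^ 2) * r))
    (by fun_prop) (by fun_prop) K0 (fun r hr => by positivity) (fun r hr => (le_abs_self _).trans (hK t ht r hr))
    (fun r hr => by
      have q0 := Real.sqrt_pos.2 (by linarith : 0 < r)
      have e := Real.sq_sqrt (by linarith : 0 ≤ r)
      have a := alg1 q0 e hr (kx_R hp t (by linarith : 3 / 2 < r))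
      have b := alg1 q0 e hr (kx_R hs t (by linarith : 3 / 2 < r))
      linarith) hR
  rw [int_add2 (by fun_prop) (by fun_prop)] at this
  have := hC t ht R hR
  have := H.mass t ⟨by linarith [ht.1], by linarith [ht.2]⟩ R hR
  linarith

theorem UD.H2 {m T M : ℝ} {p s A : ℝ × ℝ → ℝ} (H : UD m p s A T M) {E1 : ℝ}
    (hE : ∀ B, 0 ≤ B → ∫ r in (0:ℝ)..B, (dR p (0, r) ^ 2 + dR s (0, r) ^ 2) * r ≤ E1) :
    ∃ C, 0 ≤ C ∧ ∀ R, 1 ≤ R → II (-(T / 4)) (T / 4) 0 R (fun z => rho z.2 ^ 2 * ((dR (dR p) z ^ 2 + dR (dR s) z ^ 2) * z.2)) ≤ C := by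
  obtain ⟨E0, hE0⟩ := H.E0 hE
  obtain ⟨c, hz⟩ := H.zd
  obtain ⟨C, C0, hC⟩ := hz.H2r hE0
  obtain ⟨C1, C10, hC1⟩ := H.H1 hE
  have hp := H.hp; have hs := H.hs; have hT := H.hT; have hM := H.hM
  have c1 := hp.cont; have c2 := hs.cont; have c3 := hp.dR.cont; have c4 := hs.dR.cont
  have c5 := (kx_sm hp).dR.dR.cont; have c6 := (kx_sm hs).dR.dR.cont
  have c7 := hp.dR.dR.cont; have c8 := hs.dR.dR.cont
  have crr := rho_cont
  obtain ⟨K, K0, hK⟩ := bdd (F := fun z => rho z.2 ^ 2 * ((dR (dR p) z ^ 2 + dR (dR s) z ^ 2) * z.2)) (by fun_prop) (-(T / 4)) (T / 4) 0 2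
  refine ⟨(T / 4 - -(T / 4)) * (2 * K) + (3 * C + (T / 4 - -(T / 4)) * (3 * C1 + 3 * M)), by
    have : T / 4 - -(T / 4) = T / 2 := by ring
    rw [this]; positivity, fun R hR => ?_⟩
  have R0 : 0 ≤ R := by linarith
  set G1 : ℝ × ℝ → ℝ := fun z => 3 * (rho z.2 ^ 2 * (dR (dR (fun z => kk z.2 * p z)) z ^ 2 + dR (dR (fun z => kk z.2 * s z)) z ^ 2)) with hG1
  set G2 : ℝ × ℝ → ℝ := fun z => 3 * ((dR p z ^ 2 + dR s z ^ 2) * z.2) + 3 * ((p z ^ 2 + s z ^ 2) * z.2) with hG2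
  have cG1 : Continuous G1 := by rw [hG1]; fun_prop
  have cG2 : Continuous G2 := by rw [hG2]; fun_prop
  have := dom2 (F := fun z => rho z.2 ^ 2 * ((dR (dR p) z ^ 2 + dR (dR s) z ^ 2) * z.2)) (G := fun z => G1 z + G2 z)
    (by fun_prop) (by fun_prop) K0 (by linarith : -(T / 4) ≤ T / 4) (fun t ht r hr => by simp only [hG1, hG2]; positivity) (fun t ht r hr => (le_abs_self _).trans (hK t ht r hr))
    (fun t ht r hr => by
      have q0 := Real.sqrt_pos.2 (by linarith : 0 < r)
      have e := Real.sq_sqrt (by linarith : 0 ≤ r)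
      have a := alg2 q0 e hr (kx_RR hp t (by linarith : 3 / 2 < r))
      have b := alg2 q0 e hr (kx_RR hs t (by linarith : 3 / 2 < r))
      have ab := mul_le_mul_of_nonneg_left (add_le_add a b) (sq_nonneg (rho r))
      have l1 : rho r ^ 2 ≤ 1 := pow_le_one₀ (rho_pos r).le (rho_le (by linarith))
      have r0 : 0 ≤ r := by linarith
      have l2 := mul_le_mul_of_nonneg_right l1 (by positivity : 0 ≤ 3 * ((dR p (t, r) ^ 2 + dR s (t, r) ^ 2) * r) + 3 * ((p (t, r) ^ 2 + s (t, r) ^ 2) * r))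
      simp only [hG1, hG2]
      linarith) R0
  rw [II_add cG1 cG2] at this
  have i1 : II (-(T / 4)) (T / 4) 0 R G1 ≤ 3 * C := by
    rw [hG1, II_mul]
    exact mul_le_mul_of_nonneg_left (hC R hR) (by norm_num)
  have i2 : II (-(T / 4)) (T / 4) 0 R G2 ≤ (T / 4 - -(T / 4)) * (3 * C1 + 3 * M) := by
    refine II_ub cG2 (by linarith) fun t ht => ?_
    simp only [hG2]
    rw [int_add2 (by fun_prop) (by fun_prop)]
    have := hC1 t ⟨by linarith [ht.1], by linarith [ht.2]⟩ R R0
    have := H.mass t ⟨by linarith [ht.1], by linarith [ht.2]⟩ R R0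
    linarith
  linarith

theorem alg3 {w p s p1 s1 x1 y1 r k : ℝ} (hw : 0 < w) (e : w ^ 2 = r) (hk : 0 ≤ k) (hx : x1 = w * p1 + 1 / (2 * w) * p)
    (hy : y1 = w * s1 + 1 / (2 * w) * s) : k * |r * (p * s1 - s * p1)| ≤ (p ^ 2 + s ^ 2) * r + k ^ 2 * (x1 ^ 2 + y1 ^ 2) := by
  have : r * (p * s1 - s * p1) = (w * p) * y1 - (w * s) * x1 := by rw [hx, hy, ← e]; ring
  rw [this]
  have : (p ^ 2 + s ^ 2) * r = (w * p) ^ 2 + (w * s) ^ 2 := by rw [← e]; ring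
  rw [this]
  generalize w * p = a
  generalize w * s = b
  rw [← abs_of_nonneg hk, ← abs_mul, abs_of_nonneg hk, abs_le]
  constructor <;> nlinarith [sq_nonneg (a + k * y1), sq_nonneg (b - k * x1), sq_nonneg (a - k * y1), sq_nonneg (b + k * x1), sq_nonneg a, sq_nonneg b, sq_nonneg (k * x1), sq_nonneg (k * y1)]

theorem UD.J {m T M : ℝ} {p s A : ℝ × ℝ → ℝ} (H : UD m p s A T M) :
    ∃ C, 0 ≤ C ∧ ∀ R, 1 ≤ R → II (-(T / 2)) (T / 2) 0 R (fun z => rho z.2 * |z.2 * (p z * dR s z - s z * dR p z)|) ≤ C := by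
  obtain ⟨c, hz⟩ := H.zd
  obtain ⟨C, C0, hC⟩ := zd_mor' hz
  have hp := H.hp; have hs := H.hs; have hT := H.hT; have hM := H.hM
  have c1 := hp.cont; have c2 := hs.cont; have c3 := hp.dR.cont; have c4 := hs.dR.cont
  have c5 := (kx_sm hp).dR.cont; have c6 := (kx_sm hs).dR.cont
  have crr := rho_cont
  obtain ⟨K, K0, hK⟩ := bdd (F := fun z => rho z.2 * |z.2 * (p z * dR s z - s z * dR p z)|) (by fun_prop) (-(T / 2)) (T / 2) 0 2
  refine ⟨(T / 2 - -(T / 2)) * (2 * K) + ((T / 2 - -(T / 2)) * M + C), by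
    have : T / 2 - -(T / 2) = T := by ring
    rw [this]; positivity, fun R hR => ?_⟩
  have R0 : 0 ≤ R := by linarith
  set G1 : ℝ × ℝ → ℝ := fun z => rho z.2 ^ 2 * (dR (fun z => kk z.2 * p z) z ^ 2 + dR (fun z => kk z.2 * s z) z ^ 2) with hG1
  set G2 : ℝ × ℝ → ℝ := fun z => (p z ^ 2 + s z ^ 2) * z.2 with hG2
  have cG1 : Continuous G1 := by rw [hG1]; fun_prop
  have cG2 : Continuous G2 := by rw [hG2]; fun_prop
  have := dom2 (F := fun z => rho z.2 * |z.2 * (p z * dR s z - s z * dR p z)|) (G := fun z => G2 z + G1 z)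
    (by fun_prop) (by fun_prop) K0 (by linarith : -(T / 2) ≤ T / 2) (fun t ht r hr => by simp only [hG1, hG2]; positivity) (fun t ht r hr => (le_abs_self _).trans (hK t ht r hr))
    (fun t ht r hr => by
      have q0 := Real.sqrt_pos.2 (by linarith : 0 < r)
      have e := Real.sq_sqrt (by linarith : 0 ≤ r)
      exact alg3 q0 e (rho_pos r).le (kx_R hp t (by linarith : 3 / 2 < r)) (kx_R hs t (by linarith : 3 / 2 < r))) R0
  rw [II_add cG2 cG1] at this
  have i1 := hC R hR
  have i2 : II (-(T / 2)) (T / 2) 0 R G2 ≤ (T / 2 - -(T / 2)) * M :=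
    II_ub cG2 (by linarith) fun t ht => H.mass t ⟨by linarith [ht.1], by linarith [ht.2]⟩ R R0
  linarith

theorem UD.ov {m T M : ℝ} {p s A : ℝ × ℝ → ℝ} (H : UD m p s A T M) {t : ℝ} (ht : t ∈ Icc (-T) T) :
    OV (fun r => p (t, r)) (fun r => s (t, r)) (fun r => dR p (t, r)) (fun r => dR s (t, r)) M := by
  have c3 := H.hp.dR.cont; have c4 := H.hs.dR.cont
  exact ⟨fun r => H.hp.hasR t r, fun r => H.hs.hasR t r, by fun_prop, by fun_prop, H.hM, H.mass t ht⟩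

theorem UD.qbd {m T M : ℝ} {p s A : ℝ × ℝ → ℝ} (H : UD m p s A T M) {C : ℝ}
    (hC : ∀ t ∈ Icc (-(T / 2)) (T / 2), ∀ R, 0 ≤ R → ∫ r in (0:ℝ)..R, (dR p (t, r) ^ 2 + dR s (t, r) ^ 2) * r ≤ C) :
    ∃ q, 0 ≤ q ∧ ∀ t ∈ Icc (-(T / 2)) (T / 2), ∀ r, 2 ≤ r → p (t, r) ^ 2 + s (t, r) ^ 2 ≤ q := by
  have hT := H.hT
  have c1 := H.hp.cont; have c2 := H.hs.cont
  obtain ⟨K, K0, hK⟩ := bdd (F := fun z => p z ^ 2 + s z ^ 2) (by fun_prop) (-(T / 2)) (T / 2) 0 1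
  have C0 : 0 ≤ C := by
    have := hC 0 ⟨by linarith, by linarith⟩ 0 le_rfl
    simpa using this
  have hM := H.hM
  refine ⟨K + M + M + C, by positivity, fun t ht r hr => ?_⟩
  have h := (H.ov (t := t) ⟨by linarith [ht.1], by linarith [ht.2]⟩).rq (B := r) (l := 1) (by linarith) one_pos ⟨by linarith, le_rfl⟩
  have h2 := hC t ht r (by linarith)
  have h3 : ∫ σ in (0:ℝ)..1, (p (t, σ) ^ 2 + s (t, σ) ^ 2) ≤ ∫ _ in (0:ℝ)..1, K :=
    int_mono0 (by fun_prop) continuous_const zero_le_one fun σ hσ => (le_abs_self _).trans (hK t ht σ hσ)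
  rw [intervalIntegral.integral_const, smul_eq_mul] at h3
  have h4 : p (t, r) ^ 2 + s (t, r) ^ 2 ≤ r * (p (t, r) ^ 2 + s (t, r) ^ 2) := le_mul_of_one_le_left (by positivity) (by linarith)
  rw [inv_one] at h
  linarith


theorem chi_lim {d : ℝ → ℝ} (hd : IntegrableOn d (Ioi 0)) :
    Tendsto (fun b : ℝ => ∫ r in (0:ℝ)..b, chi b r * d r) atTop (𝓝 (∫ r in Ioi 0, d r)) := by
  have key : Tendsto (fun b : ℝ => ∫ r in Ioi 0, (Ioc 0 b).indicator (fun r => chi b r * d r) r) atTop (𝓝 (∫ r in Ioi 0, d r)) := by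
    refine tendsto_integral_filter_of_dominated_convergence (fun r => ‖d r‖) ?_ ?_ hd.norm ?_
    · refine Eventually.of_forall fun b => ?_
      exact ((chi_cont b).aestronglyMeasurable.mul hd.aestronglyMeasurable).indicator measurableSet_Ioc
    · filter_upwards [eventually_gt_atTop 0] with b hb
      refine Eventually.of_forall fun r => ?_
      by_cases h : r ∈ Ioc 0 b
      · rw [indicator_of_mem h, norm_mul]
        refine mul_le_of_le_one_left (norm_nonneg _) ?_
        rw [Real.norm_eq_abs, abs_of_nonneg (chi_nonneg hb h.1.le h.2)]
        exact chi_le hb h.1.le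
      · rw [indicator_of_notMem h]; simp
    · refine (ae_restrict_iff' measurableSet_Ioi).2 (Eventually.of_forall fun r hr => ?_)
      have hr : 0 < r := hr
      have l1 : Tendsto (fun b : ℝ => Real.log (1 + b)) atTop atTop :=
        Real.tendsto_log_atTop.comp (tendsto_atTop_add_const_left _ _ tendsto_id)
      have l2 : Tendsto (fun b : ℝ => (1 - Real.log (1 + r) / Real.log (1 + b)) * d r) atTop (𝓝 ((1 - 0) * d r)) :=
        (tendsto_const_nhds.sub (l1.const_div_atTop _)).mul_const _
      rw [sub_zero, one_mul] at l2
      refine l2.congr' ?_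
      filter_upwards [eventually_ge_atTop r] with b hb
      rw [indicator_of_mem (show r ∈ Ioc 0 b from ⟨hr, hb⟩), chi_eq hr.le]
  refine key.congr' ?_
  filter_upwards [eventually_ge_atTop 0] with b hb
  rw [setIntegral_indicator measurableSet_Ioc, intervalIntegral.integral_of_le hb,
    inter_eq_right.2 Ioc_subset_Ioi_self]

theorem cons {e et f : ℝ × ℝ → ℝ} {S C : ℝ} (hS : 0 < S) (ce : Continuous e) (cet : Continuous et) (cf : Continuous f)
    (he : ∀ t ∈ Icc (-S) S, ∀ r, 0 ≤ r → HasDerivAt (fun t => e (t, r)) (et (t, r)) t)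
    (hf : ∀ t ∈ Icc (-S) S, ∀ r, 0 < r → HasDerivAt (fun r => f (t, r)) (et (t, r)) r)
    (f0 : ∀ t, f (t, 0) = 0)
    (hC : ∀ b, 1 ≤ b → II (-S) S 0 b (fun z => rho z.2 * |f z|) ≤ C) {t : ℝ} (ht : t ∈ Icc (-S) S)
    (i0 : IntegrableOn (fun r => e (0, r)) (Ioi 0)) (it : IntegrableOn (fun r => e (t, r)) (Ioi 0)) :
    ∫ r in Ioi 0, e (t, r) = ∫ r in Ioi 0, e (0, r) := by
  have lim := chi_lim (d := fun r => e (t, r) - e (0, r)) (it.sub i0)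
  have crr := rho_cont
  have bd : ∀ b : ℝ, 1 ≤ b → ‖∫ r in (0:ℝ)..b, chi b r * (e (t, r) - e (0, r))‖ ≤ C / Real.log (1 + b) := by
    intro b hb
    have b0 : 0 < b := by linarith
    have L := logb_pos b0
    have cc := chi_cont b
    have st1 : ∫ r in (0:ℝ)..b, chi b r * (e (t, r) - e (0, r)) = II 0 t 0 b (fun z => chi b z.2 * et z) := by
      rw [II_swap (by fun_prop)]
      refine intervalIntegral.integral_congr fun r hr => ?_
      rw [uIcc_of_le b0.le] at hr
      dsimp only
      rw [intervalIntegral.integral_const_mul]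
      congr 1
      rw [intervalIntegral.integral_eq_sub_of_hasDerivAt (f := fun t => e (t, r))]
      · intro τ hτ
        refine he τ ?_ r hr.1
        exact uIcc_subset_Icc ⟨by linarith, hS.le⟩ ht hτ
      · exact (ct cet r).intervalIntegrable _ _
    have st2 : II 0 t 0 b (fun z => chi b z.2 * et z) = (Real.log (1 + b))⁻¹ * II 0 t 0 b (fun z => rho z.2 * f z) := by
      rw [← II_mul]
      refine intervalIntegral.integral_congr fun τ hτ => ?_
      have hτ' := uIcc_subset_Icc ⟨by linarith, hS.le⟩ ht hτ
      dsimp only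
      have ftc := intervalIntegral.integral_eq_sub_of_hasDerivAt_of_le (a := 0) (b := b) (f := fun r => chi b r * f (τ, r))
        (f' := fun r => -(Real.log (1 + b))⁻¹ * rho r * f (τ, r) + chi b r * et (τ, r)) b0.le (by fun_prop)
        (fun r hr => (chi_has hr.1.le).fun_mul (hf τ hτ' r hr.1)) (Continuous.intervalIntegrable (by fun_prop) _ _)
      rw [f0, chi_b b0] at ftc
      rw [intervalIntegral.integral_add (Continuous.intervalIntegrable (by fun_prop) _ _) (Continuous.intervalIntegrable (by fun_prop) _ _)] at ftc
      have e3 : ∫ r in (0:ℝ)..b, -(Real.log (1 + b))⁻¹ * rho r * f (τ, r) = - ∫ r in (0:ℝ)..b, (Real.log (1 + b))⁻¹ * (rho r * f (τ, r)) := by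
        rw [← intervalIntegral.integral_neg]; congr 1; ext r; ring
      rw [e3] at ftc
      linarith
    have st3 : ‖II 0 t 0 b (fun z => rho z.2 * f z)‖ ≤ C := by
      have cg := ci (F := fun z => rho z.2 * f z) (by fun_prop) 0 b
      refine (intervalIntegral.norm_integral_le_integral_norm_uIoc).trans ?_
      have sub : uIoc 0 t ⊆ Ioc (-S) S := by
        intro x hx
        have := uIoc_subset_uIcc hx
        have h2 := uIcc_subset_Icc (⟨by linarith, hS.le⟩ : (0:ℝ) ∈ Icc (-S) S) ht this
        refine ⟨?_, h2.2⟩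
        have : min 0 t < x := hx.1
        exact lt_of_le_of_lt (le_min (by linarith) ht.1) this
      refine (setIntegral_mono_set (cg.norm.integrableOn_Ioc) (Eventually.of_forall fun _ => norm_nonneg _) sub.eventuallyLE).trans ?_
      rw [← intervalIntegral.integral_of_le (by linarith)]
      refine le_trans ?_ (hC b hb)
      have cg2 := ci (F := fun z => rho z.2 * |f z|) (by fun_prop) 0 b
      refine int_mono0 cg.norm cg2 (by linarith) fun τ _ => ?_
      refine (intervalIntegral.norm_integral_le_integral_norm b0.le).trans (le_of_eq ?_)
      congr 1; ext r
      rw [norm_mul, Real.norm_eq_abs, Real.norm_eq_abs, abs_of_pos (rho_pos r)]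
    rw [st1, st2, norm_mul, Real.norm_eq_abs, abs_of_pos (inv_pos.2 L), div_eq_inv_mul]
    exact mul_le_mul_of_nonneg_left st3 (inv_pos.2 L).le
  have l1 : Tendsto (fun b : ℝ => Real.log (1 + b)) atTop atTop :=
    Real.tendsto_log_atTop.comp (tendsto_atTop_add_const_left _ _ tendsto_id)
  have z : Tendsto (fun b : ℝ => ∫ r in (0:ℝ)..b, chi b r * (e (t, r) - e (0, r))) atTop (𝓝 0) :=
    squeeze_zero_norm' (by filter_upwards [eventually_ge_atTop 1] with b hb using bd b hb) (l1.const_div_atTop C)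
  have := tendsto_nhds_unique lim z
  rw [integral_sub it i0] at this
  linarith

noncomputable def hd (p : ℝ × ℝ → ℝ) (z : ℝ × ℝ) : ℝ := ∫ σ in (0:ℝ)..1, dR p (z.1, σ * z.2)

theorem hd_cont {p : ℝ × ℝ → ℝ} (hp : Sm p) : Continuous (hd p) := by
  have c := hp.dR.cont
  exact intervalIntegral.continuous_parametric_intervalIntegral_of_continuous'
    (f := fun (z : ℝ × ℝ) σ => dR p (z.1, σ * z.2)) (by fun_prop) 0 1

theorem hd_mul {p : ℝ × ℝ → ℝ} (hp : Sm p) (p0 : ∀ t, p (t, 0) = 0) (t r : ℝ) : r * hd p (t, r) = p (t, r) := by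
  have c := hp.dR.cont
  rw [hd, ← intervalIntegral.integral_const_mul]
  rw [intervalIntegral.integral_eq_sub_of_hasDerivAt (f := fun σ => p (t, σ * r))]
  · simp [p0]
  · intro σ _
    have := (hp.hasR t (σ * r)).comp σ ((hasDerivAt_id' σ).mul_const r)
    refine this.congr_deriv ?_
    ring
  · exact Continuous.intervalIntegrable (by fun_prop) _ _

theorem hd_T {p : ℝ × ℝ → ℝ} (hp : Sm p) (t r : ℝ) : HasDerivAt (fun t => hd p (t, r)) (hd (dT p) (t, r)) t := by
  have c := hp.dR.cont; have c2 := hp.dT.dR.cont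
  refine hasDerivAt_int' (f := fun z => dR p (z.1, z.2 * r)) (f' := fun z => dR (dT p) (z.1, z.2 * r)) (by fun_prop) (by fun_prop) (fun t σ => ?_) 0 1 t
  have := hp.dR.hasT t (σ * r)
  rw [hp.comm] at this
  exact this

theorem dT0 {p : ℝ × ℝ → ℝ} (hp : Sm p) (p0 : ∀ t, p (t, 0) = 0) (t : ℝ) : dT p (t, 0) = 0 := by
  refine (hp.hasT t 0).unique ?_
  simp only [p0]
  exact hasDerivAt_const t 0

noncomputable def jj (p s : ℝ × ℝ → ℝ) (z : ℝ × ℝ) : ℝ := p z * dR s z - s z * dR p z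

theorem rj_has {p s : ℝ × ℝ → ℝ} (hp : Sm p) (hs : Sm s) (t r : ℝ) : HasDerivAt (fun r => r * jj p s (t, r))
    (jj p s (t, r) + r * (p (t, r) * dR (dR s) (t, r) - s (t, r) * dR (dR p) (t, r))) r := by
  have h := (hasDerivAt_id' r).fun_mul (((hp.hasR t r).fun_mul (hs.dR.hasR t r)).fun_sub ((hs.hasR t r).fun_mul (hp.dR.hasR t r)))
  refine h.congr_deriv ?_
  unfold jj
  ring

theorem UD.massid {m T M : ℝ} {p s A : ℝ × ℝ → ℝ} (H : UD m p s A T M) {t : ℝ} (ht : t ∈ Icc (-T) T) {r : ℝ} (hr : 0 < r) :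
    (p (t, r) * dT p (t, r) + s (t, r) * dT s (t, r)) * r = -(jj p s (t, r) + r * (p (t, r) * dR (dR s) (t, r) - s (t, r) * dR (dR p) (t, r))) := by
  have e1 := H.e1 t ht r hr
  have e2 := H.e2 t ht r hr
  unfold jj
  have rr : r * r⁻¹ = 1 := mul_inv_cancel₀ hr.ne'
  simp only [div_eq_mul_inv] at e1 e2
  linear_combination (p (t, r) * e2 - s (t, r) * e1) * r - (p (t, r) * dR s (t, r) - s (t, r) * dR p (t, r)) * rr

theorem UD.rjT {m T M : ℝ} {p s A : ℝ × ℝ → ℝ} (H : UD m p s A T M) {t : ℝ} (ht : t ∈ Icc (-T) T) {r : ℝ} (hr : 0 < r) :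
    HasDerivAt (fun r => -2 * (r * jj p s (t, r))) (2 * (p (t, r) * dT p (t, r) + s (t, r) * dT s (t, r)) * r) r := by
  refine ((rj_has H.hp H.hs t r).const_mul (-2)).congr_deriv ?_
  have := H.massid ht hr
  linarith

theorem UD.ath_T {m T M : ℝ} {p s A : ℝ × ℝ → ℝ} (H : UD m p s A T M) {t : ℝ} (ht : t ∈ Icc (-T) T) {r : ℝ} (hr : 0 ≤ r) :
    HasDerivAt (fun t => ath p s (t, r)) (r * jj p s (t, r)) t := by
  have hp := H.hp; have hs := H.hs
  have c1 := hp.cont; have c2 := hs.cont; have c3 := hp.dT.cont; have c4 := hs.dT.cont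
  have c5 := hp.dR.cont; have c6 := hs.dR.cont
  have cj : Continuous (jj p s) := by unfold jj; fun_prop
  have h := (hasDerivAt_int' (f := fun z => (p z ^ 2 + s z ^ 2) * z.2) (f' := fun z => 2 * (p z * dT p z + s z * dT s z) * z.2)
    (by fun_prop) (by fun_prop) (fun t r => by
      refine ((((hp.hasT t r).fun_pow 2).fun_add ((hs.hasT t r).fun_pow 2)).mul_const r).congr_deriv ?_
      push_cast; ring) 0 r t).const_mul (-(1 / 2))
  refine h.congr_deriv ?_
  dsimp only
  rw [intervalIntegral.integral_eq_sub_of_hasDerivAt_of_le (f := fun r => -2 * (r * jj p s (t, r))) hr (by fun_prop)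
    (fun r hr => H.rjT ht hr.1) (Continuous.intervalIntegrable (by fun_prop) _ _)]
  ring

theorem UD.massc {m T M : ℝ} {p s A : ℝ × ℝ → ℝ} (H : UD m p s A T M) {t : ℝ} (ht : t ∈ Icc (-(T / 2)) (T / 2)) :
    ∫ r in Ioi 0, (p (t, r) ^ 2 + s (t, r) ^ 2) * r = ∫ r in Ioi 0, (p (0, r) ^ 2 + s (0, r) ^ 2) * r := by
  have hp := H.hp; have hs := H.hs; have hT := H.hT
  have c1 := hp.cont; have c2 := hs.cont; have c3 := hp.dT.cont; have c4 := hs.dT.cont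
  have c5 := hp.dR.cont; have c6 := hs.dR.cont
  have crr := rho_cont
  have cj : Continuous (jj p s) := by unfold jj; fun_prop
  obtain ⟨C, C0, hC⟩ := H.J
  have T2 : ∀ t ∈ Icc (-(T / 2)) (T / 2), t ∈ Icc (-T) T := fun t ht => ⟨by linarith [ht.1], by linarith [ht.2]⟩
  have int : ∀ t ∈ Icc (-(T / 2)) (T / 2), IntegrableOn (fun r => (p (t, r) ^ 2 + s (t, r) ^ 2) * r) (Ioi 0) := fun t ht =>
    (iff_bdd (by fun_prop) fun r hr => by positivity).2 ⟨M, H.mass t (T2 t ht)⟩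
  refine cons (e := fun z => (p z ^ 2 + s z ^ 2) * z.2) (et := fun z => 2 * (p z * dT p z + s z * dT s z) * z.2)
    (f := fun z => -2 * (z.2 * jj p s z)) (S := T / 2) (C := 2 * C) (by linarith) (by fun_prop) (by fun_prop) (by fun_prop)
    (fun t _ r _ => ?_) (fun t ht r hr => H.rjT (T2 t ht) hr) (fun t => by simp) (fun b hb => ?_) ht (int 0 ⟨by linarith, by linarith⟩) (int t ht)
  · refine ((((hp.hasT t r).fun_pow 2).fun_add ((hs.hasT t r).fun_pow 2)).mul_const r).congr_deriv ?_
    push_cast; ring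
  · have : (fun z : ℝ × ℝ => rho z.2 * |-2 * (z.2 * jj p s z)|) = fun z => 2 * (rho z.2 * |z.2 * (p z * dR s z - s z * dR p z)|) := by
      ext z; rw [abs_mul, jj]; norm_num; ring
    rw [this, II_mul]
    exact mul_le_mul_of_nonneg_left (hC b hb) (by norm_num)


noncomputable def en (m : ℝ) (p s : ℝ × ℝ → ℝ) (z : ℝ × ℝ) : ℝ :=
  1 / 2 * ((dR p z ^ 2 + dR s z ^ 2) * z.2) + 1 / 2 * ((m + ath p s z) ^ 2 * (hd p z ^ 2 + hd s z ^ 2) * z.2) - 1 / 4 * ((p z ^ 2 + s z ^ 2) ^ 2 * z.2)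

noncomputable def ent (m : ℝ) (p s : ℝ × ℝ → ℝ) (z : ℝ × ℝ) : ℝ :=
  (dR p z * dR (dT p) z + dR s z * dR (dT s) z) * z.2
  + (m + ath p s z) * (z.2 * jj p s z) * (hd p z ^ 2 + hd s z ^ 2) * z.2
  + (m + ath p s z) ^ 2 * (hd p z * hd (dT p) z + hd s z * hd (dT s) z) * z.2
  - (p z ^ 2 + s z ^ 2) * (p z * dT p z + s z * dT s z) * z.2

noncomputable def enf (m : ℝ) (p s : ℝ × ℝ → ℝ) (z : ℝ × ℝ) : ℝ :=
  -(z.2 * (dR p z * dR (dR s) z - dR s z * dR (dR p) z)) - (m + ath p s z) ^ 2 * (hd p z * dR s z - hd s z * dR p z)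
  + z.2 * (p z ^ 2 + s z ^ 2) * jj p s z

theorem UD.en_T {m T M : ℝ} {p s A : ℝ × ℝ → ℝ} (H : UD m p s A T M) {t : ℝ} (ht : t ∈ Icc (-T) T) {r : ℝ} (hr : 0 ≤ r) :
    HasDerivAt (fun t => en m p s (t, r)) (ent m p s (t, r)) t := by
  have hp := H.hp; have hs := H.hs
  have d1 := hp.dR.hasT t r; have d2 := hs.dR.hasT t r
  rw [hp.comm] at d1; rw [hs.comm] at d2
  have a1 := (((d1.fun_pow 2).fun_add (d2.fun_pow 2)).mul_const r).const_mul (1 / 2 : ℝ)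
  have a2 := ((((((H.ath_T ht hr).const_add m).fun_pow 2).fun_mul (((hd_T hp t r).fun_pow 2).fun_add ((hd_T hs t r).fun_pow 2))).mul_const r)).const_mul (1 / 2 : ℝ)
  have a3 := (((((hp.hasT t r).fun_pow 2).fun_add ((hs.hasT t r).fun_pow 2)).fun_pow 2).mul_const r).const_mul (1 / 4 : ℝ)
  refine ((a1.fun_add a2).fun_sub a3).congr_deriv ?_
  unfold ent
  push_cast
  ring

theorem algf {r m' A p s pr sr prr srr pt st a b : ℝ} (hr : 0 < r) (ha : r * a = p) (hb : r * b = s)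
    (e1 : -st - A * p + prr + pr / r - (m' / r) ^ 2 * p + (p ^ 2 + s ^ 2) * p = 0)
    (e2 : pt - A * s + srr + sr / r - (m' / r) ^ 2 * s + (p ^ 2 + s ^ 2) * s = 0) :
    -(r * (pr * srr - sr * prr)) - m' ^ 2 * (a * sr - b * pr) + r * (p ^ 2 + s ^ 2) * (p * sr - s * pr)
     = r * (pr * pt + sr * st) + r * A * (p * sr - s * pr) := by
  have h1 : st = - A * p + prr + pr / r - (m' / r) ^ 2 * p + (p ^ 2 + s ^ 2) * p := by linarith
  have h2 : pt = A * s - srr - sr / r + (m' / r) ^ 2 * s - (p ^ 2 + s ^ 2) * s := by linarith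
  subst h1 h2 ha hb
  field_simp
  ring

theorem algd {r m' A p s pr sr prr srr pt st ptr str a b at' bt Ar : ℝ} (hr : 0 < r) (ha : r * a = p) (hb : r * b = s)
    (hat : r * at' = pt) (hbt : r * bt = st) (hA : Ar = m' * (p ^ 2 + s ^ 2) / r)
    (e1 : -st - A * p + prr + pr / r - (m' / r) ^ 2 * p + (p ^ 2 + s ^ 2) * p = 0)
    (e2 : pt - A * s + srr + sr / r - (m' / r) ^ 2 * s + (p ^ 2 + s ^ 2) * s = 0) :
    (pr * pt + sr * st) + r * (prr * pt + pr * ptr + (srr * st + sr * str)) + ((A + r * Ar) * (p * sr - s * pr) + r * A * (p * srr - s * prr))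
     = (pr * ptr + sr * str) * r + m' * (r * (p * sr - s * pr)) * (a ^ 2 + b ^ 2) * r + m' ^ 2 * (a * at' + b * bt) * r
        - (p ^ 2 + s ^ 2) * (p * pt + s * st) * r := by
  have i1 : prr = st + A * p - pr / r + (m' / r) ^ 2 * p - (p ^ 2 + s ^ 2) * p := by linarith
  have i2 : srr = - pt + A * s - sr / r + (m' / r) ^ 2 * s - (p ^ 2 + s ^ 2) * s := by linarith
  subst i1 i2 hA hat hbt ha hb
  field_simp
  ring

theorem UD.enf_eq {m T M : ℝ} {p s A : ℝ × ℝ → ℝ} (H : UD m p s A T M) {t : ℝ} (ht : t ∈ Icc (-T) T) {r : ℝ} (hr : 0 < r) :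
    enf m p s (t, r) = r * (dR p (t, r) * dT p (t, r) + dR s (t, r) * dT s (t, r)) + r * A (t, r) * (p (t, r) * dR s (t, r) - s (t, r) * dR p (t, r)) :=
  algf hr (hd_mul H.hp H.p0 t r) (hd_mul H.hs H.s0 t r) (H.e1 t ht r hr) (H.e2 t ht r hr)

theorem UD.enf_R {m T M : ℝ} {p s A : ℝ × ℝ → ℝ} (H : UD m p s A T M) {t : ℝ} (ht : t ∈ Icc (-T) T) {r : ℝ} (hr : 0 < r) :
    HasDerivAt (fun r => enf m p s (t, r)) (ent m p s (t, r)) r := by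
  have hp := H.hp; have hs := H.hs
  have h1 := (hasDerivAt_id' r).fun_mul (((hp.dR.hasR t r).fun_mul (hp.dT.hasR t r)).fun_add ((hs.dR.hasR t r).fun_mul (hs.dT.hasR t r)))
  have h2 := ((hasDerivAt_id' r).fun_mul (H.hA t ht r hr)).fun_mul (((hp.hasR t r).fun_mul (hs.dR.hasR t r)).fun_sub ((hs.hasR t r).fun_mul (hp.dR.hasR t r)))
  have h := h1.fun_add h2
  refine (h.congr_deriv ?_).congr_of_eventuallyEq ?_
  · have := algd (ptr := dR (dT p) (t, r)) (str := dR (dT s) (t, r)) hr (hd_mul H.hp H.p0 t r) (hd_mul H.hs H.s0 t r) (hd_mul H.hp.dT (dT0 hp H.p0) t r) (hd_mul H.hs.dT (dT0 hs H.s0) t r) rfl (H.e1 t ht r hr) (H.e2 t ht r hr)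
    unfold ent jj
    dsimp only
    rw [← this]
    ring
  · filter_upwards [Ioi_mem_nhds hr] with x hx
    exact H.enf_eq ht hx

theorem enf_0 {m : ℝ} {p s : ℝ × ℝ → ℝ} (hp : Sm p) (hs : Sm s) (t : ℝ) : enf m p s (t, 0) = 0 := by
  have h : ∀ p, hd p (t, 0) = dR p (t, 0) := fun p => by simp [hd]
  unfold enf
  simp only [h]
  ring

theorem alg5 {r k d p s pr sr prr srr a b D0 Q0 : ℝ} (hr : 2 ≤ r) (k0 : 0 ≤ k) (k1 : k ≤ 1) (ha : r * a = p) (hb : r * b = s)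
    (hd : d ^ 2 ≤ D0) (hq : p ^ 2 + s ^ 2 ≤ Q0) :
    k * |-(r * (pr * srr - sr * prr)) - d ^ 2 * (a * sr - b * pr) + r * (p ^ 2 + s ^ 2) * (p * sr - s * pr)| ≤
     k ^ 2 * ((prr ^ 2 + srr ^ 2) * r) + (1 + D0 + Q0) * ((pr ^ 2 + sr ^ 2) * r + (p ^ 2 + s ^ 2) * r) := by
  have r0 : 0 < r := by linarith
  have D00 : 0 ≤ D0 := (sq_nonneg _).trans hd
  have Q00 : 0 ≤ Q0 := le_trans (by positivity) hq
  have b1 : k * |r * (pr * srr - sr * prr)| ≤ k ^ 2 * ((prr ^ 2 + srr ^ 2) * r) + (pr ^ 2 + sr ^ 2) * r := by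
    rw [abs_mul, abs_of_pos r0]
    have : k * |pr * srr - sr * prr| ≤ k ^ 2 * (prr ^ 2 + srr ^ 2) + (pr ^ 2 + sr ^ 2) := by
      rw [← abs_of_nonneg k0, ← abs_mul, abs_of_nonneg k0, abs_le]
      constructor <;> nlinarith [sq_nonneg (pr + k * srr), sq_nonneg (pr - k * srr), sq_nonneg (sr + k * prr), sq_nonneg (sr - k * prr), sq_nonneg pr, sq_nonneg sr, sq_nonneg (k * prr), sq_nonneg (k * srr)]
    have := mul_le_mul_of_nonneg_right this r0.le
    linarith
  have gen : ∀ x y : ℝ, |x * sr - y * pr| ≤ (pr ^ 2 + sr ^ 2) + (x ^ 2 + y ^ 2) := fun x y => by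
    rw [abs_le]
    constructor <;> nlinarith [sq_nonneg (x + sr), sq_nonneg (x - sr), sq_nonneg (y + pr), sq_nonneg (y - pr), sq_nonneg x, sq_nonneg y, sq_nonneg pr, sq_nonneg sr]
  have ab : a ^ 2 + b ^ 2 ≤ p ^ 2 + s ^ 2 := by
    rw [← ha, ← hb, mul_pow, mul_pow, ← mul_add]
    exact le_mul_of_one_le_left (by positivity) (one_le_pow₀ (by linarith))
  have X0 : 0 ≤ (pr ^ 2 + sr ^ 2) + (p ^ 2 + s ^ 2) := by positivity
  have b2 : k * |d ^ 2 * (a * sr - b * pr)| ≤ D0 * (((pr ^ 2 + sr ^ 2) + (p ^ 2 + s ^ 2)) * r) := by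
    refine (mul_le_of_le_one_left (abs_nonneg _) k1).trans ?_
    rw [abs_mul, abs_of_nonneg (sq_nonneg d)]
    refine mul_le_mul hd ?_ (abs_nonneg _) D00
    have := gen a b
    have := le_mul_of_one_le_right X0 (by linarith : 1 ≤ r)
    linarith
  have b3 : k * |r * (p ^ 2 + s ^ 2) * (p * sr - s * pr)| ≤ Q0 * (((pr ^ 2 + sr ^ 2) + (p ^ 2 + s ^ 2)) * r) := by
    refine (mul_le_of_le_one_left (abs_nonneg _) k1).trans ?_
    have : r * (p ^ 2 + s ^ 2) * (p * sr - s * pr) = (p ^ 2 + s ^ 2) * ((p * sr - s * pr) * r) := by ring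
    rw [this, abs_mul, abs_mul, abs_of_pos r0, abs_of_nonneg (by positivity : 0 ≤ p ^ 2 + s ^ 2)]
    exact mul_le_mul hq (mul_le_mul_of_nonneg_right (gen p s) r0.le) (by positivity) Q00
  have tri : |-(r * (pr * srr - sr * prr)) - d ^ 2 * (a * sr - b * pr) + r * (p ^ 2 + s ^ 2) * (p * sr - s * pr)| ≤
      |r * (pr * srr - sr * prr)| + |d ^ 2 * (a * sr - b * pr)| + |r * (p ^ 2 + s ^ 2) * (p * sr - s * pr)| := by
    refine (abs_add_le _ _).trans ?_
    gcongr
    refine (abs_sub _ _).trans ?_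
    rw [abs_neg]
  have := mul_le_mul_of_nonneg_left tri k0
  have : 0 ≤ (p ^ 2 + s ^ 2) * r := by positivity
  linarith

theorem UD.en_int {m T M : ℝ} {p s A : ℝ × ℝ → ℝ} (H : UD m p s A T M) {t : ℝ} (ht : t ∈ Icc (-T) T) :
    IntegrableOn (fun r => en m p s (t, r)) (Ioi 0) ↔ ∃ C, ∀ B, 0 ≤ B → ∫ r in (0:ℝ)..B, (dR p (t, r) ^ 2 + dR s (t, r) ^ 2) * r ≤ C := by
  have hp := H.hp; have hs := H.hs
  exact (H.ov ht).eint (a := fun r => hd p (t, r)) (b := fun r => hd s (t, r)) (D := fun r => m + ath p s (t, r)) (cr (hd_cont hp) t) (cr (hd_cont hs) t)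
    (continuous_const.add (cr (ath_cont hp hs) t)) (hd_mul hp H.p0 t) (hd_mul hs H.s0 t) (fun r hr => H.D_bd ht hr)

theorem UD.enc {m T M : ℝ} {p s A : ℝ × ℝ → ℝ} (H : UD m p s A T M) (hi : IntegrableOn (fun r => en m p s (0, r)) (Ioi 0)) {t : ℝ} (ht : t ∈ Icc (-(T / 4)) (T / 4)) :
    IntegrableOn (fun r => en m p s (t, r)) (Ioi 0) ∧ ∫ r in Ioi 0, en m p s (t, r) = ∫ r in Ioi 0, en m p s (0, r) := by
  have hp := H.hp; have hs := H.hs; have hT := H.hT; have hM := H.hM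
  have T2 : ∀ t ∈ Icc (-(T / 4)) (T / 4), t ∈ Icc (-(T / 2)) (T / 2) := fun t ht => ⟨by linarith [ht.1], by linarith [ht.2]⟩
  have T1 : ∀ t ∈ Icc (-(T / 4)) (T / 4), t ∈ Icc (-T) T := fun t ht => ⟨by linarith [ht.1], by linarith [ht.2]⟩
  obtain ⟨E1, hE⟩ := (H.en_int ⟨by linarith, hT.le⟩).1 hi
  obtain ⟨C1, C10, hC1⟩ := H.H1 hE
  obtain ⟨C2, C20, hC2⟩ := H.H2 hE
  obtain ⟨Q0, Q00, hQ⟩ := H.qbd hC1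
  have it := (H.en_int (T1 t ht)).2 ⟨C1, hC1 t (T2 t ht)⟩
  refine ⟨it, ?_⟩
  have c1 := hp.cont; have c2 := hs.cont; have c3 := hp.dR.cont; have c4 := hs.dR.cont
  have c7 := hp.dR.dR.cont; have c8 := hs.dR.dR.cont
  have c9 := hp.dT.cont; have c10 := hs.dT.cont; have c11 := hp.dT.dR.cont; have c12 := hs.dT.dR.cont
  have h1 := hd_cont hp; have h2 := hd_cont hs; have h3 := hd_cont hp.dT; have h4 := hd_cont hs.dT
  have h5 := ath_cont hp hs
  have crr := rho_cont
  have cj : Continuous (jj p s) := by unfold jj; fun_prop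
  have ce : Continuous (en m p s) := by unfold en; fun_prop
  have cet : Continuous (ent m p s) := by unfold ent; fun_prop
  have cf : Continuous (enf m p s) := by unfold enf; fun_prop
  obtain ⟨K, K0, hK⟩ := bdd (F := fun z => rho z.2 * |enf m p s z|) (by fun_prop) (-(T / 4)) (T / 4) 0 2
  set N := 1 + (m + M) ^ 2 + Q0 with hN
  have N0 : 0 ≤ N := by positivity
  refine cons (S := T / 4) (C := (T / 4 - -(T / 4)) * (2 * K) + (C2 + (T / 4 - -(T / 4)) * (N * C1 + N * M))) (by linarith) ce cet cf
    (fun t ht r hr => H.en_T (T1 t ht) hr) (fun t ht r hr => H.enf_R (T1 t ht) hr) (enf_0 hp hs) (fun R hR => ?_) ht hi it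
  have R0 : 0 ≤ R := by linarith
  set G1 : ℝ × ℝ → ℝ := fun z => rho z.2 ^ 2 * ((dR (dR p) z ^ 2 + dR (dR s) z ^ 2) * z.2) with hG1
  set G2 : ℝ × ℝ → ℝ := fun z => N * ((dR p z ^ 2 + dR s z ^ 2) * z.2) + N * ((p z ^ 2 + s z ^ 2) * z.2) with hG2
  have cG1 : Continuous G1 := by rw [hG1]; fun_prop
  have cG2 : Continuous G2 := by rw [hG2]; fun_prop
  have := dom2 (F := fun z => rho z.2 * |enf m p s z|) (G := fun z => G1 z + G2 z)
    (by fun_prop) (by fun_prop) K0 (by linarith : -(T / 4) ≤ T / 4) (fun t ht r hr => by simp only [hG1, hG2]; positivity) (fun t ht r hr => (le_abs_self _).trans (hK t ht r hr))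
    (fun t ht r hr => by
      have r0 : 0 ≤ r := by linarith
      have := alg5 (pr := dR p (t, r)) (sr := dR s (t, r)) (prr := dR (dR p) (t, r)) (srr := dR (dR s) (t, r)) hr (rho_pos r).le (rho_le r0) (hd_mul hp H.p0 t r) (hd_mul hs H.s0 t r) (H.D_bd (T1 t ht) r0) (hQ t (T2 t ht) r hr)
      simp only [hG1, hG2, enf, jj]
      rw [← mul_add]
      exact this) R0
  rw [II_add cG1 cG2] at this
  have i1 := hC2 R hR
  have i2 : II (-(T / 4)) (T / 4) 0 R G2 ≤ (T / 4 - -(T / 4)) * (N * C1 + N * M) := by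
    refine II_ub cG2 (by linarith) fun t ht => ?_
    simp only [hG2]
    rw [int_add2 (by fun_prop) (by fun_prop)]
    have a1 := mul_le_mul_of_nonneg_left (hC1 t (T2 t ht) R R0) N0
    have a2 := mul_le_mul_of_nonneg_left (H.mass t (T1 t ht) R R0) N0
    linarith
  linarith


theorem AtL {q D : ℝ → ℝ} {d M : ℝ} (cq : Continuous q) (cD : Continuous D) (q0 : ∀ r, 0 ≤ q r)
    (hD : ∀ r, 0 ≤ r → |D r| ≤ d) (hM : ∀ b, 0 ≤ b → ∫ r in (0:ℝ)..b, q r * r ≤ M) :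
    (∀ r, 0 < r → HasDerivAt (fun r => -∫ σ in Ioi r, D σ * q σ / σ) (D r * q r / r) r) ∧
    (∀ r, 2 ≤ r → |-∫ σ in Ioi r, D σ * q σ / σ| ≤ d * M) := by
  have d0 : 0 ≤ d := (abs_nonneg _).trans (hD 0 le_rfl)
  have iq : IntegrableOn (fun r => q r * r) (Ioi 0) := (iff_bdd (by fun_prop) fun r hr => mul_nonneg (q0 r) hr).2 ⟨M, hM⟩
  have iM : ∫ r in Ioi 0, q r * r ≤ M := by
    refine le_of_tendsto (intervalIntegral_tendsto_integral_Ioi 0 iq tendsto_id) ?_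
    filter_upwards [eventually_ge_atTop 0] with b hb using hM b hb
  have cG : ContinuousOn (fun σ => D σ * q σ / σ) (Ioi 0) :=
    ContinuousOn.div (by fun_prop) continuousOn_id fun σ hσ => ne_of_gt hσ
  have bdG : ∀ r0, 0 < r0 → ∀ σ, r0 < σ → ‖D σ * q σ / σ‖ ≤ (d * (r0 ^ 2)⁻¹) * (q σ * σ) := by
    intro r0 h0 σ hσ
    have s0 : 0 < σ := h0.trans hσ
    rw [norm_div, norm_mul, Real.norm_eq_abs, Real.norm_eq_abs, Real.norm_eq_abs, abs_of_nonneg (q0 σ), abs_of_pos s0]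
    have e : |D σ| * q σ / σ = (|D σ| * (σ ^ 2)⁻¹) * (q σ * σ) := by field_simp
    rw [e]
    refine mul_le_mul_of_nonneg_right ?_ (mul_nonneg (q0 σ) s0.le)
    refine mul_le_mul (hD σ s0.le) ?_ (by positivity) d0
    exact inv_anti₀ (by positivity) (pow_le_pow_left₀ h0.le hσ.le 2)
  have iG : ∀ r0, 0 < r0 → IntegrableOn (fun σ => D σ * q σ / σ) (Ioi r0) := by
    intro r0 h0
    have sub : Ioi r0 ⊆ Ioi 0 := Ioi_subset_Ioi h0.le
    refine Integrable.mono' ((iq.mono_set sub).const_mul (d * (r0 ^ 2)⁻¹)) ((cG.mono sub).aestronglyMeasurable measurableSet_Ioi) ?_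
    exact (ae_restrict_iff' measurableSet_Ioi).2 (Eventually.of_forall fun σ hσ => bdG r0 h0 σ hσ)
  constructor
  · intro r hr
    have h2 : 0 < r / 2 := by linarith
    have hI : IntervalIntegrable (fun σ => D σ * q σ / σ) volume (r / 2) r := by
      rw [intervalIntegrable_iff_integrableOn_Ioc_of_le (by linarith)]
      exact (iG _ h2).mono_set Ioc_subset_Ioi_self
    have ftc := intervalIntegral.integral_hasDerivAt_right hI
      (ContinuousOn.stronglyMeasurableAtFilter isOpen_Ioi cG r hr) (cG.continuousAt (Ioi_mem_nhds hr))
    refine (ftc.sub_const (∫ σ in Ioi (r / 2), D σ * q σ / σ)).congr_of_eventuallyEq ?_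
    filter_upwards [Ioi_mem_nhds (show r / 2 < r by linarith)] with x hx
    have hx : r / 2 < x := hx
    have hI2 : IntervalIntegrable (fun σ => D σ * q σ / σ) volume (r / 2) x := by
      rw [intervalIntegrable_iff_integrableOn_Ioc_of_le hx.le]
      exact (iG _ h2).mono_set Ioc_subset_Ioi_self
    have := intervalIntegral.integral_interval_add_Ioi' hI2 (iG x (h2.trans hx))
    linarith
  · intro r hr
    rw [abs_neg, ← Real.norm_eq_abs]
    have r0 : 0 < r := by linarith
    have sub : Ioi r ⊆ Ioi (0:ℝ) := Ioi_subset_Ioi r0.le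
    calc ‖∫ σ in Ioi r, D σ * q σ / σ‖ ≤ ∫ σ in Ioi r, d * (q σ * σ) := by
          refine norm_integral_le_of_norm_le ((iq.mono_set sub).const_mul d) ?_
          refine (ae_restrict_iff' measurableSet_Ioi).2 (Eventually.of_forall fun σ hσ => ?_)
          have hσ : r < σ := hσ
          refine (bdG 1 one_pos σ (by linarith)).trans (le_of_eq ?_)
          norm_num
      _ = d * ∫ σ in Ioi r, q σ * σ := integral_const_mul _ _
      _ ≤ d * M := by
          refine mul_le_mul_of_nonneg_left (le_trans ?_ iM) d0
          exact setIntegral_mono_set iq ((ae_restrict_iff' measurableSet_Ioi).2 (Eventually.of_forall fun σ hσ => mul_nonneg (q0 σ) (le_of_lt hσ))) sub.eventuallyLE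

theorem U0 {m : ℕ} (hm : 1 ≤ m) {f : ℝ → ℂ} {U : ℝ × ℝ → ℂ} (cU : Continuous U)
    (h : ∀ x : ℝ × ℝ, x ≠ 0 → U x = f (Real.sqrt (x.1 ^ 2 + x.2 ^ 2)) *
        (((x.1 : ℂ) + (x.2 : ℂ) * Complex.I) / ((Real.sqrt (x.1 ^ 2 + x.2 ^ 2) : ℝ) : ℂ)) ^ m) :
    (∀ r, 0 < r → U (r, 0) = f r) ∧ U (0, 0) = 0 := by
  have m0 : (m : ℝ) ≠ 0 := by positivity
  have h1 : ∀ r, 0 < r → U (r, 0) = f r := by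
    intro r hr
    rw [h (r, 0) (by simp [hr.ne'])]
    have : (r : ℂ) ≠ 0 := by exact_mod_cast hr.ne'
    simp [Real.sqrt_sq hr.le, this]
  refine ⟨h1, ?_⟩
  set φ := Real.pi / m with hφ
  have h2 : ∀ r, 0 < r → U (r * Real.cos φ, r * Real.sin φ) = - f r := by
    intro r hr
    have e : (r * Real.cos φ) ^ 2 + (r * Real.sin φ) ^ 2 = r ^ 2 := by
      have := Real.sin_sq_add_cos_sq φ
      linear_combination r ^ 2 * this
    have rc : (r : ℂ) ≠ 0 := by exact_mod_cast hr.ne'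
    rw [h _ (by
      intro h0
      rw [Prod.mk_eq_zero] at h0
      rw [h0.1, h0.2] at e
      have : 0 < r ^ 2 := by positivity
      linarith)]
    dsimp only
    rw [e, Real.sqrt_sq hr.le]
    have e2 : (((r * Real.cos φ : ℝ) : ℂ) + ((r * Real.sin φ : ℝ) : ℂ) * Complex.I) / (r : ℂ) = Complex.exp (φ * Complex.I) := by
      rw [Complex.exp_mul_I]
      push_cast
      field_simp
    rw [e2, ← Complex.exp_nat_mul]
    have e3 : (m : ℂ) * (φ * Complex.I) = Real.pi * Complex.I := by
      have : (m : ℂ) ≠ 0 := by exact_mod_cast m0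
      rw [hφ]; push_cast; field_simp
    rw [e3, Complex.exp_pi_mul_I]
    ring
  have l1 : Tendsto (fun r : ℝ => U (r, 0)) (𝓝[>] 0) (𝓝 (U (0, 0))) := by
    have : Continuous fun r : ℝ => U (r, 0) := by fun_prop
    exact (this.tendsto 0).mono_left nhdsWithin_le_nhds
  have l2 : Tendsto (fun r : ℝ => U (r * Real.cos φ, r * Real.sin φ)) (𝓝[>] 0) (𝓝 (U (0, 0))) := by
    have : Continuous fun r : ℝ => U (r * Real.cos φ, r * Real.sin φ) := by fun_prop
    have := (this.tendsto 0).mono_left (nhdsWithin_le_nhds (s := Ioi 0))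
    simpa using this
  have l3 : Tendsto (fun r : ℝ => U (r, 0)) (𝓝[>] 0) (𝓝 (-U (0, 0))) := by
    refine l2.neg.congr' ?_
    filter_upwards [self_mem_nhdsWithin] with r hr
    rw [h1 r hr, h2 r hr, neg_neg]
  have := tendsto_nhds_unique l1 l3
  exact CharZero.eq_neg_self_iff.1 this

theorem ext_sm {m : ℕ} (hm : 1 ≤ m) {I : Set ℝ} (hIo : IsOpen I) {u : ℝ → ℝ → ℂ} (hu : IsCSS m I u) {t0 T : ℝ} (hT : 0 < T)
    (hI : Icc (t0 - 2 * T) (t0 + 2 * T) ⊆ I) :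
    ∃ p s : ℝ × ℝ → ℝ, Sm p ∧ Sm s ∧ (∀ t, p (t, 0) = 0) ∧ (∀ t, s (t, 0) = 0) ∧
      ∀ t ∈ Ioo (-(3 / 2 * T)) (3 / 2 * T), ∀ r, 0 < r → u (t0 + t) r = (p (t, r) : ℂ) + (s (t, r) : ℂ) * Complex.I := by
  obtain ⟨U, hU, hUe⟩ := hu.equivariant
  let θ : ContDiffBump (0:ℝ) := ⟨3 / 2 * T, 2 * T, by linarith, by linarith⟩
  let v : ℝ × ℝ → ℂ := fun z => (θ z.1) • U (t0 + z.1) (z.2, 0)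
  have θ0 : ∀ t, t0 + t ∉ I → θ t = 0 := by
    intro t ht
    refine θ.zero_of_le_dist ?_
    by_contra hc
    have hc : |t - 0| < 2 * T := not_le.1 hc
    rw [sub_zero, abs_lt] at hc
    exact ht (hI ⟨by linarith [hc.1], by linarith [hc.2]⟩)
  have cont : ∀ τ ∈ I, Continuous (U τ) := by
    intro τ hτ
    have : ContinuousOn (fun x : ℝ × ℝ => U τ x) univ :=
      hU.continuousOn.comp (f := fun x : ℝ × ℝ => (τ, x)) (by fun_prop) fun x _ => ⟨hτ, mem_univ _⟩
    exact continuousOn_univ.1 this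
  have vs : ContDiff ℝ ∞ v := by
    rw [contDiff_iff_contDiffAt]
    rintro ⟨t, r⟩
    by_cases h : t0 + t ∈ I
    · have a1 : ContDiffAt ℝ ∞ (fun p : ℝ × (ℝ × ℝ) => U p.1 p.2) (t0 + t, (r, 0)) :=
        hU.contDiffAt ((hIo.prod isOpen_univ).mem_nhds ⟨h, mem_univ _⟩)
      have a2 : ContDiffAt ℝ ∞ (fun z : ℝ × ℝ => (t0 + z.1, (z.2, (0:ℝ)))) (t, r) := by fun_prop
      have a3 : ContDiffAt ℝ ∞ (fun z : ℝ × ℝ => θ z.1) (t, r) := (θ.contDiff.comp contDiff_fst).contDiffAt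
      have a4 : ContDiffAt ℝ ∞ (fun z : ℝ × ℝ => U (t0 + z.1) (z.2, 0)) (t, r) :=
        ContDiffAt.comp (g := fun p : ℝ × (ℝ × ℝ) => U p.1 p.2) (f := fun z : ℝ × ℝ => (t0 + z.1, (z.2, (0:ℝ)))) (t, r) a1 a2
      exact a3.smul a4
    · have hm2 : 2 * T < |t| := by
        by_contra hc
        have hc := abs_le.1 (not_lt.1 hc)
        exact h (hI ⟨by linarith [hc.1], by linarith [hc.2]⟩)
      have ev : v =ᶠ[𝓝 (t, r)] fun _ => 0 := by
        have : {z : ℝ × ℝ | 2 * T < |z.1|} ∈ 𝓝 (t, r) :=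
          (isOpen_lt (by fun_prop) (by fun_prop)).mem_nhds hm2
        filter_upwards [this] with z hz
        have : θ z.1 = 0 := by
          refine θ.zero_of_le_dist ?_
          rw [Real.dist_eq, sub_zero]
          exact le_of_lt hz
        simp [v, this]
      exact contDiffAt_const.congr_of_eventuallyEq ev
  have v0 : ∀ t, v (t, 0) = 0 := by
    intro t
    by_cases h : t0 + t ∈ I
    · have := (U0 hm (cont _ h) (hUe _ h)).2
      simp [v, this]
    · simp [v, θ0 t h]
  refine ⟨fun z => (v z).re, fun z => (v z).im, Complex.reCLM.contDiff.comp vs, Complex.imCLM.contDiff.comp vs,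
    fun t => by simp [v0], fun t => by simp [v0], fun t ht r hr => ?_⟩
  have tI : t0 + t ∈ I := hI ⟨by linarith [ht.1], by linarith [ht.2]⟩
  have θ1 : θ t = 1 := by
    refine θ.one_of_mem_closedBall ?_
    rw [Metric.mem_closedBall, Real.dist_eq, sub_zero, abs_le]
    exact ⟨ht.1.le, ht.2.le⟩
  rw [Complex.re_add_im]
  simp only [v, θ1, one_smul]
  exact ((U0 hm (cont _ tI) (hUe _ tI)).1 r hr).symm


theorem nsq (a b : ℝ) : ‖(a : ℂ) + (b : ℂ) * Complex.I‖ ^ 2 = a ^ 2 + b ^ 2 := by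
  rw [← Complex.normSq_eq_norm_sq, Complex.normSq_add_mul_I]

theorem hasC {f g : ℝ → ℝ} {f' g' x : ℝ} (hf : HasDerivAt f f' x) (hg : HasDerivAt g g' x) :
    HasDerivAt (fun x => (f x : ℂ) + (g x : ℂ) * Complex.I) ((f' : ℂ) + (g' : ℂ) * Complex.I) x :=
  hf.ofReal_comp.fun_add (hg.ofReal_comp.mul_const _)

theorem csplit {A p s pt st pr sr prr srr D r q : ℝ} {N : ℂ} (hN : N = (q : ℂ))
    (h : Complex.I * ((pt : ℂ) + (st : ℂ) * Complex.I) - (A : ℂ) * ((p : ℂ) + (s : ℂ) * Complex.I)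
      + ((prr : ℂ) + (srr : ℂ) * Complex.I) + (1 / (r : ℂ)) * ((pr : ℂ) + (sr : ℂ) * Complex.I)
      - ((D / r : ℝ) : ℂ) ^ 2 * ((p : ℂ) + (s : ℂ) * Complex.I) + N * ((p : ℂ) + (s : ℂ) * Complex.I) = 0) :
    -st - A * p + prr + pr / r - (D / r) ^ 2 * p + q * p = 0 ∧ pt - A * s + srr + sr / r - (D / r) ^ 2 * s + q * s = 0 := by
  subst hN
  have k : ((-st - A * p + prr + pr / r - (D / r) ^ 2 * p + q * p : ℝ) : ℂ) + ((pt - A * s + srr + sr / r - (D / r) ^ 2 * s + q * s : ℝ) : ℂ) * Complex.I = 0 := by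
    rw [← h]
    push_cast
    linear_combination (-st : ℂ) * Complex.I_sq
  have h1 := congrArg Complex.re k
  have h2 := congrArg Complex.im k
  simp only [Complex.add_re, Complex.ofReal_re, Complex.re_ofReal_mul, Complex.I_re, mul_zero, add_zero, Complex.zero_re,
    Complex.add_im, Complex.ofReal_im, Complex.im_ofReal_mul, Complex.I_im, mul_one, zero_add, Complex.zero_im] at h1 h2
  exact ⟨h1, h2⟩

theorem red {m : ℕ} (hm : 1 ≤ m) {I : Set ℝ} (hIo : IsOpen I) {u : ℝ → ℝ → ℂ} (hu : IsCSS m I u) {t0 T : ℝ} (hT : 0 < T)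
    (hI : Icc (t0 - 2 * T) (t0 + 2 * T) ⊆ I) :
    ∃ (p s A : ℝ × ℝ → ℝ) (M : ℝ), UD m p s A T M ∧ ∀ t ∈ Icc (-T) T,
      L2sq (u (t0 + t)) = 2 * Real.pi * ∫ r in Ioi 0, (p (t, r) ^ 2 + s (t, r) ^ 2) * r ∧
      Energy m (u (t0 + t)) = 2 * Real.pi * ∫ r in Ioi 0, en m p s (t, r) ∧
      EqOn (fun r => ((1 / 2) * ‖deriv (u (t0 + t)) r‖ ^ 2
      + (1 / 2) * (((m : ℝ) + Atheta (u (t0 + t)) r) / r) ^ 2 * ‖u (t0 + t) r‖ ^ 2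
      - (1 / 4) * ‖u (t0 + t) r‖ ^ 4) * r) (fun r => en m p s (t, r)) (Ioi 0) := by
  obtain ⟨p, s, hp, hs, p0, s0, huv⟩ := ext_sm hm hIo hu hT hI
  obtain ⟨C, hC⟩ := hu.bounded (Icc (t0 - 2 * T) (t0 + 2 * T)) hI isCompact_Icc
  have c1 := hp.cont; have c2 := hs.cont
  have TI : ∀ t ∈ Icc (-T) T, t0 + t ∈ Icc (t0 - 2 * T) (t0 + 2 * T) := fun t ht => ⟨by linarith [ht.1], by linarith [ht.2]⟩
  have TO : ∀ t ∈ Icc (-T) T, t ∈ Ioo (-(3 / 2 * T)) (3 / 2 * T) := fun t ht => ⟨by linarith [ht.1], by linarith [ht.2]⟩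
  have nu : ∀ t ∈ Icc (-T) T, ∀ r, 0 < r → ‖u (t0 + t) r‖ ^ 2 = p (t, r) ^ 2 + s (t, r) ^ 2 := fun t ht r hr => by
    rw [huv t (TO t ht) r hr, nsq]
  have hath : ∀ t ∈ Icc (-T) T, ∀ r, 0 < r → Atheta (u (t0 + t)) r = ath p s (t, r) := fun t ht r hr => by
    unfold Atheta ath
    congr 1
    rw [intervalIntegral.integral_of_le hr.le, intervalIntegral.integral_of_le hr.le]
    refine setIntegral_congr_fun measurableSet_Ioc fun σ hσ => ?_
    dsimp only
    rw [nu t ht σ hσ.1]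
  have dr : ∀ t ∈ Icc (-T) T, ∀ r, 0 < r → deriv (u (t0 + t)) r = (dR p (t, r) : ℂ) + (dR s (t, r) : ℂ) * Complex.I := fun t ht r hr => by
    refine HasDerivAt.deriv ((hasC (hp.hasR t r) (hs.hasR t r)).congr_of_eventuallyEq ?_)
    filter_upwards [Ioi_mem_nhds hr] with x hx using huv t (TO t ht) x hx
  have drr : ∀ t ∈ Icc (-T) T, ∀ r, 0 < r → deriv (deriv (u (t0 + t))) r = (dR (dR p) (t, r) : ℂ) + (dR (dR s) (t, r) : ℂ) * Complex.I := fun t ht r hr => by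
    refine HasDerivAt.deriv ((hasC (hp.dR.hasR t r) (hs.dR.hasR t r)).congr_of_eventuallyEq ?_)
    filter_upwards [Ioi_mem_nhds hr] with x hx using dr t ht x hx
  have dt : ∀ t ∈ Icc (-T) T, ∀ r, 0 < r → deriv (fun τ => u τ r) (t0 + t) = (dT p (t, r) : ℂ) + (dT s (t, r) : ℂ) * Complex.I := fun t ht r hr => by
    have h := hasC (hp.hasT t r) (hs.hasT t r)
    have sh : HasDerivAt (fun τ : ℝ => τ - t0) 1 (t0 + t) := (hasDerivAt_id' _).sub_const t0
    have et : t0 + t - t0 = t := by ring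
    have h2 := HasDerivAt.scomp (𝕜' := ℝ) (t0 + t) (g₁ := fun x => (p (x, r) : ℂ) + (s (x, r) : ℂ) * Complex.I) (h := fun τ : ℝ => τ - t0) (by rw [et]; exact h) sh
    rw [one_smul] at h2
    refine HasDerivAt.deriv (h2.congr_of_eventuallyEq ?_)
    have o := TO t ht
    filter_upwards [Ioo_mem_nhds (show t0 - 3 / 2 * T < t0 + t by linarith [o.1]) (show t0 + t < t0 + 3 / 2 * T by linarith [o.2])] with x hx
    have := huv (x - t0) ⟨by linarith [hx.1], by linarith [hx.2]⟩ r hr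
    rw [add_sub_cancel] at this
    exact this
  set M := max 1 (C ^ 2) with hM
  have mass : ∀ t ∈ Icc (-T) T, ∀ b, 0 ≤ b → ∫ r in (0:ℝ)..b, (p (t, r) ^ 2 + s (t, r) ^ 2) * r ≤ M := by
    intro t ht b hb
    have h1 : ∫ r in (0:ℝ)..b, (p (t, r) ^ 2 + s (t, r) ^ 2) * r = ∫ r in Ioc 0 b, ‖u (t0 + t) r‖ ^ 2 * r := by
      rw [intervalIntegral.integral_of_le hb]
      refine setIntegral_congr_fun measurableSet_Ioc fun σ hσ => ?_
      try dsimp only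
      rw [nu t ht σ hσ.1]
    have ae0 : 0 ≤ᵐ[volume.restrict (Ioi (0:ℝ))] fun r => ‖u (t0 + t) r‖ ^ 2 * r :=
      (ae_restrict_iff' measurableSet_Ioi).2 (Eventually.of_forall fun σ hσ => mul_nonneg (by positivity) (le_of_lt hσ))
    have h2 : ∫ r in Ioc 0 b, ‖u (t0 + t) r‖ ^ 2 * r ≤ ∫ r in Ioi 0, ‖u (t0 + t) r‖ ^ 2 * r :=
      setIntegral_mono_set (hu.integrable _ (hI (TI t ht))) ae0 Ioc_subset_Ioi_self.eventuallyLE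
    have h3 : 0 ≤ ∫ r in Ioi 0, ‖u (t0 + t) r‖ ^ 2 * r := integral_nonneg_of_ae ae0
    have h4 : ∫ r in Ioi 0, ‖u (t0 + t) r‖ ^ 2 * r ≤ L2sq (u (t0 + t)) := by
      unfold L2sq
      refine le_mul_of_one_le_left h3 ?_
      linarith [Real.pi_gt_three]
    have h5 := hC _ (TI t ht)
    have h6 := Real.sqrt_nonneg (H1msq m (u (t0 + t)))
    have h7 : L2sq (u (t0 + t)) ≤ C ^ 2 := by
      rw [← Real.sq_sqrt (h3.trans h4)]
      exact pow_le_pow_left₀ (Real.sqrt_nonneg _) (by linarith) 2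
    rw [h1]
    exact h2.trans (h4.trans (h7.trans (le_max_right _ _)))
  have M1 : 1 ≤ M := le_max_left _ _
  set A : ℝ × ℝ → ℝ := fun z => At m (u (t0 + z.1)) z.2 with hA
  have mm : (0:ℝ) ≤ m := Nat.cast_nonneg m
  have athb : ∀ t ∈ Icc (-T) T, ∀ r, 0 ≤ r → |(m:ℝ) + ath p s (t, r)| ≤ m + M := by
    intro t ht r hr
    have h1 := mass t ht r hr
    have h2 : 0 ≤ ∫ r in (0:ℝ)..r, (p (t, r) ^ 2 + s (t, r) ^ 2) * r :=
      intervalIntegral.integral_nonneg hr fun σ hσ => mul_nonneg (by positivity) hσ.1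
    rw [ath, abs_le]
    constructor <;> dsimp only <;> linarith
  have Aeq : ∀ t ∈ Icc (-T) T, ∀ r, 0 < r → A (t, r) = -∫ σ in Ioi r, ((m:ℝ) + ath p s (t, σ)) * (p (t, σ) ^ 2 + s (t, σ) ^ 2) / σ := by
    intro t ht r hr
    simp only [hA, At]
    congr 1
    refine setIntegral_congr_fun measurableSet_Ioi fun σ hσ => ?_
    have σ0 : 0 < σ := hr.trans hσ
    try dsimp only
    rw [nu t ht σ σ0, hath t ht σ σ0]
  have cath := ath_cont hp hs
  have aL := fun t ht => AtL (q := fun σ => p (t, σ) ^ 2 + s (t, σ) ^ 2) (D := fun σ => (m:ℝ) + ath p s (t, σ)) (by fun_prop) (by fun_prop)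
    (fun r => by positivity) (athb t ht) (mass t ht)
  have eqs : ∀ t ∈ Icc (-T) T, ∀ r : ℝ, 0 < r →
      (-dT s (t, r) - A (t, r) * p (t, r) + dR (dR p) (t, r) + dR p (t, r) / r - (((m:ℝ) + ath p s (t, r)) / r) ^ 2 * p (t, r) + (p (t, r) ^ 2 + s (t, r) ^ 2) * p (t, r) = 0 ∧
      dT p (t, r) - A (t, r) * s (t, r) + dR (dR s) (t, r) + dR s (t, r) / r - (((m:ℝ) + ath p s (t, r)) / r) ^ 2 * s (t, r) + (p (t, r) ^ 2 + s (t, r) ^ 2) * s (t, r) = 0) := fun t ht r hr => by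
    have h := hu.eq _ (hI (TI t ht)) r hr
    unfold CSSeq at h
    rw [dt t ht r hr, dr t ht r hr, drr t ht r hr, hath t ht r hr] at h
    have hn : (((‖u (t0 + t) r‖ : ℝ) : ℂ)) ^ 2 = ((p (t, r) ^ 2 + s (t, r) ^ 2 : ℝ) : ℂ) := by
      rw [← nu t ht r hr]; push_cast; rfl
    rw [huv t (TO t ht) r hr] at h hn
    exact csplit hn h
  have H : UD m p s A T M := by
    refine ⟨hp, hs, p0, s0, hT, M1, mm, mass, fun t ht r hr => (eqs t ht r hr).1, fun t ht r hr => (eqs t ht r hr).2, ?_, (m + M) * M, by positivity, ?_⟩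
    · intro t ht r hr
      refine ((aL t ht).1 r hr).congr_of_eventuallyEq ?_
      filter_upwards [Ioi_mem_nhds hr] with x hx using Aeq t ht x hx
    · intro t ht r hr
      rw [Aeq t ht r (by linarith)]
      exact (aL t ht).2 r hr
  have eo : ∀ t ∈ Icc (-T) T, EqOn (fun r => ((1 / 2) * ‖deriv (u (t0 + t)) r‖ ^ 2
      + (1 / 2) * (((m : ℝ) + Atheta (u (t0 + t)) r) / r) ^ 2 * ‖u (t0 + t) r‖ ^ 2
      - (1 / 4) * ‖u (t0 + t) r‖ ^ 4) * r) (fun r => en m p s (t, r)) (Ioi 0) := by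
    intro t ht r hr
    have hr : 0 < r := hr
    have e4 : ‖u (t0 + t) r‖ ^ 4 = (‖u (t0 + t) r‖ ^ 2) ^ 2 := by ring
    dsimp only
    rw [e4, nu t ht r hr, hath t ht r hr, dr t ht r hr, nsq]
    unfold en
    have a1 := hd_mul hp p0 t r
    have a2 := hd_mul hs s0 t r
    dsimp only
    generalize hd p (t, r) = a at *
    generalize hd s (t, r) = b at *
    rw [← a1, ← a2]
    field_simp
  refine ⟨p, s, A, M, H, fun t ht => ⟨?_, ?_, eo t ht⟩⟩
  · unfold L2sq
    congr 1
    refine setIntegral_congr_fun measurableSet_Ioi fun r hr => ?_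
    try dsimp only
    rw [nu t ht r hr]
  · unfold Energy
    congr 1
    exact setIntegral_congr_fun measurableSet_Ioi (eo t ht)

def EI (m : ℕ) (u : ℝ → ℂ) : Prop := IntegrableOn (fun r => ((1 / 2) * ‖deriv u r‖ ^ 2
      + (1 / 2) * (((m : ℝ) + Atheta u r) / r) ^ 2 * ‖u r‖ ^ 2
      - (1 / 4) * ‖u r‖ ^ 4) * r) (Ioi 0)

theorem loc {m : ℕ} (hm : 1 ≤ m) {I : Set ℝ} (hIo : IsOpen I) {u : ℝ → ℝ → ℂ} (hu : IsCSS m I u) {t0 T : ℝ} (hT : 0 < T)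
    (hI : Icc (t0 - 2 * T) (t0 + 2 * T) ⊆ I) {t : ℝ} (ht : t ∈ Icc (t0 - T / 4) (t0 + T / 4)) :
    L2sq (u t) = L2sq (u t0) ∧ (EI m (u t0) → EI m (u t) ∧ Energy m (u t) = Energy m (u t0)) := by
  obtain ⟨p, s, A, M, H, h⟩ := red hm hIo hu hT hI
  have h0 := h 0 ⟨by linarith, hT.le⟩
  have h1 := h (t - t0) ⟨by linarith [ht.1], by linarith [ht.2]⟩
  rw [add_zero] at h0
  rw [add_sub_cancel] at h1
  refine ⟨?_, fun hi => ?_⟩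
  · rw [h0.1, h1.1, H.massc (t := t - t0) ⟨by linarith [ht.1], by linarith [ht.2]⟩]
  · have hi' : IntegrableOn (fun r => en m p s (0, r)) (Ioi 0) := (integrableOn_congr_fun h0.2.2 measurableSet_Ioi).1 hi
    have k := H.enc hi' (t := t - t0) ⟨by linarith [ht.1], by linarith [ht.2]⟩
    exact ⟨(integrableOn_congr_fun h1.2.2 measurableSet_Ioi).2 k.1, by rw [h0.2.1, h1.2.1, k.2]⟩

theorem loc2 {m : ℕ} (hm : 1 ≤ m) {I : Set ℝ} (hIo : IsOpen I) {u : ℝ → ℝ → ℂ} (hu : IsCSS m I u) {t0 : ℝ} (h0 : t0 ∈ I) :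
    ∀ᶠ t in 𝓝 t0, L2sq (u t) = L2sq (u t0) ∧ Energy m (u t) = Energy m (u t0) := by
  obtain ⟨ε, ε0, hε⟩ := Metric.isOpen_iff.1 hIo t0 h0
  have hT : 0 < ε / 8 := by linarith
  have sub : ∀ x, |x - t0| < ε → x ∈ I := fun x hx => hε hx
  filter_upwards [Icc_mem_nhds (show t0 - ε / 8 / 4 < t0 by linarith) (show t0 < t0 + ε / 8 / 4 by linarith)] with t ht
  have A := loc hm hIo hu hT (t0 := t0) (fun x hx => sub x (by rw [abs_lt]; constructor <;> linarith [hx.1, hx.2])) ht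
  have B := loc hm hIo hu hT (t0 := t) (t := t0) (fun x hx => sub x (by rw [abs_lt]; constructor <;> linarith [hx.1, hx.2, ht.1, ht.2]))
    ⟨by linarith [ht.2], by linarith [ht.1]⟩
  refine ⟨A.1, ?_⟩
  by_cases hi : EI m (u t0)
  · exact (A.2 hi).2
  · have hi2 : ¬ EI m (u t) := fun h => hi (B.2 h).1
    have z : ∀ v, ¬ EI m v → Energy m v = 0 := fun v hv => by
      unfold Energy
      rw [integral_undef hv, mul_zero]
    rw [z _ hi, z _ hi2]

theorem fin19 {m : ℕ} (hm : 1 ≤ m) {I : Set ℝ} (hIo : IsOpen I) (hIc : I.OrdConnected) {u : ℝ → ℝ → ℂ} (hu : IsCSS m I u) :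
    ∀ t ∈ I, ∀ s ∈ I, L2sq (u t) = L2sq (u s) ∧ Energy m (u t) = Energy m (u s) := by
  intro t ht s hs
  have pc : PreconnectedSpace I := isPreconnected_iff_preconnectedSpace.1 hIc.isPreconnected
  let F : I → ℝ × ℝ := fun x => (L2sq (u x), Energy m (u x))
  have lc : IsLocallyConstant F := by
    rw [IsLocallyConstant.iff_eventually_eq]
    intro x
    have := continuous_subtype_val.continuousAt.eventually (loc2 hm hIo hu x.2)
    filter_upwards [this] with y hy
    exact Prod.ext hy.1 hy.2
  have := lc.apply_eq_of_preconnectedSpace ⟨t, ht⟩ ⟨s, hs⟩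
  exact ⟨congrArg Prod.fst this, congrArg Prod.snd this⟩

end Aux

/-- conservation laws: the mass and the energy are constant in time. -/
theorem stmt19 (m : ℕ) (hm : 1 ≤ m) (I : Set ℝ) (hIo : IsOpen I) (hIc : I.OrdConnected)
    (u : ℝ → ℝ → ℂ) (hu : IsCSS m I u)
    (hbd : ∀ J : Set ℝ, J ⊆ I → IsCompact J → ∀ j k : ℕ, j + k ≤ 2 →
      ∃ C : ℝ, ∀ t ∈ J,
        2 * Real.pi * ∫ r in Set.Ioi (0:ℝ),
          (1 + r ^ 4) * ‖deriv^[j] (fun s => deriv^[k] (u s) r) t‖ ^ 2 * r ≤ C) :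
    ∀ t ∈ I, ∀ s ∈ I,
      L2sq (u t) = L2sq (u s) ∧ Energy m (u t) = Energy m (u s) := by
  exact fin19 hm hIo hIc hu
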